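/- Write s_m = s_{m+1,m} for m = 1,…,n, set q_k = q for k < n and q_n = q², and [2] = q + q^{−1}. For each k = 1,…,n there exists an F-algebra automorphism β_k of U_q^{tw}(gl_n) such that: β_k(s_k) = −s_k; β_k(s_m) = s_m for m ∉ {k−1, k, k+1}; β_k(s_{k+1}) = (q_k − q_k^{−1})^{−1}(q_k s_{k+1} s_k − s_k s_{k+1}) for k ≠ n−1, n; β_k(s_{k−1}) = (q_k − q_k^{−1})^{−1}(s_k s_{k−1} − q_k s_{k−1} s_k) for k ≠ 1, n; β_{n−1}(s_n) = −[2]^{−1}(q − q^{−1})^{−2}(s_{n−1}² s_n − q[2] s_{n−1} s_n s_{n−1} + q² s_n s_{n−1}²) − s_n; and β_n(s_{n−1}) = √−1 (q² − q^{−2})^{−1}(s_n s_{n−1} − q² s_{n−1} s_n). -/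

import Mathlib

noncomputable section

set_option synthInstance.maxHeartbeats 1000000
set_option maxHeartbeats 1000000

namespace CI

/-- The ground field F = ℂ(q). -/
abbrev F : Type := RatFunc ℂ

/-- The formal variable q. -/
def q : F := RatFunc.X

/-- The index involution i ↦ i′ = 2n+1−i (here in 0-based form i ↦ 2n−1−i). -/
def pr (n : ℕ) (i : Fin (2*n)) : Fin (2*n) := ⟨2*n - 1 - i.val, by have := i.isLt; omega⟩

/-- ε_i = 1 for i ≤ n and ε_i = −1 for i > n (1-based). -/
def eps (n : ℕ) (i : Fin (2*n)) : F := if (i : ℕ) < n then 1 else -1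

/-- (1̄,…,n̄,(n+1)̄,…,(2n)̄) = (n,…,1,−1,…,−n). -/
def bar (n : ℕ) (i : Fin (2*n)) : ℤ :=
  if (i : ℕ) < n then (n : ℤ) - (i : ℕ) else (n : ℤ) - (i : ℕ) - 1

/-- The diagonal entries of D = diag(qⁿ,…,q,q⁻¹,…,q⁻ⁿ): D_{ii} = q^{ī}. -/
def dd (n : ℕ) (i : Fin (2*n)) : F := q ^ (bar n i)

/-- The entries of the R-matrix R = Σ_{i,j} q^{δ_{ij}−δ_{ij′}} e_{ii} ⊗ e_{jj}
    + (q−q⁻¹) Σ_{i<j} e_{ij} ⊗ e_{ji}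
    − (q−q⁻¹) Σ_{i<j} q^{j̄−ī} ε_i ε_j e_{ij} ⊗ e_{i′j′}. -/
def Rm (n : ℕ) (p s : Fin (2*n) × Fin (2*n)) : F :=
  (if p.1 = s.1 ∧ p.2 = s.2 then
      q ^ ((if p.1 = p.2 then (1:ℤ) else 0) - (if p.1 = pr n p.2 then (1:ℤ) else 0)) else 0)
  + (if p.1 < p.2 ∧ s.1 = p.2 ∧ s.2 = p.1 then q - q⁻¹ else 0)
  - (if p.1 < s.1 ∧ p.2 = pr n p.1 ∧ s.2 = pr n s.1 then
      (q - q⁻¹) * q ^ (bar n s.1 - bar n p.1) * eps n p.1 * eps n s.1 else 0)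

/-- Generators t_{ij}, t̄_{ij} of the extended algebra. -/
inductive Gen (n : ℕ) : Type
  | t (i j : Fin (2*n)) : Gen n
  | tb (i j : Fin (2*n)) : Gen n

/-- The free F-algebra on the generators. -/
abbrev FA (n : ℕ) : Type := FreeAlgebra F (Gen n)

def tF (n : ℕ) (i j : Fin (2*n)) : FA n := FreeAlgebra.ι F (Gen.t i j)
def tbF (n : ℕ) (i j : Fin (2*n)) : FA n := FreeAlgebra.ι F (Gen.tb i j)

/-- The defining relations of the RTT presentation U_q(sp_{2n}): the triangularity
    and diagonal relations, the entrywise RTT relations R T₁ T₂ = T₂ T₁ R,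
    R T̄₁ T̄₂ = T̄₂ T̄₁ R, R T̄₁ T₂ = T₂ T̄₁ R, and the entrywise central relations
    T D Tᵗ D⁻¹ = T̄ D T̄ᵗ D⁻¹ = I, D Tᵗ D⁻¹ T = D T̄ᵗ D⁻¹ T̄ = I
    (where ᵗ is the twisted transposition e_{ij}ᵗ = ε_i ε_j e_{j′i′}). -/
inductive rel (n : ℕ) : FA n → FA n → Prop
  | t_upper (i j : Fin (2*n)) (h : i < j) : rel n (tF n i j) 0
  | tb_lower (i j : Fin (2*n)) (h : j < i) : rel n (tbF n i j) 0
  | t_tb_diag (i : Fin (2*n)) : rel n (tF n i i * tbF n i i) 1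
  | tb_t_diag (i : Fin (2*n)) : rel n (tbF n i i * tF n i i) 1
  | rtt_tt (i a j b : Fin (2*n)) :
      rel n (∑ k, ∑ c, Rm n (i, a) (k, c) • (tF n k j * tF n c b))
            (∑ c, ∑ l, Rm n (l, c) (j, b) • (tF n a c * tF n i l))
  | rtt_bb (i a j b : Fin (2*n)) :
      rel n (∑ k, ∑ c, Rm n (i, a) (k, c) • (tbF n k j * tbF n c b))
            (∑ c, ∑ l, Rm n (l, c) (j, b) • (tbF n a c * tbF n i l))
  | rtt_bt (i a j b : Fin (2*n)) :
      rel n (∑ k, ∑ c, Rm n (i, a) (k, c) • (tbF n k j * tF n c b))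
            (∑ c, ∑ l, Rm n (l, c) (j, b) • (tF n a c * tbF n i l))
  | cent_t1 (i j : Fin (2*n)) :
      rel n (∑ k, (dd n k * (dd n j)⁻¹ * eps n (pr n k) * eps n (pr n j)) •
              (tF n i k * tF n (pr n j) (pr n k)))
            (if i = j then 1 else 0)
  | cent_tb1 (i j : Fin (2*n)) :
      rel n (∑ k, (dd n k * (dd n j)⁻¹ * eps n (pr n k) * eps n (pr n j)) •
              (tbF n i k * tbF n (pr n j) (pr n k)))
            (if i = j then 1 else 0)
  | cent_t2 (i j : Fin (2*n)) :
      rel n (∑ k, (dd n i * (dd n k)⁻¹ * eps n (pr n i) * eps n (pr n k)) •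
              (tF n (pr n k) (pr n i) * tF n k j))
            (if i = j then 1 else 0)
  | cent_tb2 (i j : Fin (2*n)) :
      rel n (∑ k, (dd n i * (dd n k)⁻¹ * eps n (pr n i) * eps n (pr n k)) •
              (tbF n (pr n k) (pr n i) * tbF n k j))
            (if i = j then 1 else 0)

/-- The RTT presentation U_q(sp_{2n}). -/
abbrev Usp (n : ℕ) : Type := RingQuot (rel n)

/-- The generator t_{ij} of U_q(sp_{2n}). -/
def tU (n : ℕ) (i j : Fin (2*n)) : Usp n := RingQuot.mkAlgHom F (rel n) (tF n i j)

/-- The generator t̄_{ij} of U_q(sp_{2n}). -/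
def tbU (n : ℕ) (i j : Fin (2*n)) : Usp n := RingQuot.mkAlgHom F (rel n) (tbF n i j)

/-- The entries s_{ij} = Σ_{k=j}^{i} ε_k t_{ik} t̄_{jk} of the matrix S = T J T̄^u. -/
def sU (n : ℕ) (i j : Fin (2*n)) : Usp n :=
  ∑ k ∈ Finset.Icc j i, eps n k • (tU n i k * tbU n j k)

/-- The entries s̄_{ij} = ε_i ε_j Σ_{k=j}^{i} ε_{k′} t̄_{i′k′} t_{j′k′} of the
    matrix S̄ = T̄^{ut} Jᵗ Tᵗ. -/
def sbU (n : ℕ) (i j : Fin (2*n)) : Usp n :=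
  (eps n i * eps n j) • ∑ k ∈ Finset.Icc j i,
    eps n (pr n k) • (tbU n (pr n i) (pr n k) * tU n (pr n j) (pr n k))

/-- The twisted quantized enveloping algebra U_q^{tw}(gl_n): the subalgebra of
    U_q(sp_{2n}) generated by the entries of S. -/
def Utw (n : ℕ) : Subalgebra F (Usp n) :=
  Algebra.adjoin F (Set.range fun p : Fin (2*n) × Fin (2*n) => sU n p.1 p.2)

/-- The generator s_m = s_{m+1,m} in 1-based indexing (junk value 0 out of range). -/
def sg (n : ℕ) (m : ℕ) : Usp n :=
  if h : 1 ≤ m ∧ m + 1 ≤ 2*n then sU n ⟨m, by omega⟩ ⟨m - 1, by omega⟩ else 0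

/-- q_k = q for k < n and q_n = q² (1-based). -/
def qk (n : ℕ) (k : ℕ) : F := if k < n then q else q^2

/-- The defining property of the automorphism β_k of U_q^{tw}(gl_n): its action on the
    generators s_1, …, s_n (s_m = s_{m+1,m}). -/
def IsBeta (n k : ℕ) (β : Utw n ≃ₐ[F] Utw n) : Prop :=
  ∀ (m : ℕ) (x : Utw n), 1 ≤ m → m ≤ n → (x : Usp n) = sg n m →
    (m = k → ((β x : Usp n) = -sg n k)) ∧
    (m ≠ k - 1 ∧ m ≠ k ∧ m ≠ k + 1 → ((β x : Usp n) = sg n m)) ∧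
    (m = k + 1 → k ≠ n - 1 → k ≠ n →
      ((β x : Usp n) = (qk n k - (qk n k)⁻¹)⁻¹ •
        (qk n k • (sg n (k+1) * sg n k) - sg n k * sg n (k+1)))) ∧
    (m = k - 1 → k ≠ 1 → k ≠ n →
      ((β x : Usp n) = (qk n k - (qk n k)⁻¹)⁻¹ •
        (sg n k * sg n (k-1) - qk n k • (sg n (k-1) * sg n k)))) ∧
    (k = n - 1 → m = n →
      ((β x : Usp n) = (-((q + q⁻¹)⁻¹ * ((q - q⁻¹)^2)⁻¹)) •
          (sg n (n-1) ^ 2 * sg n n - (q * (q + q⁻¹)) • (sg n (n-1) * sg n n * sg n (n-1))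
            + q^2 • (sg n n * sg n (n-1) ^ 2))
        - sg n n)) ∧
    (k = n → m = n - 1 →
      ((β x : Usp n) = (RatFunc.C Complex.I * (q^2 - (q^2)⁻¹)⁻¹) •
        (sg n n * sg n (n-1) - q^2 • (sg n (n-1) * sg n n))))

set_option linter.unusedSimpArgs false
set_option linter.unusedSectionVars false

section
theorem pr_pr (n) (i : Fin (2*n)) : pr n (pr n i) = i := by
  ext; simp [pr]; omega

theorem pr_inj (n) {i j : Fin (2*n)} : pr n i = pr n j ↔ i = j :=
  ⟨fun h => by rw [← pr_pr n i, h, pr_pr], fun h => by rw [h]⟩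

theorem pr_ne (n) (i : Fin (2*n)) : pr n i ≠ i := by
  intro h; have := congrArg Fin.val h; simp [pr] at this; omega

theorem eq_pr_comm (n) {i j : Fin (2*n)} : i = pr n j ↔ j = pr n i := by
  constructor <;> (rintro rfl; rw [pr_pr])

theorem pr_lt_pr (n) {i j : Fin (2*n)} : pr n i < pr n j ↔ j < i := by
  simp only [Fin.lt_def, pr]; omega

theorem bar_pr (n) (i : Fin (2*n)) : bar n (pr n i) = - bar n i := by
  have := i.isLt
  simp only [bar, pr]; split_ifs <;> omega

theorem eps_pr (n) (i : Fin (2*n)) : eps n (pr n i) = - eps n i := by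
  have := i.isLt
  by_cases h : (i : ℕ) < n
  · have h' : ¬ (2 * n - 1 - (i : ℕ) < n) := by omega
    simp [eps, pr, h, h']
  · have h' : (2 * n - 1 - (i : ℕ) < n) := by omega
    simp [eps, pr, h, h']

theorem eps_mul_self (n) (i : Fin (2*n)) : eps n i * eps n i = 1 := by
  simp only [eps]; split_ifs <;> simp

theorem q_ne : q ≠ 0 := RatFunc.X_ne_zero

/-- symmetry of the R-matrix -/
theorem Rm_symm (n) (x y i b : Fin (2*n)) : Rm n (x,y) (i,b) = Rm n (b,i) (y,x) := by
  unfold Rm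
  congr 1
  · congr 1
    · by_cases h : x = i ∧ y = b
      · obtain ⟨rfl, rfl⟩ := h
        simp only [and_self, if_true]
        simp only [eq_comm (a := y) (b := x), eq_pr_comm n (i := y)]
      · rw [if_neg h, if_neg]; simp only; tauto
    · simp only
      refine if_congr ?_ rfl rfl
      constructor <;> (rintro ⟨h, rfl, rfl⟩; exact ⟨h, rfl, rfl⟩)
  · simp only
    by_cases h : x < i ∧ y = pr n x ∧ b = pr n i
    · obtain ⟨h, rfl, rfl⟩ := h
      rw [if_pos ⟨h, rfl, rfl⟩, if_pos ⟨(pr_lt_pr n).2 h, (pr_pr n _).symm, (pr_pr n _).symm⟩]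
      simp only [bar_pr, eps_pr]
      ring_nf
    · rw [if_neg h, if_neg]
      rintro ⟨h1, rfl, rfl⟩
      exact h ⟨(pr_lt_pr n).2 h1, (pr_pr n _).symm, (pr_pr n _).symm⟩

theorem Rm_row {M : Type*} [AddCommGroup M] [Module F M] (n) (i a : Fin (2*n))
    (f : Fin (2*n) → Fin (2*n) → M) :
    ∑ k, ∑ c, Rm n (i,a) (k,c) • f k c =
      q ^ ((if i = a then (1:ℤ) else 0) - (if i = pr n a then (1:ℤ) else 0)) • f i a
      + (if i < a then (q - q⁻¹) • f a i else 0)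
      - (if a = pr n i then ∑ k, if i < k then ((q - q⁻¹) * q ^ (bar n k - bar n i) * eps n i * eps n k) • f k (pr n k) else 0 else 0) := by
  simp only [Rm, sub_smul _ _ (_ : M), add_smul _ _ (_ : M), Finset.sum_add_distrib, Finset.sum_sub_distrib]
  congr 1
  · congr 1
    · rw [Finset.sum_eq_single i, Finset.sum_eq_single a] <;> simp +contextual [eq_comm]
    · rw [Finset.sum_eq_single a, Finset.sum_eq_single i] <;> simp +contextual [ite_smul, sub_smul]
  · by_cases h : a = pr n i
    · subst h
      simp only [true_and, if_true]
      refine Finset.sum_congr rfl fun k _ => ?_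
      rw [Finset.sum_eq_single (pr n k)] <;> simp +contextual [ite_smul]
    · simp [h]

theorem Rm_col {M : Type*} [AddCommGroup M] [Module F M] (n) (j b : Fin (2*n))
    (f : Fin (2*n) → Fin (2*n) → M) :
    ∑ l, ∑ c, Rm n (l,c) (j,b) • f l c =
      q ^ ((if j = b then (1:ℤ) else 0) - (if j = pr n b then (1:ℤ) else 0)) • f j b
      + (if b < j then (q - q⁻¹) • f b j else 0)
      - (if b = pr n j then ∑ l, if l < j then ((q - q⁻¹) * q ^ (bar n j - bar n l) * eps n l * eps n j) • f l (pr n l) else 0 else 0) := by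
  simp only [Rm, sub_smul _ _ (_ : M), add_smul _ _ (_ : M), Finset.sum_add_distrib, Finset.sum_sub_distrib]
  congr 1
  · congr 1
    · rw [Finset.sum_eq_single j, Finset.sum_eq_single b] <;> simp +contextual [eq_comm]
    · rw [Finset.sum_eq_single b, Finset.sum_eq_single j] <;> simp +contextual [ite_smul, eq_comm, sub_smul]
  · by_cases h : b = pr n j
    · subst h
      simp only [and_true, if_true]
      refine Finset.sum_congr rfl fun k _ => ?_
      rw [Finset.sum_eq_single (pr n k)] <;> simp +contextual [ite_smul]
    · simp [h]
end

section
/-- square matrices of size 2n -/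
abbrev Mat (n : ℕ) (X : Type*) := Matrix (Fin (2*n)) (Fin (2*n)) X

/-- square matrices on the tensor square -/
abbrev Mat2 (n : ℕ) (X : Type*) := Matrix (Fin (2*n) × Fin (2*n)) (Fin (2*n) × Fin (2*n)) X

section framework
variable {n : ℕ} {X : Type*} [Ring X] [Algebra F X]

/-- the R-matrix in an algebra -/
def RX (n : ℕ) (X : Type*) [Ring X] [Algebra F X] : Mat2 n X :=
  fun p s => algebraMap F X (Rm n p s)

/-- G₁ H₂ -/
def M12 (G H : Mat n X) : Mat2 n X := fun p s => G p.1 s.1 * H p.2 s.2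

/-- H₂ G₁ -/
def M21 (G H : Mat n X) : Mat2 n X := fun p s => H p.2 s.2 * G p.1 s.1

theorem RX_M12 (G H : Mat n X) (i a j b : Fin (2*n)) :
    (RX n X * M12 G H) (i,a) (j,b) = ∑ k, ∑ c, Rm n (i, a) (k, c) • (G k j * H c b) := by
  simp only [Matrix.mul_apply, Fintype.sum_prod_type, RX, M12, Algebra.smul_def]

theorem M21_RX (G H : Mat n X) (i a j b : Fin (2*n)) :
    (M21 G H * RX n X) (i,a) (j,b) = ∑ c, ∑ l, Rm n (l, c) (j, b) • (H a c * G i l) := by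
  rw [Finset.sum_comm]
  simp only [Matrix.mul_apply, Fintype.sum_prod_type, RX, M21, Algebra.smul_def, Algebra.commutes]

/-- coefficient for the twisted transpose -/
def cc (n : ℕ) (k j : Fin (2*n)) : F := dd n k * (dd n j)⁻¹ * eps n (pr n k) * eps n (pr n j)

/-- D Tᵗ D⁻¹ -/
def hat (T : Mat n X) : Mat n X := fun k j => cc n k j • T (pr n j) (pr n k)

/-- pairs of matrices satisfying all relations -/
structure RTT (T Tb : Mat n X) : Prop where
  up : ∀ i j, i < j → T i j = 0
  lo : ∀ i j, j < i → Tb i j = 0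
  d1 : ∀ i, T i i * Tb i i = 1
  d2 : ∀ i, Tb i i * T i i = 1
  tt : RX n X * M12 T T = M21 T T * RX n X
  bb : RX n X * M12 Tb Tb = M21 Tb Tb * RX n X
  bt : RX n X * M12 Tb T = M21 Tb T * RX n X
  c1 : T * hat T = 1
  cb1 : Tb * hat Tb = 1
  c2 : hat T * T = 1
  cb2 : hat Tb * Tb = 1

/-- the generator matrices -/
def TU (n : ℕ) : Mat n (Usp n) := fun i j => tU n i j
/-- the generator matrices -/
def TbU (n : ℕ) : Mat n (Usp n) := fun i j => tbU n i j

theorem mul_hat (T : Mat n X) (i j) : (T * hat T) i j = ∑ k, (dd n k * (dd n j)⁻¹ * eps n (pr n k) * eps n (pr n j)) •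
              (T i k * T (pr n j) (pr n k)) := by
  simp only [Matrix.mul_apply, hat, cc, mul_smul_comm]

theorem hat_mul (T : Mat n X) (i j) : (hat T * T) i j = ∑ k, (dd n i * (dd n k)⁻¹ * eps n (pr n i) * eps n (pr n k)) •
              (T (pr n k) (pr n i) * T k j) := by
  simp only [Matrix.mul_apply, hat, cc, smul_mul_assoc]

theorem relU {x y : FA n} (h : rel n x y) : RingQuot.mkAlgHom F (rel n) x = RingQuot.mkAlgHom F (rel n) y :=
  RingQuot.mkAlgHom_rel F h

theorem TU_mk (i j : Fin (2*n)) : TU n i j = RingQuot.mkAlgHom F (rel n) (tF n i j) := rfl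
theorem TbU_mk (i j : Fin (2*n)) : TbU n i j = RingQuot.mkAlgHom F (rel n) (tbF n i j) := rfl

theorem RTT_U (n : ℕ) : RTT (TU n) (TbU n) where
  up i j h := by simpa [TU_mk, TbU_mk] using relU (rel.t_upper i j h)
  lo i j h := by simpa [TU_mk, TbU_mk] using relU (rel.tb_lower i j h)
  d1 i := by simpa [TU_mk, TbU_mk] using relU (rel.t_tb_diag i)
  d2 i := by simpa [TU_mk, TbU_mk] using relU (rel.tb_t_diag i)
  tt := by
    ext ⟨i, a⟩ ⟨j, b⟩
    rw [RX_M12, M21_RX]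
    simpa only [TU_mk, TbU_mk, map_sum, map_smul, map_mul] using relU (rel.rtt_tt i a j b)
  bb := by
    ext ⟨i, a⟩ ⟨j, b⟩
    rw [RX_M12, M21_RX]
    simpa only [TU_mk, TbU_mk, map_sum, map_smul, map_mul] using relU (rel.rtt_bb i a j b)
  bt := by
    ext ⟨i, a⟩ ⟨j, b⟩
    rw [RX_M12, M21_RX]
    simpa only [TU_mk, TbU_mk, map_sum, map_smul, map_mul] using relU (rel.rtt_bt i a j b)
  c1 := by
    ext i j
    rw [mul_hat, Matrix.one_apply]
    simpa only [TU_mk, TbU_mk, map_sum, map_smul, map_mul, apply_ite (RingQuot.mkAlgHom F (rel n)), map_one, map_zero] using relU (rel.cent_t1 i j)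
  cb1 := by
    ext i j
    rw [mul_hat, Matrix.one_apply]
    simpa only [TU_mk, TbU_mk, map_sum, map_smul, map_mul, apply_ite (RingQuot.mkAlgHom F (rel n)), map_one, map_zero] using relU (rel.cent_tb1 i j)
  c2 := by
    ext i j
    rw [hat_mul, Matrix.one_apply]
    simpa only [TU_mk, TbU_mk, map_sum, map_smul, map_mul, apply_ite (RingQuot.mkAlgHom F (rel n)), map_one, map_zero] using relU (rel.cent_t2 i j)
  cb2 := by
    ext i j
    rw [hat_mul, Matrix.one_apply]
    simpa only [TU_mk, TbU_mk, map_sum, map_smul, map_mul, apply_ite (RingQuot.mkAlgHom F (rel n)), map_one, map_zero] using relU (rel.cent_tb2 i j)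

/-- image of generators -/
def genMap (T Tb : Mat n X) : Gen n → X
  | Gen.t i j => T i j
  | Gen.tb i j => Tb i j

theorem genMap_rel {T Tb : Mat n X} (h : RTT T Tb) {x y : FA n} (hr : rel n x y) :
    FreeAlgebra.lift F (genMap T Tb) x = FreeAlgebra.lift F (genMap T Tb) y := by
  have h1 : ∀ i j, FreeAlgebra.lift F (genMap T Tb) (tF n i j) = T i j := fun i j => by
    simp [tF, genMap]
  have h2 : ∀ i j, FreeAlgebra.lift F (genMap T Tb) (tbF n i j) = Tb i j := fun i j => by
    simp [tbF, genMap]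
  induction hr with
  | t_upper i j hij => rw [h1, map_zero, h.up i j hij]
  | tb_lower i j hij => rw [h2, map_zero, h.lo i j hij]
  | t_tb_diag i => rw [map_mul, h1, h2, map_one, h.d1]
  | tb_t_diag i => rw [map_mul, h1, h2, map_one, h.d2]
  | rtt_tt i a j b =>
    simp only [map_sum, map_smul, map_mul, h1, h2]; rw [← RX_M12, ← M21_RX, h.tt]
  | rtt_bb i a j b =>
    simp only [map_sum, map_smul, map_mul, h1, h2]; rw [← RX_M12, ← M21_RX, h.bb]
  | rtt_bt i a j b =>
    simp only [map_sum, map_smul, map_mul, h1, h2]; rw [← RX_M12, ← M21_RX, h.bt]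
  | cent_t1 i j =>
    simp only [map_sum, map_smul, map_mul, h1, apply_ite (FreeAlgebra.lift F (genMap T Tb)), map_one, map_zero]
    rw [← mul_hat, h.c1, Matrix.one_apply]
  | cent_tb1 i j =>
    simp only [map_sum, map_smul, map_mul, h2, apply_ite (FreeAlgebra.lift F (genMap T Tb)), map_one, map_zero]
    rw [← mul_hat, h.cb1, Matrix.one_apply]
  | cent_t2 i j =>
    simp only [map_sum, map_smul, map_mul, h1, apply_ite (FreeAlgebra.lift F (genMap T Tb)), map_one, map_zero]
    rw [← hat_mul, h.c2, Matrix.one_apply]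
  | cent_tb2 i j =>
    simp only [map_sum, map_smul, map_mul, h2, apply_ite (FreeAlgebra.lift F (genMap T Tb)), map_one, map_zero]
    rw [← hat_mul, h.cb2, Matrix.one_apply]

/-- the universal property of the RTT algebra -/
def RTT.hom {T Tb : Mat n X} (h : RTT T Tb) : Usp n →ₐ[F] X :=
  RingQuot.liftAlgHom F ⟨FreeAlgebra.lift F (genMap T Tb), fun _ _ hr => genMap_rel h hr⟩

theorem RTT.hom_t {T Tb : Mat n X} (h : RTT T Tb) (i j) : h.hom (tU n i j) = T i j := by
  simp [RTT.hom, tU, tF, genMap, RingQuot.liftAlgHom_mkAlgHom_apply]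

theorem RTT.hom_tb {T Tb : Mat n X} (h : RTT T Tb) (i j) : h.hom (tbU n i j) = Tb i j := by
  simp [RTT.hom, tbU, tbF, genMap, RingQuot.liftAlgHom_mkAlgHom_apply]

/-- induction on U -/
theorem U_induction (n : ℕ) {C : Usp n → Prop} (hF : ∀ r, C (algebraMap F _ r))
    (ht : ∀ i j, C (tU n i j)) (htb : ∀ i j, C (tbU n i j))
    (hadd : ∀ x y, C x → C y → C (x + y)) (hmul : ∀ x y, C x → C y → C (x * y)) (x : Usp n) : C x := by
  obtain ⟨y, rfl⟩ := RingQuot.mkAlgHom_surjective F (rel n) x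
  induction y using FreeAlgebra.induction with
  | grade0 r => rw [AlgHom.commutes]; exact hF r
  | grade1 g => cases g with
    | t i j => exact ht i j
    | tb i j => exact htb i j
  | mul a b ha hb => rw [map_mul]; exact hmul _ _ ha hb
  | add a b ha hb => rw [map_add]; exact hadd _ _ ha hb

/-! products -/

theorem M12_mul {P Q P' Q' : Mat n X} (h : ∀ i j k l, Commute (Q i j) (P' k l)) :
    M12 (P * Q) (P' * Q') = M12 P P' * M12 Q Q' := by
  ext ⟨i, a⟩ ⟨j, b⟩
  simp only [M12, Matrix.mul_apply, Fintype.sum_prod_type, Finset.sum_mul_sum]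
  refine Finset.sum_congr rfl fun x _ => Finset.sum_congr rfl fun y _ => ?_
  rw [mul_assoc, ← mul_assoc (Q x j), (h x j a y).eq]; simp only [mul_assoc]

theorem M21_mul {P Q P' Q' : Mat n X} (h : ∀ i j k l, Commute (Q' i j) (P k l)) :
    M21 (P * Q) (P' * Q') = M21 P P' * M21 Q Q' := by
  ext ⟨i, a⟩ ⟨j, b⟩
  simp only [M21, Matrix.mul_apply, Fintype.sum_prod_type, Finset.sum_mul_sum]
  rw [Finset.sum_comm]
  refine Finset.sum_congr rfl fun x _ => Finset.sum_congr rfl fun y _ => ?_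
  rw [mul_assoc, ← mul_assoc (Q' y b), (h y b i x).eq]; simp only [mul_assoc]

theorem hat_mul_hat {P Q : Mat n X} (h : ∀ i j k l, Commute (P i j) (Q k l)) :
    hat (P * Q) = hat Q * hat P := by
  ext i j
  simp only [hat, Matrix.mul_apply, Finset.smul_sum]
  let e : Equiv.Perm (Fin (2*n)) := ⟨pr n, pr n, pr_pr n, pr_pr n⟩
  rw [← Equiv.sum_comp e]
  refine Finset.sum_congr rfl fun k _ => ?_
  have hk : e k = pr n k := rfl
  rw [hk, smul_mul_smul_comm, (h _ _ _ _).eq]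
  congr 1
  have h1 := eps_mul_self n (pr n k)
  have h2 : dd n k ≠ 0 := zpow_ne_zero _ q_ne
  simp only [cc]
  field_simp
  rw [pow_two, h1, mul_one]

theorem diag_up {P Q : Mat n X} (hP : ∀ i j, i < j → P i j = 0) (hQ : ∀ i j, i < j → Q i j = 0) :
    (∀ i j, i < j → (P * Q) i j = 0) ∧ ∀ i, (P * Q) i i = P i i * Q i i := by
  constructor
  · intro i j h
    rw [Matrix.mul_apply]
    refine Finset.sum_eq_zero fun k _ => ?_
    rcases lt_or_ge i k with h' | h'
    · rw [hP _ _ h', zero_mul]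
    · rw [hQ _ _ (lt_of_le_of_lt h' h), mul_zero]
  · intro i
    rw [Matrix.mul_apply, Finset.sum_eq_single i]
    · intro k _ hk
      rcases lt_or_gt_of_ne hk with h' | h'
      · rw [hQ _ _ h', mul_zero]
      · rw [hP _ _ h', zero_mul]
    · simp

theorem diag_lo {P Q : Mat n X} (hP : ∀ i j, j < i → P i j = 0) (hQ : ∀ i j, j < i → Q i j = 0) :
    (∀ i j, j < i → (P * Q) i j = 0) ∧ ∀ i, (P * Q) i i = P i i * Q i i := by
  constructor
  · intro i j h
    rw [Matrix.mul_apply]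
    refine Finset.sum_eq_zero fun k _ => ?_
    rcases lt_or_ge k i with h' | h'
    · rw [hP _ _ h', zero_mul]
    · rw [hQ _ _ (lt_of_lt_of_le h h'), mul_zero]
  · intro i
    rw [Matrix.mul_apply, Finset.sum_eq_single i]
    · intro k _ hk
      rcases lt_or_gt_of_ne hk with h' | h'
      · rw [hP _ _ h', zero_mul]
      · rw [hQ _ _ h', mul_zero]
    · simp

theorem RX_prod {P Q P' Q' : Mat n X} (h1 : ∀ i j k l, Commute (Q i j) (P' k l))
    (h2 : ∀ i j k l, Commute (Q' i j) (P k l))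
    (hP : RX n X * M12 P P' = M21 P P' * RX n X) (hQ : RX n X * M12 Q Q' = M21 Q Q' * RX n X) :
    RX n X * M12 (P * Q) (P' * Q') = M21 (P * Q) (P' * Q') * RX n X := by
  rw [M12_mul h1, M21_mul h2, ← mul_assoc, hP, mul_assoc, hQ, mul_assoc]

theorem RTT.mul {P Pb Q Qb : Mat n X} (hP : RTT P Pb) (hQ : RTT Q Qb)
    (h1 : ∀ i j k l, Commute (P i j) (Q k l)) (h2 : ∀ i j k l, Commute (Pb i j) (Q k l))
    (h3 : ∀ i j k l, Commute (P i j) (Qb k l)) (h4 : ∀ i j k l, Commute (Pb i j) (Qb k l)) :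
    RTT (P * Q) (Pb * Qb) where
  up := (diag_up hP.up hQ.up).1
  lo := (diag_lo hP.lo hQ.lo).1
  d1 i := by
    rw [(diag_up hP.up hQ.up).2, (diag_lo hP.lo hQ.lo).2, mul_assoc, ← mul_assoc (Q i i),
      ← (h2 i i i i).eq, mul_assoc, hQ.d1, mul_one, hP.d1]
  d2 i := by
    rw [(diag_up hP.up hQ.up).2, (diag_lo hP.lo hQ.lo).2, mul_assoc, ← mul_assoc (Qb i i),
      ← (h3 i i i i).eq, mul_assoc, hQ.d2, mul_one, hP.d2]
  tt := RX_prod (fun _ _ _ _ => (h1 _ _ _ _).symm) (fun _ _ _ _ => (h1 _ _ _ _).symm) hP.tt hQ.tt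
  bb := RX_prod (fun _ _ _ _ => (h4 _ _ _ _).symm) (fun _ _ _ _ => (h4 _ _ _ _).symm) hP.bb hQ.bb
  bt := RX_prod (fun _ _ _ _ => (h3 _ _ _ _).symm) (fun _ _ _ _ => (h2 _ _ _ _).symm) hP.bt hQ.bt
  c1 := by rw [hat_mul_hat h1, mul_assoc, ← mul_assoc Q, hQ.c1, one_mul, hP.c1]
  cb1 := by rw [hat_mul_hat h4, mul_assoc, ← mul_assoc Qb, hQ.cb1, one_mul, hP.cb1]
  c2 := by rw [hat_mul_hat h1, mul_assoc, ← mul_assoc (hat P), hP.c2, one_mul, hQ.c2]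
  cb2 := by rw [hat_mul_hat h4, mul_assoc, ← mul_assoc (hat Pb), hP.cb2, one_mul, hQ.cb2]

/-- image of an RTT pair under a hom -/
theorem RTT.map {Y : Type*} [Ring Y] [Algebra F Y] {T Tb : Mat n X} (h : RTT T Tb) (f : X →ₐ[F] Y) :
    RTT (T.map f) (Tb.map f) := by
  have key : ∀ G H : Mat n X, RX n X * M12 G H = M21 G H * RX n X →
      RX n Y * M12 (G.map f) (H.map f) =
        M21 (G.map f) (H.map f) * RX n Y := by
    intro G H e
    ext ⟨i, a⟩ ⟨j, b⟩
    have := congrArg f (congrFun (congrFun e (i,a)) (j,b))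
    rw [RX_M12, M21_RX] at this ⊢
    simpa only [map_sum, map_smul, map_mul, Matrix.map_apply] using this
  have k1 : ∀ G : Mat n X, G * hat G = 1 → (G.map f) * hat (G.map f) = 1 := by
    intro G e
    ext i j
    have := congrArg f (congrFun (congrFun e i) j)
    rw [mul_hat] at this ⊢
    simpa only [map_sum, map_smul, map_mul, Matrix.map_apply, Matrix.one_apply, apply_ite f, map_one, map_zero] using this
  have k2 : ∀ G : Mat n X, hat G * G = 1 → hat (G.map f) * (G.map f) = 1 := by
    intro G e
    ext i j
    have := congrArg f (congrFun (congrFun e i) j)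
    rw [hat_mul] at this ⊢
    simpa only [map_sum, map_smul, map_mul, Matrix.map_apply, Matrix.one_apply, apply_ite f, map_one, map_zero] using this
  exact {
    up := fun i j hij => by rw [Matrix.map_apply, h.up i j hij, map_zero]
    lo := fun i j hij => by rw [Matrix.map_apply, h.lo i j hij, map_zero]
    d1 := fun i => by rw [Matrix.map_apply, Matrix.map_apply, ← map_mul, h.d1, map_one]
    d2 := fun i => by rw [Matrix.map_apply, Matrix.map_apply, ← map_mul, h.d2, map_one]
    tt := key _ _ h.tt
    bb := key _ _ h.bb
    bt := key _ _ h.bt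
    c1 := k1 _ h.c1
    cb1 := k1 _ h.cb1
    c2 := k2 _ h.c2
    cb2 := k2 _ h.cb2 }

end framework
end

section
open MulOpposite TensorProduct

section antipode
variable {n : ℕ} {X : Type*} [Ring X] [Algebra F X]

theorem dd_ne (k : Fin (2*n)) : dd n k ≠ 0 := zpow_ne_zero _ q_ne

theorem dd_pr (k : Fin (2*n)) : dd n (pr n k) = (dd n k)⁻¹ := by
  rw [dd, bar_pr, zpow_neg]; rfl

/-- inverse matrix in the opposite algebra -/
def hop (T : Mat n X) : Mat n Xᵐᵒᵖ := (hat T).map op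

theorem cc_self (k : Fin (2*n)) : cc n k k = 1 := by
  rw [cc, mul_inv_cancel₀ (dd_ne k), one_mul, eps_mul_self]

theorem M_inv {T S G H : Mat n X} (h1 : T * G = 1) (h2 : S * H = 1) :
    M12 T S * M21 G H = 1 := by
  ext ⟨i, a⟩ ⟨j, b⟩
  simp only [M12, M21, Matrix.mul_apply, Fintype.sum_prod_type]
  have e : ∀ x y, T i x * S a y * (H y b * G x j) = T i x * (S a y * H y b) * G x j := by
    intro x y; simp only [mul_assoc]
  simp only [e, ← Finset.sum_mul, ← Finset.mul_sum]
  have := congrFun (congrFun h2 a) b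
  rw [Matrix.mul_apply] at this
  rw [this]
  have h1' := congrFun (congrFun h1 i) j
  rw [Matrix.mul_apply] at h1'
  simp only [Matrix.one_apply, Prod.mk.injEq] at h1' ⊢
  by_cases hab : a = b
  · simp only [hab, if_true, mul_one, h1', and_true]
  · simp [hab]

theorem M_inv' {T S G H : Mat n X} (h1 : T * G = 1) (h2 : S * H = 1) :
    M21 T S * M12 G H = 1 := by
  ext ⟨i, a⟩ ⟨j, b⟩
  simp only [M12, M21, Matrix.mul_apply, Fintype.sum_prod_type]
  have e : ∀ x y, S a y * T i x * (G x j * H y b) = S a y * (T i x * G x j) * H y b := by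
    intro x y; simp only [mul_assoc]
  rw [Finset.sum_comm]
  simp only [e, ← Finset.sum_mul, ← Finset.mul_sum]
  have := congrFun (congrFun h1 i) j
  rw [Matrix.mul_apply] at this
  rw [this]
  have h1' := congrFun (congrFun h2 a) b
  rw [Matrix.mul_apply] at h1'
  simp only [Matrix.one_apply, Prod.mk.injEq] at h1' ⊢
  by_cases hab : i = j
  · simp only [hab, if_true, mul_one, h1', true_and]
  · simp [hab]

theorem hop_RTT {T S : Mat n X} (hT : T * hat T = 1) (hT' : hat T * T = 1) (hS : S * hat S = 1)
    (hS' : hat S * S = 1) (h : RX n X * M12 T S = M21 T S * RX n X) :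
    RX n Xᵐᵒᵖ * M12 (hop T) (hop S) = M21 (hop T) (hop S) * RX n Xᵐᵒᵖ := by
  have key : M12 (hat T) (hat S) * RX n X = RX n X * M21 (hat T) (hat S) := by
    calc M12 (hat T) (hat S) * RX n X
        = M12 (hat T) (hat S) * RX n X * (M12 T S * M21 (hat T) (hat S)) := by rw [M_inv hT hS, mul_one]
      _ = M12 (hat T) (hat S) * (RX n X * M12 T S) * M21 (hat T) (hat S) := by simp only [mul_assoc]
      _ = (M12 (hat T) (hat S) * M21 T S) * RX n X * M21 (hat T) (hat S) := by rw [h]; simp only [mul_assoc]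
      _ = _ := by rw [M_inv hT' hS', one_mul]
  ext ⟨i, a⟩ ⟨j, b⟩
  have := congrArg op (congrFun (congrFun key (i,a)) (j,b))
  rw [RX_M12, M21_RX]
  conv_rhs => rw [Finset.sum_comm]
  simp only [Matrix.mul_apply, Fintype.sum_prod_type, RX, M21, M12, ← Algebra.smul_def, ← Algebra.commutes,
    Finset.op_sum, op_smul, op_mul] at this
  exact this.symm

/-- the involution as a permutation -/
def prE (n : ℕ) : Equiv.Perm (Fin (2*n)) := ⟨pr n, pr n, pr_pr n, pr_pr n⟩

theorem prE_apply (k : Fin (2*n)) : prE n k = pr n k := rfl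

theorem eps_sq (k : Fin (2*n)) : eps n k ^ 2 = 1 := by rw [pow_two, eps_mul_self]

theorem hop_c1 {T : Mat n X} (h : hat T * T = 1) : hop T * hat (hop T) = 1 := by
  ext i j
  have e := congrFun (congrFun h (pr n j)) (pr n i)
  rw [hat_mul, ← Equiv.sum_comp (prE n)] at e
  rw [mul_hat]
  have : ∑ k, (dd n k * (dd n j)⁻¹ * eps n (pr n k) * eps n (pr n j)) • (hop T i k * hop T (pr n j) (pr n k))
     = (dd n i * (dd n j)⁻¹ * eps n i * eps n j) • op (∑ k, (dd n (pr n j) * (dd n (prE n k))⁻¹ * eps n (pr n (pr n j)) * eps n (pr n (prE n k))) •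
      (T (pr n (prE n k)) (pr n (pr n j)) * T (prE n k) (pr n i))) := by
    rw [Finset.op_sum, Finset.smul_sum]
    refine Finset.sum_congr rfl fun k _ => ?_
    simp only [hop, Matrix.map_apply, hat, prE_apply, ← op_mul, ← op_smul, smul_mul_smul_comm, smul_smul, pr_pr, cc, dd_pr, eps_pr]
    congr 2
    have := eps_sq k
    have := dd_ne k
    have := dd_ne j
    have h3 : eps n k ^ 3 = eps n k := by rw [pow_succ, eps_sq, one_mul]
    field_simp
    try rw [h3]
  rw [this, e, Matrix.one_apply, Matrix.one_apply]
  simp only [pr_inj]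
  by_cases hij : i = j
  · subst hij
    rw [mul_inv_cancel₀ (dd_ne i), one_mul, eps_mul_self]; simp
  · simp [hij, Ne.symm hij]

theorem hop_c2 {T : Mat n X} (h : T * hat T = 1) : hat (hop T) * hop T = 1 := by
  ext i j
  have e := congrFun (congrFun h (pr n j)) (pr n i)
  rw [mul_hat, ← Equiv.sum_comp (prE n)] at e
  rw [hat_mul]
  have : ∑ k, (dd n i * (dd n k)⁻¹ * eps n (pr n i) * eps n (pr n k)) • (hop T (pr n k) (pr n i) * hop T k j)
     = (dd n i * (dd n j)⁻¹ * eps n i * eps n j) • op (∑ k, (dd n (prE n k) * (dd n (pr n i))⁻¹ * eps n (pr n (prE n k)) * eps n (pr n (pr n i))) •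
      (T (pr n j) (prE n k) * T (pr n (pr n i)) (pr n (prE n k)))) := by
    rw [Finset.op_sum, Finset.smul_sum]
    refine Finset.sum_congr rfl fun k _ => ?_
    simp only [hop, Matrix.map_apply, hat, prE_apply, ← op_mul, ← op_smul, smul_mul_smul_comm, smul_smul, pr_pr, cc, dd_pr, eps_pr]
    congr 2
    have := eps_sq i
    have := dd_ne k
    have := dd_ne j
    have := dd_ne i
    have h3 : eps n k ^ 3 = eps n k := by rw [pow_succ, eps_sq, one_mul]
    field_simp
    try rw [h3]
  rw [this, e, Matrix.one_apply, Matrix.one_apply]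
  simp only [pr_inj]
  by_cases hij : i = j
  · subst hij
    rw [mul_inv_cancel₀ (dd_ne i), one_mul, eps_mul_self]; simp
  · simp [hij, Ne.symm hij]

theorem RTT.hop {T Tb : Mat n X} (h : RTT T Tb) : RTT (hop T) (hop Tb) where
  up i j hij := by simp [CI.hop, hat, h.up _ _ ((pr_lt_pr n).2 hij)]
  lo i j hij := by simp [CI.hop, hat, h.lo _ _ ((pr_lt_pr n).2 hij)]
  d1 i := by
    simp only [CI.hop, hat, Matrix.map_apply, ← op_mul, cc_self, one_smul, h.d2, op_one]
  d2 i := by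
    simp only [CI.hop, hat, Matrix.map_apply, ← op_mul, cc_self, one_smul, h.d1, op_one]
  tt := hop_RTT h.c1 h.c2 h.c1 h.c2 h.tt
  bb := hop_RTT h.cb1 h.cb2 h.cb1 h.cb2 h.bb
  bt := hop_RTT h.cb1 h.cb2 h.c1 h.c2 h.bt
  c1 := hop_c1 h.c2
  cb1 := hop_c1 h.cb2
  c2 := hop_c2 h.c1
  cb2 := hop_c2 h.cb1

end antipode

section hopf
variable (n : ℕ)

/-- tensor product of RTT pairs -/
theorem RTT.tensor {n : ℕ} {X Y : Type} [Ring X] [Algebra F X] [Ring Y] [Algebra F Y]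
    {T Tb : Mat n X} {S Sb : Mat n Y} (h : RTT T Tb) (h' : RTT S Sb) :
    RTT (T.map (Algebra.TensorProduct.includeLeft : X →ₐ[F] X ⊗[F] Y) * S.map (Algebra.TensorProduct.includeRight : Y →ₐ[F] X ⊗[F] Y))
     (Tb.map (Algebra.TensorProduct.includeLeft : X →ₐ[F] X ⊗[F] Y) * Sb.map (Algebra.TensorProduct.includeRight : Y →ₐ[F] X ⊗[F] Y)) := by
  refine (h.map _).mul (h'.map _) ?_ ?_ ?_ ?_ <;>
  · intro i j k l
    simp [Commute, SemiconjBy, Algebra.TensorProduct.includeLeft_apply, Algebra.TensorProduct.includeRight_apply]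

/-- the coproduct -/
def Delta : Usp n →ₐ[F] Usp n ⊗[F] Usp n := ((RTT_U n).tensor (RTT_U n)).hom

theorem Delta_t (i j) : Delta n (tU n i j) = ∑ k, tU n i k ⊗ₜ tU n k j := by
  rw [Delta, RTT.hom_t, Matrix.mul_apply]
  simp [TU]

theorem Delta_tb (i j) : Delta n (tbU n i j) = ∑ k, tbU n i k ⊗ₜ tbU n k j := by
  rw [Delta, RTT.hom_tb, Matrix.mul_apply]
  simp [TbU]

/-- u ↦ u₁ ⊗ S(u₂) -/
def Psi : Usp n →ₐ[F] Usp n ⊗[F] (Usp n)ᵐᵒᵖ := ((RTT_U n).tensor (RTT_U n).hop).hom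

theorem Psi_t (i j) : Psi n (tU n i j) = ∑ k, tU n i k ⊗ₜ op (hat (TU n) k j) := by
  rw [Psi, RTT.hom_t, Matrix.mul_apply]
  simp [TU, hop]

theorem Psi_tb (i j) : Psi n (tbU n i j) = ∑ k, tbU n i k ⊗ₜ op (hat (TbU n) k j) := by
  rw [Psi, RTT.hom_tb, Matrix.mul_apply]
  simp [TbU, hop]

/-- (a ⊗ op v, m) ↦ a ⊗ v m -/
def act : Usp n ⊗[F] (Usp n)ᵐᵒᵖ →ₗ[F] Usp n →ₗ[F] Usp n ⊗[F] Usp n :=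
  TensorProduct.lift (LinearMap.mk₂ F (fun a v =>
    (TensorProduct.mk F (Usp n) (Usp n) a) ∘ₗ (LinearMap.mulLeft F (unop v)))
    (by intros; ext; simp [add_tmul]) (by intros; ext; simp [smul_tmul'])
    (by intros; ext; simp [add_mul, tmul_add]) (by intros; ext; simp))

theorem act_tmul (a : Usp n) (v : (Usp n)ᵐᵒᵖ) (m : Usp n) : act n (a ⊗ₜ v) m = a ⊗ₜ (unop v * m) := rfl

/-- u ⊗ m ↦ u₁ ⊗ S(u₂) m -/
def psi : Usp n ⊗[F] Usp n →ₗ[F] Usp n ⊗[F] Usp n :=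
  TensorProduct.lift ((act n) ∘ₗ (Psi n).toLinearMap)

theorem psi_tmul (u m : Usp n) : psi n (u ⊗ₜ m) = act n (Psi n u) m := rfl

theorem act_mul (x : Usp n ⊗[F] (Usp n)ᵐᵒᵖ) (a v m : Usp n) :
    act n ((a ⊗ₜ op v) * x) m = (a ⊗ₜ 1) * act n x (v * m) := by
  induction x with
  | zero => simp
  | tmul b w => simp [act_tmul, mul_assoc]
  | add x y hx hy => simp only [mul_add, map_add, LinearMap.add_apply, hx, hy]

theorem psi_Delta_gen (T : Mat n (Usp n)) (hT : hat T * T = 1)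
    (h1 : ∀ i j, Delta n (T i j) = ∑ k, T i k ⊗ₜ T k j)
    (h2 : ∀ i j, Psi n (T i j) = ∑ k, T i k ⊗ₜ op (hat T k j)) (i j) (w : Usp n ⊗[F] Usp n) :
    psi n (Delta n (T i j) * w) = (T i j ⊗ₜ 1) * psi n w := by
  induction w with
  | zero => simp
  | add x y hx hy => simp only [mul_add, map_add, hx, hy]
  | tmul u m =>
    rw [h1, Finset.sum_mul, map_sum]
    simp only [Algebra.TensorProduct.tmul_mul_tmul, psi_tmul, map_mul, h2, Finset.sum_mul, map_sum,
      LinearMap.sum_apply, act_mul]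
    rw [Finset.sum_comm]
    have : ∀ l, ∑ k, (T i l ⊗ₜ[F] (1 : Usp n)) * act n (Psi n u) (hat T l k * (T k j * m)) =
       (T i l ⊗ₜ[F] (1 : Usp n)) * act n (Psi n u) ((1 : Mat n (Usp n)) l j * m) := by
      intro l
      rw [← Finset.mul_sum, ← map_sum, ← hT, Matrix.mul_apply, Finset.sum_mul]
      simp only [mul_assoc]
    simp only [this, Matrix.one_apply]
    rw [Finset.sum_eq_single j] <;> simp +contextual

theorem psi_Delta_mul (x : Usp n) : ∀ w, psi n (Delta n x * w) = (x ⊗ₜ 1) * psi n w := by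
  induction x using U_induction n with
  | hF r => intro w; rw [AlgHom.commutes, Algebra.algebraMap_eq_smul_one, Algebra.algebraMap_eq_smul_one]; rw [← smul_tmul', smul_mul_assoc, smul_mul_assoc, one_mul, map_smul, ← Algebra.TensorProduct.one_def, one_mul]
  | ht i j => exact psi_Delta_gen n (TU n) (RTT_U n).c2 (Delta_t n) (Psi_t n) i j
  | htb i j => exact psi_Delta_gen n (TbU n) (RTT_U n).cb2 (Delta_tb n) (Psi_tb n) i j
  | hadd x y hx hy => intro w; simp only [map_add, add_mul, add_tmul, hx, hy]
  | hmul x y hx hy =>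
    intro w
    rw [map_mul (Delta n), mul_assoc, hx, hy, ← mul_assoc, Algebra.TensorProduct.tmul_mul_tmul, mul_one]

theorem psi_Delta (x : Usp n) : psi n (Delta n x) = x ⊗ₜ 1 := by
  have := psi_Delta_mul n x 1
  rw [mul_one] at this
  rw [this, Algebra.TensorProduct.one_def, psi_tmul, map_one (Psi n), Algebra.TensorProduct.one_def, act_tmul]
  simp

end hopf
end

section
open MulOpposite TensorProduct Polynomial

section reg
variable {𝕜 : Type} [Field 𝕜] {U : Type} [Ring U] [Algebra 𝕜 U]

theorem poly_reg (κ B : U) (hκ : IsUnit κ) (p : 𝕜[X]) (hp : p ≠ 0) (P : U[X])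
    (h : P * aeval (C κ * X + C B : U[X]) p = 0) : P = 0 := by
  set Y : U[X] := C κ * X + C B with hY
  have hYd : Y.natDegree ≤ 1 := natDegree_linear_le
  have hYc : Y.coeff 1 = κ := by simp [hY]
  set D := p.natDegree
  have hpow : ∀ i, (Y ^ i).natDegree ≤ i := fun i => by
    simpa using natDegree_pow_le_of_le i hYd
  have hZ : aeval Y p = ∑ i ∈ Finset.range (D+1), p.coeff i • Y ^ i := aeval_eq_sum_range _
  have hZd : (aeval Y p).natDegree ≤ D := by
    rw [hZ]
    refine natDegree_sum_le_of_forall_le _ _ fun i hi => ?_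
    refine (natDegree_smul_le _ _).trans ((hpow i).trans ?_)
    simp at hi; omega
  have hZc : (aeval Y p).coeff D = p.leadingCoeff • κ ^ D := by
    rw [hZ, finsetSum_coeff, Finset.sum_eq_single D]
    · rw [coeff_smul]
      have := coeff_pow_of_natDegree_le (p := Y) (n := 1) (m := D) hYd
      rw [mul_one] at this
      rw [this, hYc]; rfl
    · intro i hi hne
      rw [coeff_smul, coeff_eq_zero_of_natDegree_lt (p := Y ^ i), smul_zero]
      simp at hi
      exact lt_of_le_of_lt (hpow i) (by omega)
    · simp
  have hc : (P * aeval Y p).coeff (P.natDegree + D) = P.leadingCoeff * (p.leadingCoeff • κ ^ D) := by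
    rw [← hZc]
    exact coeff_mul_add_eq_of_natDegree_le le_rfl hZd
  rw [h, coeff_zero] at hc
  have hu : IsUnit (p.leadingCoeff • κ ^ D) := by
    rw [Algebra.smul_def]
    exact ((isUnit_iff_ne_zero.2 (leadingCoeff_ne_zero.2 hp)).map (algebraMap 𝕜 U)).mul (hκ.pow _)
  rw [← leadingCoeff_eq_zero]
  exact (hu.mul_left_eq_zero).1 hc.symm

/-- the fraction field of 𝕜[X] -/
abbrev K0 (𝕜 : Type) [Field 𝕜] : Type := FractionRing 𝕜[X]

/-- the variable in K0 -/
def xk (𝕜 : Type) [Field 𝕜] : K0 𝕜 := algebraMap 𝕜[X] (K0 𝕜) X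

/-- polynomials over U inside U ⊗ K0 -/
def iotaK (𝕜 : Type) [Field 𝕜] (U : Type) [Ring U] [Algebra 𝕜 U] : U[X] →ₐ[𝕜] U ⊗[𝕜] K0 𝕜 :=
  (Algebra.TensorProduct.map (AlgHom.id 𝕜 U) (IsScalarTower.toAlgHom 𝕜 𝕜[X] (K0 𝕜))).comp
    (polyEquivTensor 𝕜 U).toAlgHom

theorem iotaK_inj : Function.Injective (iotaK 𝕜 U) := by
  have h : Function.Injective (LinearMap.lTensor U (IsScalarTower.toAlgHom 𝕜 𝕜[X] (K0 𝕜)).toLinearMap) := by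
    apply Module.Flat.lTensor_preserves_injective_linearMap
    exact IsFractionRing.injective 𝕜[X] (K0 𝕜)
  exact h.comp (polyEquivTensor 𝕜 U).injective

theorem iotaK_lin (κ B : U) : iotaK 𝕜 U (C κ * X + C B) = κ ⊗ₜ xk 𝕜 + B ⊗ₜ 1 := by
  simp [iotaK, xk]

theorem iotaK_tmul (u : U) (p : 𝕜[X]) : iotaK 𝕜 U ((polyEquivTensor 𝕜 U).symm (u ⊗ₜ p)) = u ⊗ₜ algebraMap _ _ p := by
  simp only [iotaK, AlgHom.comp_apply]
  change (Algebra.TensorProduct.map _ _) (polyEquivTensor 𝕜 U ((polyEquivTensor 𝕜 U).symm (u ⊗ₜ p))) = _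
  rw [AlgEquiv.apply_symm_apply]
  simp

theorem clear_den (y : U ⊗[𝕜] K0 𝕜) : ∃ (d : 𝕜[X]) (P : U[X]), d ≠ 0 ∧
    y * (1 ⊗ₜ algebraMap 𝕜[X] (K0 𝕜) d) = iotaK 𝕜 U P := by
  induction y with
  | zero => exact ⟨1, 0, one_ne_zero, by simp⟩
  | tmul u r =>
    obtain ⟨a, b, hb, rfl⟩ := IsFractionRing.div_surjective (A := 𝕜[X]) r
    refine ⟨b, (polyEquivTensor 𝕜 U).symm (u ⊗ₜ a), nonZeroDivisors.ne_zero hb, ?_⟩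
    rw [iotaK_tmul, Algebra.TensorProduct.tmul_mul_tmul, mul_one, div_mul_cancel₀]
    exact fun h => nonZeroDivisors.ne_zero hb ((IsFractionRing.injective 𝕜[X] (K0 𝕜)) (by simpa using h))
  | add x y hx hy =>
    obtain ⟨d, P, hd, h⟩ := hx
    obtain ⟨e, Q, he, h'⟩ := hy
    refine ⟨d * e, P * (polyEquivTensor 𝕜 U).symm (1 ⊗ₜ e) + Q * (polyEquivTensor 𝕜 U).symm (1 ⊗ₜ d), mul_ne_zero hd he, ?_⟩
    rw [map_add, map_mul (iotaK 𝕜 U), map_mul (iotaK 𝕜 U), iotaK_tmul, iotaK_tmul, ← h, ← h', add_mul, mul_assoc, mul_assoc,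
      Algebra.TensorProduct.tmul_mul_tmul, Algebra.TensorProduct.tmul_mul_tmul, mul_one, map_mul,
      mul_comm (algebraMap 𝕜[X] (K0 𝕜) e)]

theorem tensor_reg (κ B : U) (hκ : IsUnit κ) (p : 𝕜[X]) (hp : p ≠ 0) (y : U ⊗[𝕜] K0 𝕜)
    (h : y * aeval (κ ⊗ₜ xk 𝕜 + B ⊗ₜ 1 : U ⊗[𝕜] K0 𝕜) p = 0) : y = 0 := by
  obtain ⟨d, P, hd, hP⟩ := clear_den y
  have hcomm : Commute ((1 : U) ⊗ₜ[𝕜] algebraMap 𝕜[X] (K0 𝕜) d) (aeval (κ ⊗ₜ xk 𝕜 + B ⊗ₜ 1 : U ⊗[𝕜] K0 𝕜) p) := by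
    generalize (aeval (κ ⊗ₜ xk 𝕜 + B ⊗ₜ 1 : U ⊗[𝕜] K0 𝕜) p) = z
    induction z with
    | zero => exact Commute.zero_right _
    | tmul u r => simp [Commute, SemiconjBy, mul_comm]
    | add x y hx hy => exact hx.add_right hy
  have h2 : iotaK 𝕜 U (P * aeval (C κ * X + C B : U[X]) p) = 0 := by
    rw [map_mul, ← hP, ← aeval_algHom_apply, iotaK_lin, mul_assoc, hcomm.eq, ← mul_assoc, h, zero_mul]
  have hP0 : P = 0 := poly_reg κ B hκ p hp P (iotaK_inj (h2.trans (map_zero _).symm))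
  rw [hP0, map_zero] at hP
  have hd' : algebraMap 𝕜[X] (K0 𝕜) d ≠ 0 := fun h => hd ((IsFractionRing.injective 𝕜[X] (K0 𝕜)) (by simpa using h))
  calc y = y * ((1 : U) ⊗ₜ[𝕜] algebraMap 𝕜[X] (K0 𝕜) d) * ((1 : U) ⊗ₜ[𝕜] (algebraMap 𝕜[X] (K0 𝕜) d)⁻¹) := by
        rw [mul_assoc, Algebra.TensorProduct.tmul_mul_tmul, mul_inv_cancel₀ hd', mul_one, ← Algebra.TensorProduct.one_def, mul_one]
    _ = 0 := by rw [hP, zero_mul]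

/-- functionals compatible with right multiplication by B -/
def IsFun (B : U) (f : U →ₗ[𝕜] K0 𝕜) : Prop := ∀ u, f (u * B) = xk 𝕜 * f u

theorem IsFun.mulLeft {B : U} {f : U →ₗ[𝕜] K0 𝕜} (hf : IsFun B f) (v : U) :
    IsFun B (f ∘ₗ LinearMap.mulLeft 𝕜 v) := by
  intro u; simp [← mul_assoc]; rw [hf]

theorem lTensor_mul {V : Type} [Ring V] [Algebra 𝕜 V] {B : U} {f : U →ₗ[𝕜] K0 𝕜} (hf : IsFun B f) (κ b : V) (p : 𝕜[X]) :
    ∀ (w : V ⊗[𝕜] U),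
    LinearMap.lTensor V f (w * aeval (κ ⊗ₜ B + b ⊗ₜ 1 : V ⊗[𝕜] U) p) =
      LinearMap.lTensor V f w * aeval (κ ⊗ₜ xk 𝕜 + b ⊗ₜ 1 : V ⊗[𝕜] K0 𝕜) p := by
  have h1 : ∀ w : V ⊗[𝕜] U, LinearMap.lTensor V f (w * (κ ⊗ₜ B + b ⊗ₜ 1 : V ⊗[𝕜] U)) =
      LinearMap.lTensor V f w * (κ ⊗ₜ xk 𝕜 + b ⊗ₜ 1 : V ⊗[𝕜] K0 𝕜) := by
    intro w
    induction w with
    | zero => simp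
    | tmul v u => simp only [mul_add, Algebra.TensorProduct.tmul_mul_tmul, map_add, LinearMap.lTensor_tmul, hf u, mul_one, mul_comm (xk 𝕜)]
    | add x y hx hy => simp only [add_mul, map_add, hx, hy]
  induction p using Polynomial.induction_on with
  | C a => intro w; simp [Algebra.algebraMap_eq_smul_one]
  | add p r hp hr => intro w; simp only [map_add, mul_add, hp, hr]
  | monomial m a h =>
    intro w
    have e : ∀ (W : Type) [Ring W] [Algebra 𝕜 W] (z : W), aeval z (C a * X ^ (m+1)) = aeval z (C a * X ^ m) * z := by
      intro W _ _ z; simp [pow_succ, mul_assoc]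
    rw [e, e, ← mul_assoc, h1, h, mul_assoc]

theorem exists_fun (B : U) (h : ∀ p : 𝕜[X], p ≠ 0 → aeval B p ≠ 0) :
    ∃ f : U →ₗ[𝕜] K0 𝕜, IsFun B f ∧ f 1 ≠ 0 := by
  let M := Module.AEval' (LinearMap.mulRight 𝕜 B)
  let o : U ≃ₗ[𝕜] M := Module.AEval'.of _
  let S := nonZeroDivisors 𝕜[X]
  let V := LocalizedModule S M
  let ℓ : M →ₗ[𝕜[X]] V := LocalizedModule.mkLinearMap S M
  have haev : ∀ p : 𝕜[X], aeval (LinearMap.mulRight 𝕜 B) p (1 : U) = aeval B p := by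
    intro p
    induction p using Polynomial.induction_on with
    | C a => simp [Algebra.algebraMap_eq_smul_one]
    | add p r hp hr => simp [hp, hr]
    | monomial m a h => simp [pow_succ', LinearMap.mulRight_apply] at h ⊢; rw [← smul_mul_assoc, h, mul_assoc, pow_mul_comm']
  have hne : ℓ (o 1) ≠ 0 := by
    intro h0
    obtain ⟨c, hc⟩ := (IsLocalizedModule.eq_zero_iff S ℓ).1 h0
    have h1 : (c : 𝕜[X]) • o 1 = 0 := hc
    have h2 := Module.AEval.of_aeval_smul (R := 𝕜) (a := LinearMap.mulRight 𝕜 B) (c : 𝕜[X]) (1 : U)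
    have h3 : aeval (LinearMap.mulRight 𝕜 B) (c : 𝕜[X]) (1 : U) = 0 := by
      apply o.injective
      rw [map_zero]
      exact h2.trans h1
    rw [haev] at h3
    exact h _ (nonZeroDivisors.ne_zero c.2) h3
  obtain ⟨g, hg⟩ : ∃ g : Module.Dual (K0 𝕜) V, g (ℓ (o 1)) ≠ 0 := by
    by_contra hcon
    push Not at hcon
    exact hne ((Module.forall_dual_apply_eq_zero_iff (K0 𝕜) _).1 hcon)
  let g' : V →ₗ[𝕜[X]] K0 𝕜 := g.restrictScalars 𝕜[X]
  let G : M →ₗ[𝕜[X]] K0 𝕜 := g' ∘ₗ ℓ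
  let f : U →ₗ[𝕜] K0 𝕜 := (G.restrictScalars 𝕜) ∘ₗ o.toLinearMap
  refine ⟨f, ?_, hg⟩
  intro u
  have : o (u * B) = (X : 𝕜[X]) • o u := (Module.AEval'.X_smul_of (LinearMap.mulRight 𝕜 B) u).symm
  change G (o (u * B)) = xk 𝕜 * G (o u)
  rw [this, map_smul, Algebra.smul_def]; rfl

end reg

section regU
variable {n : ℕ}

theorem psi_kill {B : Usp n} (w : Usp n ⊗[F] Usp n)
    (h : ∀ f : Usp n →ₗ[F] K0 F, IsFun B f → LinearMap.lTensor (Usp n) f w = 0)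
    (f : Usp n →ₗ[F] K0 F) (hf : IsFun B f) : LinearMap.lTensor (Usp n) f (psi n w) = 0 := by
  let b := Module.Basis.ofVectorSpace F (Usp n)
  obtain ⟨c, rfl⟩ := TensorProduct.eq_repr_basis_left b w
  have hc : ∀ i, ∀ f : Usp n →ₗ[F] K0 F, IsFun B f → f (c i) = 0 := by
    intro i f hf
    have h1 := h f hf
    rw [Finsupp.sum, map_sum] at h1
    have h2 := TensorProduct.sum_tmul_basis_left_eq_zero b (c.mapRange f (map_zero f)) (by
      rw [Finsupp.sum_mapRange_index (by simp)]
      simpa [Finsupp.sum] using h1)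
    simpa using DFunLike.congr_fun h2 i
  rw [Finsupp.sum, map_sum, map_sum]
  refine Finset.sum_eq_zero fun i _ => ?_
  rw [psi_tmul]
  generalize Psi n (b i) = z
  induction z with
  | zero => simp
  | tmul a v =>
    rw [act_tmul, LinearMap.lTensor_tmul]
    have := hc i _ (hf.mulLeft (unop v))
    simp only [LinearMap.comp_apply, LinearMap.mulLeft_apply] at this
    rw [this, tmul_zero]
  | add x y hx hy => rw [map_add, LinearMap.add_apply, map_add, hx, hy, add_zero]

/-- regularity dichotomy -/
theorem regular (B κ : Usp n) (hκ : IsUnit κ) (hD : Delta n B = κ ⊗ₜ B + B ⊗ₜ 1)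
    (hB : ∀ p : F[X], p ≠ 0 → aeval B p ≠ 0) (x : Usp n) (p : F[X]) (hp : p ≠ 0)
    (hx : x * aeval B p = 0) : x = 0 := by
  obtain ⟨f, hf, hf1⟩ := exists_fun B hB
  have hw : ∀ f : Usp n →ₗ[F] K0 F, IsFun B f → LinearMap.lTensor (Usp n) f (Delta n x) = 0 := by
    intro f hf
    apply tensor_reg κ B hκ p hp
    rw [← lTensor_mul hf, ← hD, aeval_algHom_apply, ← map_mul, hx, map_zero, map_zero]
  have h1 := psi_kill (Delta n x) hw f hf
  rw [psi_Delta, LinearMap.lTensor_tmul] at h1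
  by_contra hx0
  obtain ⟨φ, hφ⟩ : ∃ g : Module.Dual F (K0 F), g (f 1) ≠ 0 := by
    by_contra hcon
    push Not at hcon
    exact hf1 ((Module.forall_dual_apply_eq_zero_iff F _).1 hcon)
  have h2 := congrArg (fun y => TensorProduct.rid F (Usp n) (LinearMap.lTensor (Usp n) φ y)) h1
  simp only [LinearMap.lTensor_tmul, TensorProduct.rid_tmul, map_zero] at h2
  exact hx0 ((smul_eq_zero.1 h2).resolve_left hφ)

end regU
end

section
open MulOpposite TensorProduct Polynomial

section alg
variable {𝕜 : Type} [Field 𝕜] {U : Type} [Ring U] [Algebra 𝕜 U]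

theorem coeff_lin_pow (κ B : U) (m : ℕ) :
    ((C κ * X + C B : U[X]) ^ m).natDegree ≤ m ∧ ((C κ * X + C B : U[X]) ^ m).coeff m = κ ^ m := by
  have hYd : (C κ * X + C B : U[X]).natDegree ≤ 1 := natDegree_linear_le
  constructor
  · simpa using natDegree_pow_le_of_le m hYd
  · have := coeff_pow_of_natDegree_le (n := 1) (m := m) hYd
    rw [mul_one] at this
    rw [this]; simp

theorem coeff_lin_pow' (κ Ex Fx : U) (α β : 𝕜) (h1 : Ex * κ = α • (κ * Ex)) (h2 : Fx * κ = β • (κ * Fx))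
    (m : ℕ) :
    ((C κ * X + C (Ex + Fx) : U[X]) ^ (m+1)).coeff m =
      κ ^ m * ((∑ i ∈ Finset.range (m+1), α ^ i) • Ex + (∑ i ∈ Finset.range (m+1), β ^ i) • Fx) := by
  induction m with
  | zero => simp
  | succ m ih =>
    rw [pow_succ, mul_add, coeff_add, ← mul_assoc, coeff_mul_X, coeff_mul_C, coeff_mul_C, ih,
      (coeff_lin_pow κ (Ex+Fx) (m+1)).2]
    rw [Finset.sum_range_succ' _ (m+1), Finset.sum_range_succ' _ (m+1)]
    have ea : ∀ γ : 𝕜, ∑ i ∈ Finset.range (m+1), γ ^ (i+1) = (∑ i ∈ Finset.range (m+1), γ ^ i) * γ := by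
      intro γ; rw [Finset.sum_mul]; exact Finset.sum_congr rfl fun i _ => pow_succ _ _
    rw [ea, ea]
    generalize (∑ i ∈ Finset.range (m+1), α ^ i) = a
    generalize (∑ i ∈ Finset.range (m+1), β ^ i) = b
    simp only [mul_assoc, add_mul, smul_mul_assoc, h1, h2, mul_add, mul_smul_comm, pow_zero, pow_succ]
    module

theorem alg_zero (κ Ex Fx : U) (hκ : IsUnit κ) (α : 𝕜) (hα0 : α ≠ 0) (hα : ∀ m : ℕ, α ^ (m+1) ≠ 1)
    (h1 : Ex * κ = α • (κ * Ex)) (h2 : Fx * κ = α⁻¹ • (κ * Fx))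
    (hD : ∀ p : 𝕜[X], aeval (Ex + Fx) p = 0 → aeval (κ ⊗ₜ (Ex + Fx) + (Ex + Fx) ⊗ₜ 1 : U ⊗[𝕜] U) p = 0)
    (p0 : 𝕜[X]) (hp0 : p0 ≠ 0) (hp : aeval (Ex + Fx) p0 = 0) : Ex + Fx = 0 := by
  set B := Ex + Fx with hB
  rcases subsingleton_or_nontrivial U with hs | hs
  · exact Subsingleton.elim _ _
  have hBint : IsIntegral 𝕜 B := isAlgebraic_iff_isIntegral.1 ⟨p0, hp0, hp⟩
  set p := minpoly 𝕜 B with hpdef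
  have hmon : p.Monic := minpoly.monic hBint
  obtain ⟨d, hd⟩ : ∃ d, p.natDegree = d + 1 := by
    have : 0 < p.natDegree := minpoly.natDegree_pos hBint
    exact ⟨p.natDegree - 1, by omega⟩
  have hpB : aeval (κ ⊗ₜ B + B ⊗ₜ 1 : U ⊗[𝕜] U) p = 0 := hD p (minpoly.aeval 𝕜 B)
  -- evaluation U[X] → U ⊗ U
  let ev : U[X] →ₐ[𝕜] U ⊗[𝕜] U :=
    (Algebra.TensorProduct.map (AlgHom.id 𝕜 U) (aeval B)).comp (polyEquivTensor 𝕜 U).toAlgHom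
  have evlin : ev (C κ * X + C B) = κ ⊗ₜ B + B ⊗ₜ 1 := by simp [ev]
  have evmon : ∀ (u : U) (j : ℕ), ev (C u * X ^ j) = u ⊗ₜ (B ^ j) := by
    intro u j
    have e1 : ev (C u) = u ⊗ₜ 1 := by simp [ev]
    have e2 : ev X = 1 ⊗ₜ B := by simp [ev]
    rw [map_mul, map_pow, e1, e2, Algebra.TensorProduct.tmul_pow, Algebra.TensorProduct.tmul_mul_tmul, one_pow, mul_one, one_mul]
  set P : U[X] := aeval (C κ * X + C B : U[X]) p with hP
  have hevP : ev P = 0 := by rw [hP, ← aeval_algHom_apply, evlin, hpB]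
  set Q : U[X] := P - C (κ ^ (d+1)) * p.map (algebraMap 𝕜 U) with hQ
  have hPs : P = ∑ i ∈ Finset.range (d+1+1), p.coeff i • (C κ * X + C B : U[X]) ^ i := by
    rw [hP, aeval_eq_sum_range, hd]
  have hPd : P.natDegree ≤ d+1 := by
    rw [hPs]
    refine natDegree_sum_le_of_forall_le _ _ fun i hi => ?_
    refine (natDegree_smul_le _ _).trans ((coeff_lin_pow κ B i).1.trans ?_)
    simp at hi; omega
  have hlc : p.coeff (d+1) = 1 := by rw [← hd]; exact hmon
  have hPc : P.coeff (d+1) = κ ^ (d+1) := by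
    rw [hPs, finsetSum_coeff, Finset.sum_eq_single (d+1)]
    · rw [coeff_smul, (coeff_lin_pow κ B (d+1)).2, hlc, one_smul]
    · intro i hi hne
      rw [coeff_smul, coeff_eq_zero_of_natDegree_lt (p := (C κ * X + C B : U[X]) ^ i), smul_zero]
      simp at hi
      exact lt_of_le_of_lt (coeff_lin_pow κ B i).1 (by omega)
    · simp
  have hPc' : P.coeff d = κ ^ d * ((∑ i ∈ Finset.range (d+1), α ^ i) • Ex + (∑ i ∈ Finset.range (d+1), α⁻¹ ^ i) • Fx) + p.coeff d • κ ^ d := by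
    rw [hPs, finsetSum_coeff, Finset.sum_range_succ, Finset.sum_range_succ, Finset.sum_eq_zero]
    · rw [coeff_smul, (coeff_lin_pow κ B d).2, coeff_smul, coeff_lin_pow' κ Ex Fx α α⁻¹ h1 h2, hlc, one_smul, zero_add, add_comm]
    · intro i hi
      rw [coeff_smul, coeff_eq_zero_of_natDegree_lt (p := (C κ * X + C B : U[X]) ^ i), smul_zero]
      simp at hi
      exact lt_of_le_of_lt (coeff_lin_pow κ B i).1 (by omega)
  have hevQ : ev Q = 0 := by
    rw [hQ, map_sub, hevP, map_mul]
    have : ev (p.map (algebraMap 𝕜 U)) = 1 ⊗ₜ aeval B p := by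
      rw [(p.map (algebraMap 𝕜 U)).as_sum_range_C_mul_X_pow' (n := p.natDegree + 1) (Nat.lt_succ_of_le natDegree_map_le)]
      rw [map_sum, aeval_eq_sum_range, tmul_sum]
      refine Finset.sum_congr rfl fun i _ => ?_
      rw [evmon, coeff_map, Algebra.algebraMap_eq_smul_one, smul_tmul]
    rw [this, minpoly.aeval, tmul_zero, mul_zero, sub_zero]
  have hQd : ∀ j, d < j → Q.coeff j = 0 := by
    intro j hj
    rcases Nat.lt_or_ge (d+1) j with h | h
    · rw [hQ, coeff_sub, coeff_C_mul, coeff_map, coeff_eq_zero_of_natDegree_lt (lt_of_le_of_lt hPd h),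
        coeff_eq_zero_of_natDegree_lt (p := p) (by omega)]; simp
    · obtain rfl : j = d + 1 := by omega
      rw [hQ, coeff_sub, coeff_C_mul, coeff_map, hPc, hlc]; simp
  have hQ0 : ∀ j, j < d + 1 → Q.coeff j = 0 := by
    have hQs : Q = ∑ j ∈ Finset.range (d+1), C (Q.coeff j) * X ^ j := by
      apply Polynomial.as_sum_range_C_mul_X_pow'
      by_cases hz : Q = 0
      · rw [hz]; simp
      · by_contra hcon
        exact hz (leadingCoeff_eq_zero.1 (hQd Q.natDegree (by omega)))
    rw [hQs, map_sum] at hevQ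
    simp only [evmon] at hevQ
    have hli := linearIndependent_pow (K := 𝕜) B
    intro j hj
    refine (Module.forall_dual_apply_eq_zero_iff 𝕜 (Q.coeff j)).1 fun φ => ?_
    have h3 := congrArg (fun y => TensorProduct.lid 𝕜 U (LinearMap.rTensor U φ y)) hevQ
    simp only [map_sum, LinearMap.rTensor_tmul, TensorProduct.lid_tmul, map_zero] at h3
    rw [Finset.sum_range] at h3
    rw [Fintype.linearIndependent_iff] at hli
    have h4 := hli (fun i => φ (Q.coeff i)) (by
      rw [← h3]
      exact Fintype.sum_equiv (finCongr hd) _ _ (fun i => by simp)) ⟨j, (show j < p.natDegree by omega)⟩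
    exact h4
  have hfin := hQ0 d (by omega)
  rw [hQ, coeff_sub, coeff_C_mul, coeff_map, hPc'] at hfin
  set a := ∑ i ∈ Finset.range (d+1), α ^ i with ha
  set b := ∑ i ∈ Finset.range (d+1), α⁻¹ ^ i with hb
  have hα1 : α ≠ 1 := by simpa using hα 0
  have ha0 : a ≠ 0 := by
    intro h
    have := geom_sum_mul α (d+1)
    rw [← ha, h, zero_mul] at this
    exact hα d (sub_eq_zero.1 this.symm)
  have hb0 : b ≠ 0 := by
    intro h
    have := geom_sum_mul α⁻¹ (d+1)
    rw [← hb, h, zero_mul] at this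
    apply hα d
    rw [← inv_inj, inv_one, ← inv_pow]
    exact (sub_eq_zero.1 this.symm)
  have hcan : ∀ z : U, κ * z = 0 → z = 0 := fun z hz => hκ.mul_right_eq_zero.1 hz
  -- a Ex + b Fx commutes with κ
  have hE : a • Ex + b • Fx = p.coeff d • κ - p.coeff d • 1 := by
    have : κ ^ d * ((a • Ex + b • Fx) - (p.coeff d • κ - p.coeff d • 1)) = 0 := by
      rw [← hfin, Algebra.algebraMap_eq_smul_one]
      simp only [mul_sub, mul_smul_comm, mul_one, pow_succ]
      abel
    exact sub_eq_zero.1 ((hκ.pow d).mul_right_eq_zero.1 this)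
  have hcm : (a • Ex + b • Fx) * κ = κ * (a • Ex + b • Fx) := by
    rw [hE]; simp [sub_mul, mul_sub]
  have hz1 : (a * (α - 1)) • Ex + (b * (α⁻¹ - 1)) • Fx = 0 := by
    apply hcan
    rw [add_mul, smul_mul_assoc, smul_mul_assoc, h1, h2] at hcm
    rw [← sub_eq_zero.2 hcm]
    simp only [mul_add, mul_smul_comm]
    module
  have hz2 : (a * (α - 1) * α) • Ex + (b * (α⁻¹ - 1) * α⁻¹) • Fx = 0 := by
    apply hcan
    have := congrArg (· * κ) hz1
    simp only [add_mul, smul_mul_assoc, h1, h2, zero_mul] at this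
    rw [← this]
    simp only [mul_add, mul_smul_comm]
    module
  have hαα : α - α⁻¹ ≠ 0 := by
    intro h
    apply hα 1
    rw [pow_two]
    nth_rewrite 1 [sub_eq_zero.1 h]
    exact inv_mul_cancel₀ hα0
  have hEx : Ex = 0 := by
    have : (a * (α - 1) * (α - α⁻¹)) • Ex = 0 := by
      have e : (a * (α - 1) * (α - α⁻¹)) • Ex = ((a * (α - 1) * α) • Ex + (b * (α⁻¹ - 1) * α⁻¹) • Fx) - α⁻¹ • ((a * (α - 1)) • Ex + (b * (α⁻¹ - 1)) • Fx) := by module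
      rw [e, hz1, hz2]; simp
    refine (smul_eq_zero.1 this).resolve_left ?_
    exact mul_ne_zero (mul_ne_zero ha0 (sub_ne_zero.2 hα1)) hαα
  have hFx : Fx = 0 := by
    rw [hEx, smul_zero, zero_add] at hz1
    refine (smul_eq_zero.1 hz1).resolve_left ?_
    refine mul_ne_zero hb0 (sub_ne_zero.2 ?_)
    intro h; exact hα1 (inv_eq_one.1 h)
  rw [hB, hEx, hFx, add_zero]

end alg
end

section
section comm
variable {n : ℕ}

theorem tU_up {i j : Fin (2*n)} (h : i < j) : tU n i j = 0 := (RTT_U n).up i j h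
theorem tbU_lo {i j : Fin (2*n)} (h : j < i) : tbU n i j = 0 := (RTT_U n).lo i j h
theorem t_tb (i : Fin (2*n)) : tU n i i * tbU n i i = 1 := (RTT_U n).d1 i
theorem tb_t (i : Fin (2*n)) : tbU n i i * tU n i i = 1 := (RTT_U n).d2 i

/-- the exponent correction -/
def dl (n : ℕ) (i j : Fin (2*n)) : ℤ := if j = pr n i then 1 else 0

theorem dl_symm (i j : Fin (2*n)) : dl n i j = dl n j i := by
  unfold dl; simp only [eq_pr_comm n (i := i)]

theorem ne_pr_self (i : Fin (2*n)) : ¬ i = pr n i := fun h => pr_ne n i h.symm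

section rc
variable {M : Type*} [AddCommGroup M] [Module F M]

/-- row sums of the R-matrix -/
def rowS (n : ℕ) (i a : Fin (2*n)) (f : Fin (2*n) → Fin (2*n) → M) : M := ∑ k, ∑ c, Rm n (i,a) (k,c) • f k c
/-- column sums of the R-matrix -/
def colS (n : ℕ) (j b : Fin (2*n)) (f : Fin (2*n) → Fin (2*n) → M) : M := ∑ l, ∑ c, Rm n (l,c) (j,b) • f l c

theorem row_diag (i : Fin (2*n)) (f : Fin (2*n) → Fin (2*n) → M) : rowS n i i f = q • f i i := by
  rw [rowS, Rm_row, if_pos rfl, if_neg (ne_pr_self i), if_neg (lt_irrefl i), if_neg (ne_pr_self i)]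
  simp

theorem col_diag (i : Fin (2*n)) (f : Fin (2*n) → Fin (2*n) → M) : colS n i i f = q • f i i := by
  rw [colS, Rm_col, if_pos rfl, if_neg (ne_pr_self i), if_neg (lt_irrefl i), if_neg (ne_pr_self i)]
  simp

theorem row_lt {i a : Fin (2*n)} (h : i < a) (h' : a ≠ pr n i) (f : Fin (2*n) → Fin (2*n) → M) :
    rowS n i a f = f i a + (q - q⁻¹) • f a i := by
  have h2 : ¬ i = pr n a := fun h3 => h' ((eq_pr_comm n).1 h3)
  rw [rowS, Rm_row, if_neg (ne_of_lt h), if_neg h2, if_pos h, if_neg h']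
  simp

theorem row_gt {i a : Fin (2*n)} (h : a < i) (h' : a ≠ pr n i) (f : Fin (2*n) → Fin (2*n) → M) :
    rowS n i a f = f i a := by
  have h2 : ¬ i = pr n a := fun h3 => h' ((eq_pr_comm n).1 h3)
  rw [rowS, Rm_row, if_neg (ne_of_gt h), if_neg h2, if_neg (not_lt_of_gt h), if_neg h']
  simp

theorem col_lt {j b : Fin (2*n)} (h : j < b) (h' : b ≠ pr n j) (f : Fin (2*n) → Fin (2*n) → M) :
    colS n j b f = f j b := by
  have h2 : ¬ j = pr n b := fun h3 => h' ((eq_pr_comm n).1 h3)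
  rw [colS, Rm_col, if_neg (ne_of_lt h), if_neg h2, if_neg (not_lt_of_gt h), if_neg h']
  simp

theorem col_gt {j b : Fin (2*n)} (h : b < j) (h' : b ≠ pr n j) (f : Fin (2*n) → Fin (2*n) → M) :
    colS n j b f = f j b + (q - q⁻¹) • f b j := by
  have h2 : ¬ j = pr n b := fun h3 => h' ((eq_pr_comm n).1 h3)
  rw [colS, Rm_col, if_neg (ne_of_gt h), if_neg h2, if_pos h, if_neg h']
  simp

theorem row_pr (i : Fin (2*n)) (f : Fin (2*n) → Fin (2*n) → M) :
    rowS n i (pr n i) f = q⁻¹ • f i (pr n i) + (if i < pr n i then (q - q⁻¹) • f (pr n i) i else 0)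
      - ∑ k, if i < k then ((q - q⁻¹) * q ^ (bar n k - bar n i) * eps n i * eps n k) • f k (pr n k) else 0 := by
  rw [rowS, Rm_row, if_neg (ne_pr_self i), if_pos (pr_pr n i).symm, if_pos rfl]
  simp

theorem col_pr (j : Fin (2*n)) (f : Fin (2*n) → Fin (2*n) → M) :
    colS n j (pr n j) f = q⁻¹ • f j (pr n j) + (if pr n j < j then (q - q⁻¹) • f (pr n j) j else 0)
      - ∑ l, if l < j then ((q - q⁻¹) * q ^ (bar n j - bar n l) * eps n l * eps n j) • f l (pr n l) else 0 := by
  rw [colS, Rm_col, if_neg (ne_pr_self j), if_pos (pr_pr n j).symm, if_pos rfl]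
  simp

theorem row_lt0 {i a : Fin (2*n)} (h : i < a) (f : Fin (2*n) → Fin (2*n) → M)
    (h0 : ∀ k, i < k → a = pr n i → f k (pr n k) = 0) :
    rowS n i a f = q ^ (- dl n i a) • f i a + (q - q⁻¹) • f a i := by
  by_cases h' : a = pr n i
  · subst h'
    rw [row_pr, if_pos h, dl, if_pos rfl, Finset.sum_eq_zero, sub_zero, zpow_neg_one]
    intro k _
    split_ifs with h3
    · rw [h0 k h3 rfl, smul_zero]
    · rfl
  · rw [row_lt h h', dl, if_neg h']; simp

theorem row_gt0 {i a : Fin (2*n)} (h : a < i) (f : Fin (2*n) → Fin (2*n) → M)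
    (h0 : ∀ k, i < k → a = pr n i → f k (pr n k) = 0) :
    rowS n i a f = q ^ (- dl n i a) • f i a := by
  by_cases h' : a = pr n i
  · subst h'
    rw [row_pr, if_neg (not_lt_of_gt h), dl, if_pos rfl, Finset.sum_eq_zero, sub_zero, zpow_neg_one, add_zero]
    intro k _
    split_ifs with h3
    · rw [h0 k h3 rfl, smul_zero]
    · rfl
  · rw [row_gt h h', dl, if_neg h']; simp

theorem col_lt0 {j b : Fin (2*n)} (h : j < b) (f : Fin (2*n) → Fin (2*n) → M)
    (h0 : ∀ l, l < j → b = pr n j → f l (pr n l) = 0) :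
    colS n j b f = q ^ (- dl n j b) • f j b := by
  by_cases h' : b = pr n j
  · subst h'
    rw [col_pr, if_neg (not_lt_of_gt h), dl, if_pos rfl, Finset.sum_eq_zero, sub_zero, zpow_neg_one, add_zero]
    intro k _
    split_ifs with h3
    · rw [h0 k h3 rfl, smul_zero]
    · rfl
  · rw [col_lt h h', dl, if_neg h']; simp

theorem col_gt0 {j b : Fin (2*n)} (h : b < j) (f : Fin (2*n) → Fin (2*n) → M)
    (h0 : ∀ l, l < j → b = pr n j → f l (pr n l) = 0) :
    colS n j b f = q ^ (- dl n j b) • f j b + (q - q⁻¹) • f b j := by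
  by_cases h' : b = pr n j
  · subst h'
    rw [col_pr, if_pos h, dl, if_pos rfl, Finset.sum_eq_zero, sub_zero, zpow_neg_one]
    intro k _
    split_ifs with h3
    · rw [h0 k h3 rfl, smul_zero]
    · rfl
  · rw [col_gt h h', dl, if_neg h']; simp

end rc

theorem bt0 (i a j b : Fin (2*n)) :
    rowS n i a (fun k c => tbU n k j * tU n c b) = colS n j b (fun l c => tU n a c * tbU n i l) := by
  have := congrFun (congrFun (RTT_U n).bt (i,a)) (j,b)
  rw [RX_M12, M21_RX] at this
  refine this.trans ?_
  rw [Finset.sum_comm (s := Finset.univ)]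
  rfl

theorem bb0 (i a j b : Fin (2*n)) :
    rowS n i a (fun k c => tbU n k j * tbU n c b) = colS n j b (fun l c => tbU n a c * tbU n i l) := by
  have := congrFun (congrFun (RTT_U n).bb (i,a)) (j,b)
  rw [RX_M12, M21_RX] at this
  refine this.trans ?_
  rw [Finset.sum_comm (s := Finset.univ)]
  rfl

theorem tt0 (i a j b : Fin (2*n)) :
    rowS n i a (fun k c => tU n k j * tU n c b) = colS n j b (fun l c => tU n a c * tU n i l) := by
  have := congrFun (congrFun (RTT_U n).tt (i,a)) (j,b)
  rw [RX_M12, M21_RX] at this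
  refine this.trans ?_
  rw [Finset.sum_comm (s := Finset.univ)]
  rfl

variable {i j : Fin (2*n)} (hij : i < j)
include hij

theorem c1 : q • (tbU n i j * tU n i i) = q ^ (- dl n i j) • (tU n i i * tbU n i j) := by
  have h := bt0 i i j i
  rw [row_diag, col_gt0 hij _ (fun l hl e => by
    rw [tU_up (by rw [e, pr_lt_pr]; exact hl), zero_mul]), tU_up hij, dl_symm] at h
  simpa using h

theorem c2 : q ^ (- dl n i j) • (tbU n i j * tU n j j) = q • (tU n j j * tbU n i j) := by
  have h := bt0 i j j j
  rw [col_diag, row_lt0 hij _ (fun l hl e => by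
    rw [tU_up (by rw [e, pr_lt_pr]; exact hl), mul_zero]), tU_up hij] at h
  simpa using h

theorem c3 : tbU n i i * tU n j j = tU n j j * tbU n i i := by
  have h := bt0 i j i j
  rw [row_lt0 hij _ (fun l hl e => by rw [tU_up (by rw [e, pr_lt_pr]; exact hl), mul_zero]),
    col_lt0 hij _ (fun l hl e => by rw [tbU_lo hl, mul_zero]), tU_up hij] at h
  simp only [mul_zero, smul_zero, add_zero] at h
  exact smul_right_injective _ (zpow_ne_zero _ q_ne) h

theorem c4 : q ^ (- dl n i j) • (tbU n i i * tU n j i) = q • (tU n j i * tbU n i i) := by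
  have h := bt0 i j i i
  rw [col_diag, row_lt0 hij _ (fun l hl e => by rw [tbU_lo hl, zero_mul]), tbU_lo hij] at h
  simpa using h

theorem c5 : q • (tbU n j j * tU n j i) = q ^ (- dl n i j) • (tU n j i * tbU n j j) := by
  have h := bt0 j j j i
  rw [row_diag, col_gt0 hij _ (fun l hl e => by rw [tbU_lo hl, mul_zero]), tbU_lo hij, dl_symm] at h
  simpa using h

end comm

section BB
variable {n : ℕ} (i j : Fin (2*n)) (hij : (j : ℕ) = i + 1)
include hij

theorem sU_adj : sU n j i = eps n j • (tU n j j * tbU n i j) + eps n i • (tU n j i * tbU n i i) := by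
  have : Finset.Icc i j = {i, j} := by
    ext x; simp only [Finset.mem_Icc, Finset.mem_insert, Finset.mem_singleton, Fin.le_def, Fin.ext_iff]; omega
  have hne : i ≠ j := by intro h; rw [h] at hij; omega
  rw [sU, this, Finset.sum_pair hne, add_comm]

open TensorProduct in
theorem Delta_s : Delta n (sU n j i) = (tU n j j * tbU n i i) ⊗ₜ sU n j i + sU n j i ⊗ₜ 1 := by
  have hlt : i < j := by rw [Fin.lt_def]; omega
  have hne : i ≠ j := ne_of_lt hlt
  have h1 : Delta n (tU n j j) = tU n j j ⊗ₜ tU n j j := by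
    rw [Delta_t, Finset.sum_eq_single j]
    · intro b _ hb
      rcases lt_or_gt_of_ne hb with h | h
      · rw [tU_up h, tmul_zero]
      · rw [tU_up h, zero_tmul]
    · simp
  have h2 : Delta n (tbU n i i) = tbU n i i ⊗ₜ tbU n i i := by
    rw [Delta_tb, Finset.sum_eq_single i]
    · intro b _ hb
      rcases lt_or_gt_of_ne hb with h | h
      · rw [tbU_lo h, zero_tmul]
      · rw [tbU_lo h, tmul_zero]
    · simp
  have h3 : Delta n (tU n j i) = tU n j i ⊗ₜ tU n i i + tU n j j ⊗ₜ tU n j i := by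
    rw [Delta_t, ← Finset.sum_subset (Finset.subset_univ {i, j}), Finset.sum_pair hne]
    intro b _ hb
    simp only [Finset.mem_insert, Finset.mem_singleton, not_or, Fin.ext_iff] at hb
    rcases lt_or_ge b j with h | h
    · rw [tU_up (i := b) (j := i) (by rw [Fin.lt_def] at *; omega), tmul_zero]
    · rw [tU_up (i := j) (j := b) (by rw [Fin.lt_def]; rw [Fin.le_def] at h; omega), zero_tmul]
  have h4 : Delta n (tbU n i j) = tbU n i i ⊗ₜ tbU n i j + tbU n i j ⊗ₜ tbU n j j := by
    rw [Delta_tb, ← Finset.sum_subset (Finset.subset_univ {i, j}), Finset.sum_pair hne]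
    intro b _ hb
    simp only [Finset.mem_insert, Finset.mem_singleton, not_or, Fin.ext_iff] at hb
    rcases lt_or_ge b i with h | h
    · rw [tbU_lo h, zero_tmul]
    · rw [tbU_lo (i := b) (j := j) (by rw [Fin.lt_def]; rw [Fin.le_def] at h; omega), tmul_zero]
  rw [sU_adj i j hij, map_add, map_smul, map_smul, map_mul, map_mul, h1, h2, h3, h4]
  simp only [mul_add, add_mul, Algebra.TensorProduct.tmul_mul_tmul, t_tb, tmul_add, add_tmul, smul_add]
  simp only [tmul_smul, ← smul_tmul']
  abel

theorem unit_t (a : Fin (2*n)) : IsUnit (tU n a a) := ⟨⟨_, _, t_tb a, tb_t a⟩, rfl⟩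
theorem unit_tb (a : Fin (2*n)) : IsUnit (tbU n a a) := ⟨⟨_, _, tb_t a, t_tb a⟩, rfl⟩

theorem Ex_kap : (eps n j • (tU n j j * tbU n i j)) * (tU n j j * tbU n i i) =
    q ^ (2 + 2 * dl n i j) • ((tU n j j * tbU n i i) * (eps n j • (tU n j j * tbU n i j))) := by
  have hlt : i < j := by rw [Fin.lt_def]; omega
  have e1 : tbU n i j * tU n j j = q ^ (1 + dl n i j) • (tU n j j * tbU n i j) := by
    rw [zpow_add₀ q_ne, zpow_one, mul_comm, mul_smul, ← c2 hlt, smul_smul, ← zpow_add₀ q_ne]; simp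
  have e2 : tbU n i j * tbU n i i = q ^ (1 + dl n i j) • (tbU n i i * tbU n i j) := by
    have h := congrArg (fun z => q ^ (dl n i j) • (tbU n i i * z * tbU n i i)) (c1 hlt)
    simp only [mul_smul_comm, smul_mul_assoc] at h
    simp only [mul_assoc, t_tb, mul_one] at h
    rw [← mul_assoc (tbU n i i) (tU n i i), tb_t, one_mul, smul_smul, smul_smul, ← zpow_add₀ q_ne] at h
    rw [zpow_add₀ q_ne, zpow_one, mul_comm, h]; simp
  simp only [smul_mul_assoc, mul_smul_comm]
  rw [smul_comm]
  congr 1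
  rw [mul_assoc, ← mul_assoc (tbU n i j), e1, smul_mul_assoc, mul_assoc (tU n j j) (tbU n i j), e2]
  rw [mul_assoc (tU n j j) (tbU n i i), ← mul_assoc (tbU n i i) (tU n j j), c3 hlt]
  simp only [mul_smul_comm, smul_smul, ← zpow_add₀ q_ne, mul_assoc]
  congr 2; ring

theorem Fx_kap : (eps n i • (tU n j i * tbU n i i)) * (tU n j j * tbU n i i) =
    (q ^ (2 + 2 * dl n i j))⁻¹ • ((tU n j j * tbU n i i) * (eps n i • (tU n j i * tbU n i i))) := by
  have hlt : i < j := by rw [Fin.lt_def]; omega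
  have e1 : tU n j i * tbU n i i = q ^ (-1 - dl n i j) • (tbU n i i * tU n j i) := by
    rw [sub_eq_add_neg, zpow_add₀ q_ne, mul_smul, c4 hlt, smul_smul]; simp [q_ne]
  have e2 : tU n j i * tU n j j = q ^ (-1 - dl n i j) • (tU n j j * tU n j i) := by
    have h := congrArg (fun z => q⁻¹ • (tU n j j * z * tU n j j)) (c5 hlt)
    simp only [mul_smul_comm, smul_mul_assoc] at h
    simp only [mul_assoc, tb_t, mul_one] at h
    rw [← mul_assoc (tU n j j) (tbU n j j), t_tb, one_mul, smul_smul, smul_smul, inv_mul_cancel₀ q_ne, one_smul] at h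
    rw [sub_eq_add_neg, zpow_add₀ q_ne, h]; simp
  simp only [smul_mul_assoc, mul_smul_comm]
  rw [smul_comm]
  congr 1
  rw [mul_assoc, ← mul_assoc (tbU n i i) (tU n j j), c3 hlt, ← mul_assoc, ← mul_assoc, e2, smul_mul_assoc, smul_mul_assoc,
    mul_assoc (tU n j j) (tU n j i), e1]
  simp only [mul_smul_comm, smul_mul_assoc, smul_smul, ← zpow_add₀ q_ne, ← zpow_neg, mul_assoc, e1]

  congr 2; ring

theorem q_pow_ne {m : ℕ} (hm : m ≠ 0) : q ^ m ≠ 1 := by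
  intro h
  have h1 : (algebraMap (Polynomial ℂ) (RatFunc ℂ)) (Polynomial.X ^ m) = algebraMap _ _ (1 : Polynomial ℂ) := by
    rw [map_pow, RatFunc.algebraMap_X, map_one]; exact h
  have h2 := congrArg Polynomial.natDegree (RatFunc.algebraMap_injective ℂ h1)
  simp at h2; exact hm h2

open Polynomial in
theorem s_regular (hB : sU n j i ≠ 0) (x : Usp n) (p : F[X]) (hp : p ≠ 0)
    (hx : x * aeval (sU n j i) p = 0) : x = 0 := by
  have hu : IsUnit (tU n j j * tbU n i i) := (unit_t i j hij j).mul (unit_tb i j hij i)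
  refine regular (sU n j i) _ hu (Delta_s i j hij) ?_ x p hp hx
  intro p0 hp0 h0
  apply hB
  obtain ⟨m, hm⟩ : ∃ m : ℕ, (2 + 2 * dl n i j) = ((m+1 : ℕ) : ℤ) := by
    unfold dl; split_ifs
    · exact ⟨3, rfl⟩
    · exact ⟨1, rfl⟩
  rw [sU_adj i j hij]
  refine alg_zero (tU n j j * tbU n i i) _ _ hu (q ^ (2 + 2 * dl n i j)) (zpow_ne_zero _ q_ne) ?_
    (Ex_kap i j hij) (Fx_kap i j hij) ?_ p0 hp0 ?_
  · intro r
    rw [hm, zpow_natCast, ← pow_mul]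
    exact q_pow_ne i j hij (by positivity)
  · intro p1 hp1
    rw [← sU_adj i j hij] at *
    rw [← Delta_s i j hij, aeval_algHom_apply, hp1, map_zero]
  · rw [← sU_adj i j hij]; exact h0

end BB
end

section
section refl
variable {n : ℕ}

theorem Rm_G1 (i a j b : Fin (2*n)) :
    q ^ ((if i = a then (1:ℤ) else 0) - (if i = pr n a then (1:ℤ) else 0)) * (eps n i * eps n b * Rm n (j,a) (i,b)) =
    q ^ ((if j = b then (1:ℤ) else 0) - (if j = pr n b then (1:ℤ) else 0)) * (eps n a * eps n j * Rm n (j,a) (i,b)) := by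
  unfold Rm
  by_cases h1 : j = i ∧ a = b
  · obtain ⟨rfl, rfl⟩ := h1
    ring
  by_cases h2 : j < a ∧ i = a ∧ b = j
  · obtain ⟨h, rfl, rfl⟩ := h2
    simp [ne_pr_self, mul_comm]
  by_cases h3 : j < i ∧ a = pr n j ∧ b = pr n i
  · obtain ⟨h, rfl, rfl⟩ := h3
    simp only [pr_pr, eps_pr, neg_mul, mul_neg, eps_mul_self, eq_comm (a := i) (b := j)]
    simp only [eq_pr_comm n (i := i) (j := j)]
  simp [h1, h2, h3]

theorem Rm_G2 (i a j b : Fin (2*n)) :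
    (if i < a then Rm n (j,i) (a,b) else 0) = (if b < j then Rm n (b,a) (i,j) else 0) := by
  unfold Rm
  by_cases h1 : j = a ∧ i = b
  · obtain ⟨rfl, rfl⟩ := h1
    by_cases h : i < j
    · simp [h, not_lt_of_gt h, ne_of_lt h, ne_of_gt h, eq_pr_comm n (i := i) (j := j)]
    · simp [h]
  by_cases h3 : j < a ∧ i < a ∧ i = pr n j ∧ b = pr n a
  · obtain ⟨h, h', rfl, rfl⟩ := h3
    have e1 : pr n a < j := by rw [← pr_pr n j, pr_lt_pr]; exact h'
    have e2 : pr n a < pr n j := by rw [pr_lt_pr]; exact h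
    simp only [if_pos h', if_pos e1, pr_pr, bar_pr, eps_pr, e2, h, if_true, true_and, and_true]
    simp only [ne_of_gt h', ne_of_lt h, ne_of_lt e1, ne_of_lt e2, ne_of_gt e1, ne_of_gt e2, ne_of_gt h, ne_of_lt h', false_and, and_false, if_false]
    ring_nf
  have e1 : (if i < a then ((if j = a ∧ i = b then
      q ^ ((if j = i then (1:ℤ) else 0) - (if j = pr n i then (1:ℤ) else 0)) else 0)
      + (if j < i ∧ a = i ∧ b = j then q - q⁻¹ else 0)
      - (if j < a ∧ i = pr n j ∧ b = pr n a then
      (q - q⁻¹) * q ^ (bar n a - bar n j) * eps n j * eps n a else 0)) else 0) = 0 := by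
    split_ifs with g <;> first | rfl | skip
    all_goals first | (exfalso; tauto) | simp
    all_goals (rename_i u v; obtain ⟨_, rfl, _⟩ := u; exact absurd g (lt_irrefl _))
  have e2 : (if b < j then ((if b = i ∧ a = j then
      q ^ ((if b = a then (1:ℤ) else 0) - (if b = pr n a then (1:ℤ) else 0)) else 0)
      + (if b < a ∧ i = a ∧ j = b then q - q⁻¹ else 0)
      - (if b < i ∧ a = pr n b ∧ j = pr n i then
      (q - q⁻¹) * q ^ (bar n i - bar n b) * eps n b * eps n i else 0)) else 0) = 0 := by
    by_cases g : b < j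
    · have g1 : ¬ (b = i ∧ a = j) := fun h => h1 ⟨h.2.symm, h.1.symm⟩
      have g2 : ¬ (b < a ∧ i = a ∧ j = b) := fun h => (ne_of_gt g) h.2.2
      have g3 : ¬ (b < i ∧ a = pr n b ∧ j = pr n i) := by
        rintro ⟨x, rfl, rfl⟩
        refine h3 ⟨(pr_lt_pr n).2 x, ?_, (pr_pr n i).symm, (pr_pr n b).symm⟩
        rw [← pr_pr n i, pr_lt_pr]; exact g
      simp [g, g1, g2, g3]
    · simp [g]
  exact e1.trans e2.symm

theorem Rm_S1 (j k b : Fin (2*n)) : Rm n (j, pr n k) (k, b) = if k = j ∧ b = pr n j then q⁻¹ else 0 := by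
  unfold Rm
  by_cases h : k = j ∧ b = pr n j
  · obtain ⟨rfl, rfl⟩ := h
    simp [ne_pr_self, pr_pr, pr_ne]
  · have h1 : ¬ (j = k ∧ pr n k = b) := fun g => h ⟨g.1.symm, by rw [g.1, g.2]⟩
    have h2 : ¬ (j < pr n k ∧ k = pr n k ∧ b = j) := fun g => ne_pr_self k g.2.1
    have h3 : ¬ (j < k ∧ pr n k = pr n j ∧ b = pr n k) := fun g => (ne_of_gt g.1) ((pr_inj n).1 g.2.1)
    simp [h, h1, h2, h3]

theorem Rm_S2 (l a i : Fin (2*n)) : Rm n (l, a) (i, pr n l) = if l = i ∧ a = pr n i then q⁻¹ else 0 := by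
  unfold Rm
  by_cases h : l = i ∧ a = pr n i
  · obtain ⟨rfl, rfl⟩ := h
    simp [ne_pr_self, pr_pr, pr_ne]
  · have h1 : ¬ (l = i ∧ a = pr n l) := fun g => h ⟨g.1, by rw [g.2, g.1]⟩
    have h2 : ¬ (l < a ∧ i = a ∧ pr n l = l) := fun g => pr_ne n l g.2.2
    have h3 : ¬ (l < i ∧ a = pr n l ∧ pr n l = pr n i) := fun g => (ne_of_lt g.1) ((pr_inj n).1 g.2.2)
    simp [h, h1, h2, h3]

theorem const_D (i a j b : Fin (2*n)) :
    rowS n i a (fun k c => eps n k * eps n b * Rm n (j,c) (k,b)) =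
    colS n j b (fun l c => eps n a * eps n l * Rm n (l,a) (i,c)) := by
  rw [rowS, colS, Rm_row, Rm_col]
  simp only [smul_eq_mul]
  rw [Rm_G1]
  congr 1
  · congr 1
    have := Rm_G2 i a j b
    split_ifs with h1 h2 h2
    · rw [if_pos h1, if_pos h2] at this; rw [this]
    · rw [if_pos h1, if_neg h2] at this; rw [this]; ring
    · rw [if_neg h1, if_pos h2] at this; rw [← this]; ring
    · rfl
  · by_cases h : a = pr n i ∧ b = pr n j
    · obtain ⟨rfl, rfl⟩ := h
      rw [if_pos rfl, if_pos rfl, Finset.sum_eq_single j, Finset.sum_eq_single i]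
      · simp only [Rm_S1, Rm_S2, and_self, if_true, eps_pr]
        split_ifs
        · have := eps_mul_self n i; have := eps_mul_self n j
          linear_combination (q - q⁻¹) * q ^ (bar n j - bar n i) * q⁻¹ * eps n i * eps n j * (eps_mul_self n i - eps_mul_self n j)
        · rfl
      · intro l _ hl; rw [Rm_S2]; simp [hl]
      · simp
      · intro k _ hk; rw [Rm_S1]; simp [hk]
      · simp
    · have e1 : (if a = pr n i then ∑ k, if i < k then ((q - q⁻¹) * q ^ (bar n k - bar n i) * eps n i * eps n k) * (eps n k * eps n b * Rm n (j,pr n k) (k,b)) else 0 else 0) = 0 := by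
        split_ifs with h1
        · have h2 : b ≠ pr n j := fun g => h ⟨h1, g⟩
          simp [Rm_S1, h2]
        · rfl
      have e2 : (if b = pr n j then ∑ l, if l < j then ((q - q⁻¹) * q ^ (bar n j - bar n l) * eps n l * eps n j) * (eps n a * eps n l * Rm n (l,a) (i,pr n l)) else 0 else 0) = 0 := by
        split_ifs with h1
        · have h2 : a ≠ pr n i := fun g => h ⟨g, h1⟩
          simp [Rm_S2, h2]
        · rfl
      rw [e1, e2]


/-- G₁ -/
def L1 (G : Mat n (Usp n)) : Mat2 n (Usp n) := fun p s => if p.2 = s.2 then G p.1 s.1 else 0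
/-- H₂ -/
def L2 (H : Mat n (Usp n)) : Mat2 n (Usp n) := fun p s => if p.1 = s.1 then H p.2 s.2 else 0
/-- partial transpose of R -/
def RP (n : ℕ) : Mat2 n (Usp n) := fun p s => algebraMap F _ (Rm n (s.1, p.2) (p.1, s.2))

theorem L1_mul (G : Mat n (Usp n)) (Z : Mat2 n (Usp n)) (i a) (s) : (L1 G * Z) (i,a) s = ∑ k, G i k * Z (k,a) s := by
  simp [Matrix.mul_apply, L1, Fintype.sum_prod_type]
theorem L2_mul (G : Mat n (Usp n)) (Z : Mat2 n (Usp n)) (i a) (s) : (L2 G * Z) (i,a) s = ∑ c, G a c * Z (i,c) s := by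
  simp [Matrix.mul_apply, L2, Fintype.sum_prod_type]
theorem mul_L1 (G : Mat n (Usp n)) (Z : Mat2 n (Usp n)) (j b) (p) : (Z * L1 G) p (j,b) = ∑ k, Z p (k,b) * G k j := by
  simp [Matrix.mul_apply, L1, Fintype.sum_prod_type]
theorem mul_L2 (G : Mat n (Usp n)) (Z : Mat2 n (Usp n)) (j b) (p) : (Z * L2 G) p (j,b) = ∑ c, Z p (j,c) * G c b := by
  simp [Matrix.mul_apply, L2, Fintype.sum_prod_type]

theorem L1_L2 (G H : Mat n (Usp n)) : L1 G * L2 H = M12 G H := by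
  ext ⟨i,a⟩ ⟨j,b⟩; rw [L1_mul]; simp [L2, M12]
theorem L2_L1 (G H : Mat n (Usp n)) : L2 H * L1 G = M21 G H := by
  ext ⟨i,a⟩ ⟨j,b⟩; rw [L2_mul]; simp [L1, M21]
theorem L1_hom (G H : Mat n (Usp n)) : L1 (G * H) = L1 G * L1 H := by
  ext ⟨i,a⟩ ⟨j,b⟩; rw [L1_mul]
  by_cases h : a = b <;> simp [L1, Matrix.mul_apply, h]
theorem L2_hom (G H : Mat n (Usp n)) : L2 (G * H) = L2 G * L2 H := by
  ext ⟨i,a⟩ ⟨j,b⟩; rw [L2_mul]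
  by_cases h : i = j <;> simp [L2, Matrix.mul_apply, h]

/-- J -/
def JU (n : ℕ) : Mat n (Usp n) := Matrix.diagonal fun i => algebraMap F _ (eps n i)
/-- transposed second matrix -/
def WU (n : ℕ) : Mat n (Usp n) := fun i j => tbU n j i
/-- the S matrix -/
def SU (n : ℕ) : Mat n (Usp n) := TU n * JU n * WU n

theorem SU_eq (i j : Fin (2*n)) : SU n i j = sU n i j := by
  rw [SU, mul_assoc, Matrix.mul_apply]
  have : ∀ k, (JU n * WU n) k j = eps n k • tbU n j k := by
    intro k; rw [JU, Matrix.diagonal_mul, WU, Algebra.smul_def]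
  simp only [this]
  rw [sU, ← Finset.sum_subset (Finset.subset_univ (Finset.Icc j i))]
  · exact Finset.sum_congr rfl fun k _ => mul_smul_comm _ _ _
  · intro k _ hk
    rw [Finset.mem_Icc, not_and_or, not_le, not_le] at hk
    rcases hk with hk | hk
    · rw [tbU_lo hk, smul_zero, mul_zero]
    · rw [TU, tU_up hk, zero_mul]

theorem J1_comm (H : Mat n (Usp n)) : L1 (JU n) * L2 H = L2 H * L1 (JU n) := by
  rw [L1_L2, L2_L1]; ext ⟨i,a⟩ ⟨j,b⟩
  simp only [M12, M21, JU, Matrix.diagonal_apply]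
  split_ifs
  · rw [Algebra.commutes]
  · simp
theorem J2_comm (H : Mat n (Usp n)) : L2 (JU n) * L1 H = L1 H * L2 (JU n) := by
  rw [L1_L2, L2_L1]; ext ⟨i,a⟩ ⟨j,b⟩
  simp only [M12, M21, JU, Matrix.diagonal_apply]
  split_ifs
  · rw [Algebra.commutes]
  · simp

theorem relA : L1 (WU n) * RP n * L2 (TU n) = L2 (TU n) * RP n * L1 (WU n) := by
  ext ⟨i,a⟩ ⟨j,b⟩
  rw [mul_L2, mul_L1]
  simp only [L1_mul, L2_mul, RP, WU, TU, Finset.sum_mul]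
  have h := bt0 j a i b
  rw [rowS, colS, Finset.sum_comm] at h
  simp only [mul_assoc, Algebra.left_comm, ← Algebra.smul_def]
  simpa only [mul_assoc, Algebra.left_comm, Algebra.commutes, ← Algebra.smul_def, mul_smul_comm, smul_mul_assoc] using h

theorem relB : L2 (WU n) * RP n * L1 (TU n) = L1 (TU n) * RP n * L2 (WU n) := by
  ext ⟨i,a⟩ ⟨j,b⟩
  rw [mul_L2, mul_L1]
  simp only [L1_mul, L2_mul, RP, WU, TU, Finset.sum_mul]
  have h := bt0 b i a j
  rw [rowS, colS, Finset.sum_comm] at h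
  simp only [← Rm_symm n _ _ i b] at h
  simp only [Rm_symm n _ _ a j] at h
  simp only [mul_assoc, Algebra.left_comm, ← Algebra.smul_def]
  simpa only [mul_assoc, Algebra.left_comm, Algebra.commutes, ← Algebra.smul_def, mul_smul_comm, smul_mul_assoc] using h

theorem relC : L2 (WU n) * L1 (WU n) * RX n (Usp n) = RX n (Usp n) * L1 (WU n) * L2 (WU n) := by
  rw [L2_L1, mul_assoc, L1_L2]
  ext ⟨i,a⟩ ⟨j,b⟩
  rw [RX_M12, M21_RX]
  have h := bb0 b j a i
  rw [rowS, colS] at h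
  simp only [← Rm_symm n _ _ j b] at h
  simp only [Rm_symm n _ _ a i] at h
  rw [Finset.sum_comm (s := Finset.univ) (f := fun l c => Rm n (i,a) (c,l) • _)] at h
  exact h

theorem relD : RX n (Usp n) * L1 (JU n) * RP n * L2 (JU n) = L2 (JU n) * RP n * L1 (JU n) * RX n (Usp n) := by
  ext ⟨i,a⟩ ⟨j,b⟩
  have h := congrArg (algebraMap F (Usp n)) (const_D i a j b)
  rw [rowS, colS] at h
  rw [mul_L2, mul_assoc (L2 _), mul_assoc (L2 _), L2_mul]
  simp only [JU, Matrix.diagonal_apply]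
  simp only [mul_ite, ite_mul, mul_zero, zero_mul, Finset.sum_ite_eq, Finset.sum_ite_eq', Finset.mem_univ, if_true]
  rw [mul_assoc, Matrix.mul_apply, Matrix.mul_apply, Fintype.sum_prod_type, Fintype.sum_prod_type]
  simp only [L1_mul, mul_L1, Matrix.diagonal_apply]
  simp only [mul_ite, ite_mul, mul_zero, zero_mul, Finset.sum_ite_eq, Finset.sum_ite_eq', Finset.mem_univ, if_true]
  simp only [RX, RP, ← map_mul, ← map_sum]
  simp only [smul_eq_mul] at h
  convert h using 2
  · rw [Finset.sum_mul]
    refine Finset.sum_congr rfl fun k _ => ?_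
    rw [Finset.sum_mul]
    refine Finset.sum_congr rfl fun c _ => ?_
    ring
  · rw [Finset.mul_sum]
    refine Finset.sum_congr rfl fun k _ => ?_
    rw [Finset.mul_sum]
    refine Finset.sum_congr rfl fun c _ => ?_
    ring

theorem RE_mat : RX n (Usp n) * L1 (SU n) * RP n * L2 (SU n) = L2 (SU n) * RP n * L1 (SU n) * RX n (Usp n) := by
  have htt : RX n (Usp n) * L1 (TU n) * L2 (TU n) = L2 (TU n) * L1 (TU n) * RX n (Usp n) := by
    rw [mul_assoc, L1_L2, L2_L1]; exact (RTT_U n).tt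
  simp only [SU, L1_hom, L2_hom]
  have A := relA (n := n)
  have B := relB (n := n)
  have C := relC (n := n)
  have D := relD (n := n)
  have J1T := J1_comm (TU n)
  have J1W := J1_comm (WU n)
  have J2T := J2_comm (TU n)
  have J2W := J2_comm (WU n)
  generalize L1 (TU n) = T1 at *
  generalize L2 (TU n) = T2 at *
  generalize L1 (JU n) = J1 at *
  generalize L2 (JU n) = J2 at *
  generalize L1 (WU n) = W1 at *
  generalize L2 (WU n) = W2 at *
  generalize RX n (Usp n) = R at *
  generalize RP n = P at *
  calc R * (T1 * J1 * W1) * P * (T2 * J2 * W2) = R * T1 * J1 * (W1 * P * T2) * J2 * W2 := by simp only [mul_assoc]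
    _ = R * T1 * (J1 * T2) * P * (W1 * J2) * W2 := by rw [A]; simp only [mul_assoc]
    _ = (R * T1 * T2) * J1 * P * J2 * W1 * W2 := by rw [J1T, ← J2W]; simp only [mul_assoc]
    _ = T2 * T1 * (R * J1 * P * J2) * W1 * W2 := by rw [htt]; simp only [mul_assoc]
    _ = T2 * T1 * J2 * P * J1 * (R * W1 * W2) := by rw [D]; simp only [mul_assoc]
    _ = T2 * (T1 * J2) * P * (J1 * W2) * W1 * R := by rw [← C]; simp only [mul_assoc]
    _ = T2 * J2 * (T1 * P * W2) * J1 * W1 * R := by rw [← J2T, J1W]; simp only [mul_assoc]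
    _ = (T2 * J2 * W2) * P * (T1 * J1 * W1) * R := by rw [← B]; simp only [mul_assoc]

/-- reflection equation, entrywise -/
theorem RE (i a j b : Fin (2*n)) :
    rowS n i a (fun k c => rowS n j c (fun x y => sU n k x * sU n y b)) =
    colS n j b (fun l c => colS n i c (fun x y => sU n a y * sU n x l)) := by
  have h := congrFun (congrFun (RE_mat (n := n)) (i,a)) (j,b)
  rw [mul_assoc, mul_assoc] at h
  rw [Matrix.mul_apply, Matrix.mul_apply, Fintype.sum_prod_type, Fintype.sum_prod_type] at h
  simp only [L1_mul, mul_L1, L2_mul, mul_L2, RP, RX, SU_eq, Finset.mul_sum, Finset.sum_mul] at h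
  simp only [rowS, colS, Finset.smul_sum]
  simp only [mul_assoc, Algebra.left_comm, ← Algebra.smul_def] at h
  simp only [mul_smul_comm, smul_mul_assoc] at h
  rw [h]
  refine Finset.sum_congr rfl fun x _ => Finset.sum_congr rfl fun x1 _ => Finset.sum_congr rfl fun x2 _ => Finset.sum_congr rfl fun x3 _ => ?_
  rw [← Algebra.commutes, ← Algebra.smul_def, mul_smul_comm, smul_comm]
end refl
end

section
section inst
variable {n : ℕ}

section gl
variable {k : Type*} [Field k] {M : Type*} [AddCommGroup M] [Module k M] (q : k) (hq : q ≠ 0)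
include hq
theorem gl1 (x y : M) (h : q⁻¹ • q⁻¹ • x + ((q - q⁻¹) * q⁻¹) • y = x) : (1 - q⁻¹ * q⁻¹) • (x - y) = 0 := by
  linear_combination (norm := skip) (-1 : k) • h
  match_scalars <;> field_simp <;> ring
theorem gl2 (x y z : M) (h : x + (q - q⁻¹) • (y + (q - q⁻¹) • z) = q • (y + (q - q⁻¹) • z)) : x - q⁻¹ • y = (1 - q⁻¹ * q⁻¹) • z := by
  linear_combination (norm := skip) h
  match_scalars <;> field_simp <;> ring
end gl

theorem pr_val (i : Fin (2*n)) : (pr n i : ℕ) = 2*n-1-i := rfl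

theorem sU_up {i j : Fin (2*n)} (h : i < j) : sU n i j = 0 := by
  rw [sU, Finset.Icc_eq_empty (not_le_of_gt h), Finset.sum_empty]

theorem sU_diag (i : Fin (2*n)) : sU n i i = eps n i • 1 := by
  rw [sU, Finset.Icc_self, Finset.sum_singleton, t_tb]

/-- the abstract relations of the generators of the twisted algebra -/
structure SRel (n : ℕ) {A : Type*} [Ring A] [Algebra F A] (s : Fin (2*n) → Fin (2*n) → A) : Prop where
  re : ∀ i a j b, rowS n i a (fun k c => rowS n j c (fun x y => s k x * s y b)) = colS n j b (fun l c => colS n i c (fun x y => s a y * s x l))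
  up : ∀ {i j}, i < j → s i j = 0
  diag : ∀ i, s i i = eps n i • 1

theorem SRel_U : SRel n (sU n) := ⟨RE, sU_up, sU_diag⟩

variable {A : Type*} [Ring A] [Algebra F A] {s : Fin (2*n) → Fin (2*n) → A}
theorem eps_lt {i : Fin (2*n)} (h : (i : ℕ) < n) : eps n i = 1 := by rw [eps, if_pos h]
theorem eps_ge {i : Fin (2*n)} (h : n ≤ (i : ℕ)) : eps n i = -1 := by rw [eps, if_neg (not_lt.2 h)]
theorem bar_lt {i : Fin (2*n)} (h : (i : ℕ) < n) : bar n i = (n : ℤ) - (i : ℕ) := by rw [bar, if_pos h]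
theorem bar_ge {i : Fin (2*n)} (h : n ≤ (i : ℕ)) : bar n i = (n : ℤ) - (i : ℕ) - 1 := by rw [bar, if_neg (not_lt.2 h)]

theorem Y0 (H : SRel n s) (g : Fin (2*n) → A) {j c b : Fin (2*n)} (hcb : c < b) (h : c ≤ j ∨ (j < b ∧ c ≠ pr n j)) :
    rowS n j c (fun x y => g x * s y b) = 0 := by
  rcases lt_trichotomy c j with h1 | h1 | h1
  · rw [row_gt0 h1 _ (fun k hk e => by rw [H.up, mul_zero]; have := pr_val j; have := pr_val k; omega), H.up hcb, mul_zero, smul_zero]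
  · subst h1; rw [row_diag, H.up hcb, mul_zero, smul_zero]
  · obtain ⟨h2, h3⟩ := h.resolve_left (not_le_of_gt h1)
    rw [row_lt h1 h3, H.up hcb, H.up h2]; simp

/-- peel left -/
theorem peelL (H : SRel n s) (j m r : Fin (2*n)) (hr : (r : ℕ) = m + 1) (hj : j < m) (h1 : r ≠ pr n m) (h2 : m ≠ pr n j) (h3 : r ≠ pr n j) :
    s m j * s r m + ((q - q⁻¹) * eps n m) • s r j = q • (s r m * s m j) := by
  have h := H.re m r j m
  have e1 : m < r := by omega
  have e2 : j < r := by omega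
  rw [row_lt e1 h1, row_lt e2 h3, row_lt hj h2, col_lt hj h2, col_diag, H.up e1, H.up hj, H.diag m] at h
  simpa [smul_smul] using h

/-- peel right -/
theorem peelR (H : SRel n s) (k j i : Fin (2*n)) (hk : (j : ℕ) = k + 1) (hi : j < i) (h1 : i ≠ pr n j) (h2 : i ≠ pr n k) (h3 : j ≠ pr n k) :
    s j k * s i j + ((q - q⁻¹) * eps n j) • s i k = q • (s i j * s j k) := by
  have h := H.re j i k j
  have e1 : k < j := by omega
  have e2 : k < i := by omega
  rw [row_lt hi h1, row_lt e2 h2, row_lt e1 h3, col_lt e1 h3, col_diag, H.up hi, H.up e1, H.diag j] at h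
  simpa [smul_smul] using h

/-- exceptional -/
theorem excC (H : SRel n s) (j m r p : Fin (2*n)) (hj : (j : ℕ) + 1 < n) (hr : r = pr n j) (hm : (m : ℕ) + 1 = r) (hp : (p : ℕ) = j + 1) :
    q⁻¹ • (s m j * s r m) + ((q - q⁻¹) * q⁻¹) • s m p - (q - q⁻¹) • s r j = q • (s r m * s m j) := by
  have hrv := pr_val j
  rw [← hr] at hrv
  have hmv := pr_val m
  have hpm : p = pr n m := by omega
  have h := H.re m r j m
  have e1 : m < r := by omega
  have e2 : j < r := by omega
  have e3 : j < m := by omega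
  rw [row_lt e1 (by omega), row_lt e3 (by omega), col_lt e3 (by omega), col_diag, H.up e3, H.diag m] at h
  have key : rowS n j r (fun x y => s m x * s y m) = q⁻¹ • (s m j * s r m) + ((q - q⁻¹) * q⁻¹) • s m p := by
    rw [hr, row_pr, ← hr, if_pos e2, H.up e1, Finset.sum_eq_single p]
    · rw [if_pos (by omega), hpm, pr_pr, ← hpm, H.diag, eps_ge (i := m) (by omega), eps_lt (i := j) (by omega), eps_lt (i := p) (by omega),
        bar_lt (i := j) (by omega), bar_lt (i := p) (by omega)]
      have : ((n : ℤ) - (p : ℕ) - (n - (j : ℕ))) = -1 := by omega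
      rw [this]; simp
    · intro x _ hx
      split_ifs with h1
      · rcases lt_or_ge x p with h2 | h2
        · omega
        · rw [H.up (i := pr n x) (j := m), mul_zero, smul_zero]
          have := pr_val x; omega
      · rfl
    · simp
  rw [key, eps_ge (i := m) (by omega)] at h
  rw [← h]
  simp; abel

theorem qq_ne : (1 : F) - q⁻¹ * q⁻¹ ≠ 0 := by
  intro h
  have h1 : q ^ 2 = 1 := by
    have := q_ne
    field_simp at h
    linear_combination h
  have h2 : (RatFunc.X : RatFunc ℂ) ^ 2 = 1 := h1
  have h3 : (algebraMap (Polynomial ℂ) (RatFunc ℂ)) (Polynomial.X ^ 2) = algebraMap _ _ (1 : Polynomial ℂ) := by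
    rw [map_pow, RatFunc.algebraMap_X, map_one]; exact h2
  have h4 := congrArg Polynomial.natDegree (RatFunc.algebraMap_injective ℂ h3)
  simp at h4

/-- symmetry of the lower diagonal -/
theorem symD (H : SRel n s) (i i1 : Fin (2*n)) (h1 : (i1 : ℕ) = i + 1) (hi : (i1 : ℕ) < n) :
    s (pr n i) (pr n i1) = s i1 i := by
  have hv := pr_val i
  have hv1 := pr_val i1
  have h := H.re i (pr n i) i (pr n i1)
  have e1 : i < pr n i := by omega
  have e2 : i < pr n i1 := by omega
  have e3 : pr n i1 ≠ pr n i := by omega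
  rw [row_pr, if_pos e1, col_lt e2 e3, col_lt e2 e3, row_diag, H.up e2] at h
  have k1 : rowS n i (pr n i) (fun x y => s i x * s y (pr n i1)) = q⁻¹ • (s (pr n i) (pr n i1)) := by
    rw [row_pr, if_pos e1, H.up e1, Finset.sum_eq_zero]
    · rw [H.diag, eps_lt (by omega)]; simp
    · intro k _
      split_ifs with h2
      · rw [H.up h2]; simp
      · rfl
  rw [k1, Finset.sum_eq_single i1] at h
  · rw [if_pos (by omega), row_lt e2 e3, H.up e2, H.diag, H.diag, eps_lt (i := i) (by omega), eps_lt (i := i1) (by omega), eps_ge (i := pr n i1) (by omega),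
        bar_lt (i := i) (by omega), bar_lt (i := i1) (by omega)] at h
    have : ((n : ℤ) - (i1 : ℕ) - (n - (i : ℕ))) = -1 := by omega
    rw [this] at h
    have h' : (1 - q⁻¹ * q⁻¹) • (s (pr n i) (pr n i1) - s i1 i) = 0 := by
      simp at h
      exact gl1 q q_ne _ _ h
    exact sub_eq_zero.1 ((smul_eq_zero.1 h').resolve_left qq_ne)
  · intro k _ hk
    split_ifs with h2
    · have hk' := pr_val k
      rw [Y0 H, smul_zero]
      · omega
      · right; constructor
        · omega
        · omega
    · rfl
  · simp

/-- commuting generators -/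
theorem commG (H : SRel n s) (p p1 r r1 : Fin (2*n)) (hp : (p1 : ℕ) = p + 1) (hr : (r1 : ℕ) = r + 1) (h : p1 < r) (hn : (r1 : ℕ) ≤ n) :
    s p1 p * s r1 r = s r1 r * s p1 p := by
  have hv := pr_val p
  have hv1 := pr_val p1
  have hh := H.re p1 r1 p r
  rw [row_lt (i := p1) (a := r1) (by omega) (by omega), row_lt (i := p) (a := r1) (by omega) (by omega),
    row_lt (i := p) (a := p1) (by omega) (by omega), col_lt (j := p) (b := r) (by omega) (by omega),
    col_lt (j := p1) (b := r) (by omega) (by omega), H.up (i := p1) (j := r1) (by omega), H.up (i := p1) (j := r) (by omega),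
    H.up (i := p) (j := r) (by omega)] at hh
  simpa using hh

/-- type A Serre 1 -/
theorem serA1 (H : SRel n s) (x y z : Fin (2*n)) (hy : (y : ℕ) = x + 1) (hz : (z : ℕ) = y + 1) (hn : (z : ℕ) < n) :
    s y x * s z x - q⁻¹ • (s z x * s y x) = (1 - q⁻¹ * q⁻¹) • s z y := by
  have hv := pr_val x
  have hv1 := pr_val y
  have hh := H.re y z x x
  have hq := q_ne
  rw [row_lt (i := y) (a := z) (by omega) (by omega), row_lt (i := x) (a := z) (by omega) (by omega),
    row_lt (i := x) (a := y) (by omega) (by omega), col_diag, col_gt (j := y) (b := x) (by omega) (by omega),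
    H.up (i := y) (j := z) (by omega), H.diag, eps_lt (i := x) (by omega)] at hh
  simp only [one_smul, mul_one, zero_mul, smul_zero, add_zero] at hh
  exact gl2 q q_ne _ _ _ hh

/-- type A Serre 2 -/
theorem serA2 (H : SRel n s) (x y z : Fin (2*n)) (hy : (y : ℕ) = x + 1) (hz : (z : ℕ) = y + 1) (hn : (z : ℕ) < n) :
    q • (s z x * s z y) = s z y * s z x + (q - q⁻¹) • s y x := by
  have hv := pr_val x
  have hv1 := pr_val z
  have hh := H.re z z x y
  have hq := q_ne
  rw [row_diag, row_lt (i := x) (a := z) (by omega) (by omega), col_lt (j := x) (b := y) (by omega) (by omega),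
    col_gt (j := z) (b := y) (by omega) (by omega),
    H.up (i := x) (j := y) (by omega), H.diag, eps_lt (i := z) (by omega)] at hh
  simpa using hh

end inst
end

section
section mid
variable {n : ℕ}

section rows
variable {M : Type*} [AddCommGroup M] [Module F M]
  {p0 p1 p2 p3 : Fin (2*n)} (h0 : (p0 : ℕ) + 2 = n) (h1 : (p1 : ℕ) + 1 = n) (h2 : (p2 : ℕ) = n) (h3 : (p3 : ℕ) = n + 1)
include h0 h1 h2 h3

theorem prs : pr n p0 = p3 ∧ pr n p1 = p2 ∧ pr n p2 = p1 ∧ pr n p3 = p0 := by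
  have := pr_val p0; have := pr_val p1; have := pr_val p2; have := pr_val p3
  refine ⟨?_, ?_, ?_, ?_⟩ <;> omega

theorem row_p1 (f : Fin (2*n) → Fin (2*n) → M) (hz : ∀ k, p3 < k → f k (pr n k) = 0) :
    rowS n p1 p2 f = q⁻¹ • f p1 p2 + (q - q⁻¹) • f p2 p1
      - (((q - q⁻¹) * q ^ (-2 : ℤ) * 1 * (-1)) • f p2 p1 + ((q - q⁻¹) * q ^ (-3 : ℤ) * 1 * (-1)) • f p3 p0) := by
  obtain ⟨e0, e1, e2, e3⟩ := prs h0 h1 h2 h3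
  have h := row_pr p1 f
  rw [e1, if_pos (by omega)] at h
  rw [h, Fintype.sum_eq_add p2 p3 (by omega), if_pos (by omega), if_pos (by omega), e2, e3, eps_lt (i := p1) (by omega), eps_ge (i := p2) (by omega), eps_ge (i := p3) (by omega), bar_lt (i := p1) (by omega), bar_ge (i := p2) (by omega), bar_ge (i := p3) (by omega)]
  · have : ((n : ℤ) - (p2 : ℕ) - 1 - (n - (p1 : ℕ))) = -2 := by omega
    rw [this]
    have : ((n : ℤ) - (p3 : ℕ) - 1 - (n - (p1 : ℕ))) = -3 := by omega
    rw [this]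
  · intro x hx
    split_ifs with h4
    · rw [hz x (by omega), smul_zero]
    · rfl

theorem row_p2 (f : Fin (2*n) → Fin (2*n) → M) (hz : ∀ k, p3 < k → f k (pr n k) = 0) :
    rowS n p2 p1 f = q⁻¹ • f p2 p1 - ((q - q⁻¹) * q ^ (-1 : ℤ) * (-1) * (-1)) • f p3 p0 := by
  obtain ⟨e0, e1, e2, e3⟩ := prs h0 h1 h2 h3
  have h := row_pr p2 f
  rw [e2, if_neg (by omega)] at h
  rw [h, Fintype.sum_eq_single p3, if_pos (by omega), e3, eps_ge (i := p2) (by omega), eps_ge (i := p3) (by omega), bar_ge (i := p2) (by omega), bar_ge (i := p3) (by omega)]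
  · have : ((n : ℤ) - (p3 : ℕ) - 1 - (n - (p2 : ℕ) - 1)) = -1 := by omega
    rw [this, add_zero]
  · intro x hx
    split_ifs with h4
    · rw [hz x (by omega), smul_zero]
    · rfl

theorem row_p0 (f : Fin (2*n) → Fin (2*n) → M) (hz : ∀ k, p1 < k → f k (pr n k) = 0) :
    rowS n p0 p3 f = q⁻¹ • f p0 p3 - ((q - q⁻¹) * q ^ (-1 : ℤ) * 1 * 1) • f p1 p2 := by
  obtain ⟨e0, e1, e2, e3⟩ := prs h0 h1 h2 h3
  have h := row_pr p0 f
  have hz3 := hz p3 (by omega)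
  rw [e3] at hz3
  rw [e0, if_pos (by omega)] at h
  rw [h, Fintype.sum_eq_single p1, if_pos (by omega), e1, eps_lt (i := p1) (by omega), eps_lt (i := p0) (by omega), bar_lt (i := p1) (by omega), bar_lt (i := p0) (by omega)]
  · have : ((n : ℤ) - (p1 : ℕ) - (n - (p0 : ℕ))) = -1 := by omega
    rw [this, hz3, smul_zero, add_zero]
  · intro x hx
    split_ifs with h4
    · rw [hz x (by omega), smul_zero]
    · rfl

theorem col_p2 (f : Fin (2*n) → Fin (2*n) → M) (hz : ∀ k, k < p1 → f k (pr n k) = 0) :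
    colS n p2 p1 f = q⁻¹ • f p2 p1 + (q - q⁻¹) • f p1 p2 - ((q - q⁻¹) * q ^ (-2 : ℤ) * 1 * (-1)) • f p1 p2 := by
  obtain ⟨e0, e1, e2, e3⟩ := prs h0 h1 h2 h3
  have h := col_pr p2 f
  rw [e2, if_pos (by omega)] at h
  rw [h, Fintype.sum_eq_single p1, if_pos (by omega), e1, eps_lt (i := p1) (by omega), eps_ge (i := p2) (by omega), bar_lt (i := p1) (by omega), bar_ge (i := p2) (by omega)]
  · have : ((n : ℤ) - (p2 : ℕ) - 1 - (n - (p1 : ℕ))) = -2 := by omega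
    rw [this]
  · intro x hx
    split_ifs with h4
    · rw [hz x (by omega), smul_zero]
    · rfl

end rows

section gens
variable {A : Type*} [Ring A] [Algebra F A] {s : Fin (2*n) → Fin (2*n) → A} (H : SRel n s)
  {p0 p1 p2 p3 : Fin (2*n)} (h0 : (p0 : ℕ) + 2 = n) (h1 : (p1 : ℕ) + 1 = n) (h2 : (p2 : ℕ) = n) (h3 : (p3 : ℕ) = n + 1)
include H h0 h1 h2 h3

theorem E1 : q⁻¹ • (s p1 p0 * s p2 p1) + (q - q⁻¹) • s p2 p0 - (((q - q⁻¹) * q ^ (-2 : ℤ) * 1 * (-1)) • s p2 p0)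
    = q • (s p2 p1 * s p1 p0) := by
  have v0 := pr_val p0; have v1 := pr_val p1
  have h := H.re p1 p2 p0 p1
  rw [row_p1 h0 h1 h2 h3 _ (fun k hk => Y0 H _ (by have := pr_val k; omega) (Or.inl (by have := pr_val k; omega))),
    row_lt (i := p0) (a := p2) (by omega) (by omega), row_lt (i := p0) (a := p1) (by omega) (by omega), row_diag,
    col_lt (j := p0) (b := p1) (by omega) (by omega), col_diag, H.up (i := p1) (j := p2) (by omega),
    H.up (i := p0) (j := p1) (by omega), H.diag, eps_lt (i := p1) (by omega)] at h
  simpa only [one_smul, mul_one, zero_mul, mul_zero, smul_zero, add_zero] using h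

theorem E2 : s p2 p1 * s p1 p0 - ((q - q⁻¹) * q ^ (-1 : ℤ) * (-1) * (-1)) • s p3 p1
    = s p1 p0 * s p2 p1 + (q - q⁻¹) • (q⁻¹ • s p2 p0) := by
  have v0 := pr_val p0; have v1 := pr_val p1; have v2 := pr_val p2
  have h := H.re p2 p1 p1 p0
  rw [row_p2 h0 h1 h2 h3 _ (fun k hk => Y0 H _ (by have := pr_val k; omega) (Or.inl (by have := pr_val k; omega))),
    row_diag, row_gt (i := p1) (a := p0) (by omega) (by omega),
    col_gt (j := p1) (b := p0) (by omega) (by omega), col_gt (j := p2) (b := p0) (by omega) (by omega),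
    col_p2 h0 h1 h2 h3 _ (fun k hk => by rw [H.up (i := p1) (by have := pr_val k; omega), zero_mul]),
    H.up (i := p1) (j := p2) (by omega),
    H.diag, H.diag, eps_lt (i := p0) (by omega), eps_lt (i := p1) (by omega), smul_smul, inv_mul_cancel₀ q_ne] at h
  simpa only [one_smul, mul_one, one_mul, zero_mul, mul_zero, smul_zero, add_zero, sub_zero] using h

theorem E3 : q • (s p2 p0 * s p2 p1) = q⁻¹ • (s p2 p1 * s p2 p0) + (q - q⁻¹) • (-s p1 p0) - ((q - q⁻¹) * q ^ (-2 : ℤ) * 1 * (-1)) • (-s p1 p0) := by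
  have v0 := pr_val p0; have v1 := pr_val p1; have v2 := pr_val p2
  have h := H.re p2 p2 p0 p1
  rw [row_diag, row_lt (i := p0) (a := p2) (by omega) (by omega),
    col_lt (j := p0) (b := p1) (by omega) (by omega),
    col_p2 h0 h1 h2 h3 _ (fun k hk => by rw [H.up (i := p2) (by have := pr_val k; omega), zero_mul]),
    H.up (i := p0) (j := p1) (by omega), H.diag, eps_ge (i := p2) (by omega)] at h
  simpa only [neg_smul, neg_mul, one_smul, mul_one, one_mul, zero_mul, mul_zero, smul_zero, add_zero, sub_zero] using h

theorem E4 : q⁻¹ • (s p1 p0 * s p2 p0) + (q - q⁻¹) • (s p2 p0 * s p1 p0 + (q - q⁻¹) • s p2 p1)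
      - (((q - q⁻¹) * q ^ (-2 : ℤ) * 1 * (-1)) • (s p2 p0 * s p1 p0 + (q - q⁻¹) • s p2 p1) + ((q - q⁻¹) * q ^ (-3 : ℤ) * 1 * (-1)) • (q • s p3 p0))
      = q • (s p2 p0 * s p1 p0 + (q - q⁻¹) • s p2 p1) := by
  have v0 := pr_val p0; have v1 := pr_val p1; have v2 := pr_val p2
  have h := H.re p1 p2 p0 p0
  rw [row_p1 h0 h1 h2 h3 _ (fun k hk => Y0 H _ (by have := pr_val k; omega) (Or.inl (by have := pr_val k; omega))),
    row_lt (i := p0) (a := p2) (by omega) (by omega), row_lt (i := p0) (a := p1) (by omega) (by omega), row_diag,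
    col_diag, col_gt (j := p1) (b := p0) (by omega) (by omega), H.up (i := p1) (j := p2) (by omega),
    H.diag, eps_lt (i := p0) (by omega)] at h
  simpa only [one_smul, mul_one, zero_mul, mul_zero, smul_zero, add_zero] using h

theorem E5 : q⁻¹ • (s p1 p0 * s p3 p0) - ((q - q⁻¹) * q ^ (-1 : ℤ) * 1 * 1) • s p2 p0 + (q - q⁻¹) • (s p3 p0 * s p1 p0 + (q - q⁻¹) • s p3 p1)
      = q • (s p3 p0 * s p1 p0 + (q - q⁻¹) • s p3 p1) := by
  have v0 := pr_val p0; have v1 := pr_val p1; have v2 := pr_val p2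
  have h := H.re p1 p3 p0 p0
  rw [row_lt (i := p1) (a := p3) (by omega) (by omega),
    row_p0 h0 h1 h2 h3 _ (fun k hk => by rw [H.up (i := p1) hk, zero_mul]), row_lt (i := p0) (a := p1) (by omega) (by omega),
    col_diag, col_gt (j := p1) (b := p0) (by omega) (by omega),
    H.diag, H.diag, eps_lt (i := p0) (by omega), eps_lt (i := p1) (by omega)] at h
  simpa only [one_smul, mul_one, one_mul, zero_mul, mul_zero, smul_zero, add_zero] using h

end gens
end mid
end

section
section gen
variable {k : Type*} [Field k] {A : Type*} [Ring A] [Algebra k A] (q : k) (hq : q ≠ 0) (h2 : q ^ 2 ≠ 1) (h4 : q ^ 4 ≠ 1)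
include hq h2

theorem ga1 (s t X : A) (e1 : s * t + (q - q⁻¹) • X = q • (t * s))
    (e2 : s * X - q⁻¹ • (X * s) = (1 - q⁻¹ * q⁻¹) • t) :
    s * s * t - (q + q⁻¹) • (s * t * s) + t * s * s = (-(q⁻¹ * (q - q⁻¹)^2)) • t := by
  have h2' : q ^ 2 - 1 ≠ 0 := sub_ne_zero.2 h2
  have hX : X = (q / (q^2 - 1)) • (q • (t * s) - s * t) := by
    rw [← e1, add_sub_cancel_left, smul_smul]
    have : q / (q^2 - 1) * (q - q⁻¹) = 1 := by field_simp
    rw [this, one_smul]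
  rw [hX] at e2
  simp only [mul_smul_comm, smul_mul_assoc, mul_sub, sub_mul, ← mul_assoc] at e2
  linear_combination (norm := skip) (-((q^2-1)/q)) • e2
  match_scalars <;> field_simp <;> ring

theorem ga2 (s t X : A) (e1 : s * t + (q - q⁻¹) • X = q • (t * s))
    (e2 : q • (X * t) = t * X + (q - q⁻¹) • s) :
    t * t * s - (q + q⁻¹) • (t * s * t) + s * t * t = (-(q⁻¹ * (q - q⁻¹)^2)) • s := by
  have h2' : q ^ 2 - 1 ≠ 0 := sub_ne_zero.2 h2
  have hX : X = (q / (q^2 - 1)) • (q • (t * s) - s * t) := by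
    rw [← e1, add_sub_cancel_left, smul_smul]
    have : q / (q^2 - 1) * (q - q⁻¹) = 1 := by field_simp
    rw [this, one_smul]
  rw [hX] at e2
  simp only [mul_smul_comm, smul_mul_assoc, mul_sub, sub_mul, ← mul_assoc] at e2
  linear_combination (norm := skip) (-((q^2-1)/q^2)) • e2
  match_scalars <;> field_simp <;> ring

include h4
theorem gX (a b X : A) (e1 : q⁻¹ • (a * b) + (q - q⁻¹) • X - (((q - q⁻¹) * q ^ (-2 : ℤ) * 1 * (-1)) • X)
    = q • (b * a)) : X = (q ^ 3 / (q^4 - 1)) • (q • (b * a) - q⁻¹ • (a * b)) := by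
  have h4' : q ^ 4 - 1 ≠ 0 := sub_ne_zero.2 h4
  have : q ^ (-2 : ℤ) = (q^2)⁻¹ := by rw [zpow_neg]; norm_cast
  rw [← e1, this]
  match_scalars
  · field_simp; ring
  · simp

theorem ga3 (a b X : A) (e1 : q⁻¹ • (a * b) + (q - q⁻¹) • X - (((q - q⁻¹) * q ^ (-2 : ℤ) * 1 * (-1)) • X)
    = q • (b * a)) (e3 : q • (X * b) = q⁻¹ • (b * X) + (q - q⁻¹) • (-a) - ((q - q⁻¹) * q ^ (-2 : ℤ) * 1 * (-1)) • (-a)) :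
    b * b * a - (q^2 + (q^2)⁻¹) • (b * a * b) + a * b * b = ((q^2)⁻¹ * (q^2 - (q^2)⁻¹)^2) • a := by
  have h4' : q ^ 4 - 1 ≠ 0 := sub_ne_zero.2 h4
  have : q ^ (-2 : ℤ) = (q^2)⁻¹ := by rw [zpow_neg]; norm_cast
  rw [gX q hq h2 h4 a b X e1, this] at e3
  simp only [mul_smul_comm, smul_mul_assoc, mul_sub, sub_mul, ← mul_assoc] at e3
  linear_combination (norm := skip) (-((q^4-1)/q^3)) • e3
  match_scalars <;> field_simp <;> ring

theorem ga4 (a b X W S : A) (e1 : q⁻¹ • (a * b) + (q - q⁻¹) • X - (((q - q⁻¹) * q ^ (-2 : ℤ) * 1 * (-1)) • X)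
    = q • (b * a))
    (e2 : b * a - ((q - q⁻¹) * q ^ (-1 : ℤ) * (-1) * (-1)) • S = a * b + (q - q⁻¹) • (q⁻¹ • X))
    (e4 : q⁻¹ • (a * X) + (q - q⁻¹) • (X * a + (q - q⁻¹) • b)
      - (((q - q⁻¹) * q ^ (-2 : ℤ) * 1 * (-1)) • (X * a + (q - q⁻¹) • b) + ((q - q⁻¹) * q ^ (-3 : ℤ) * 1 * (-1)) • (q • W))
      = q • (X * a + (q - q⁻¹) • b))
    (e5 : q⁻¹ • (a * W) - ((q - q⁻¹) * q ^ (-1 : ℤ) * 1 * 1) • X + (q - q⁻¹) • (W * a + (q - q⁻¹) • S)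
      = q • (W * a + (q - q⁻¹) • S)) :
    a * (a * a * b - (q^2 + (q^2)⁻¹) • (a * b * a) + b * a * a + (q⁻¹ * (q^2 - (q^2)⁻¹)^2) • b)
     = (a * a * b - (q^2 + (q^2)⁻¹) • (a * b * a) + b * a * a + (q⁻¹ * (q^2 - (q^2)⁻¹)^2) • b) * a := by
  have h2' : q ^ 2 - 1 ≠ 0 := sub_ne_zero.2 h2
  have h4' : q ^ 4 - 1 ≠ 0 := sub_ne_zero.2 h4
  have z1 : q ^ (-1 : ℤ) = q⁻¹ := zpow_neg_one q
  have z2 : q ^ (-2 : ℤ) = (q^2)⁻¹ := by rw [zpow_neg]; norm_cast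
  have z3 : q ^ (-3 : ℤ) = (q^3)⁻¹ := by rw [zpow_neg]; norm_cast
  have hW : a * W - W * a = q • (b * a) - q • (a * b) := by
    rw [z1] at e2 e5
    linear_combination (norm := skip) q • e5 - q • e2
    match_scalars <;> field_simp <;> ring
  have hW2 : W = (q^3 / (q^2 - 1)) • ((q⁻¹^3) • (X * a) + (q⁻¹^3*(q - q⁻¹)) • b - (q⁻¹^2) • (q • (a * X))) := by
    rw [z2, z3] at e4
    linear_combination (norm := skip) (q^3/(q^2 - 1)) • e4
    match_scalars <;> field_simp <;> ring
  rw [hW2, gX q hq h2 h4 a b X e1] at hW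
  simp only [mul_smul_comm, smul_mul_assoc, mul_sub, sub_mul, mul_add, add_mul, ← mul_assoc] at hW ⊢
  linear_combination (norm := skip) ((q^2-1)*(q^4-1)/q^4) • hW
  match_scalars <;> field_simp <;> ring
end gen
end

section
theorem qpow_ne (m : ℕ) (hm : m ≠ 0) : q ^ m ≠ 1 := by
  intro h1
  have h2 : (RatFunc.X : RatFunc ℂ) ^ m = 1 := h1
  have h3 : (algebraMap (Polynomial ℂ) (RatFunc ℂ)) (Polynomial.X ^ m) = algebraMap _ _ (1 : Polynomial ℂ) := by
    rw [map_pow, RatFunc.algebraMap_X, map_one]; exact h2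
  have h4 := congrArg Polynomial.natDegree (RatFunc.algebraMap_injective ℂ h3)
  simp at h4
  exact hm h4

theorem qd_ne : q - q⁻¹ ≠ 0 := by
  intro h
  have h1 := qpow_ne 2 (by norm_num)
  have := q_ne
  apply h1
  field_simp at h
  linear_combination h

section genr
variable {n : ℕ} {A : Type*} [Ring A] [Algebra F A] {s : Fin (2*n) → Fin (2*n) → A}

theorem mem_add {S : Subalgebra F A} {u t w : A} {c : F} (hc : c ≠ 0) (hu : u ∈ S) (hw : w ∈ S) (h : u + c • t = w) : t ∈ S := by
  have : c • t ∈ S := by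
    have : c • t = w - u := by rw [← h, add_sub_cancel_left]
    rw [this]; exact S.sub_mem hw hu
  have h2 := S.smul_mem this c⁻¹
  rwa [smul_smul, inv_mul_cancel₀ hc, one_smul] at h2

theorem eps_ne (i : Fin (2*n)) : eps n i ≠ 0 := by
  rw [eps]; split_ifs <;> simp

theorem gen_all (H : SRel n s) (hn : 2 ≤ n) (S : Subalgebra F A)
    (hS : ∀ i j : Fin (2*n), (i : ℕ) = j + 1 → (i : ℕ) ≤ n → s i j ∈ S) (i j : Fin (2*n)) : s i j ∈ S := by
  have hd := qd_ne
  have hq := q_ne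
  induction' hdd : (i : ℕ) - j using Nat.strong_induction_on with d ih generalizing i j
  rcases lt_trichotomy i j with h | h | h
  · rw [H.up h]; exact S.zero_mem
  · subst h; rw [H.diag]; exact S.smul_mem S.one_mem _
  by_cases h1 : (i : ℕ) = j + 1
  · by_cases h2 : (i : ℕ) ≤ n
    · exact hS i j h1 h2
    · have hi := pr_val i; have hj := pr_val j
      have := symD H (pr n i) (pr n j) (by omega) (by omega)
      rw [pr_pr, pr_pr] at this
      rw [this]
      exact hS _ _ (by omega) (by omega)
  have ih' : ∀ a b : Fin (2*n), (a : ℕ) - b < i - j → s a b ∈ S := fun a b hab => ih _ (by omega) a b rfl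
  by_cases h2 : (i : ℕ) + j = 2 * n - 1
  · have hp := excC H j ⟨i - 1, by omega⟩ i ⟨j + 1, by omega⟩ (by omega) (by have := pr_val j; omega) (by simp; omega) rfl
    rw [sub_eq_add_neg, ← neg_smul] at hp
    refine mem_add (neg_ne_zero.2 hd) ?_ ?_ hp
    · refine S.add_mem (S.smul_mem (S.mul_mem ?_ ?_) _) (S.smul_mem ?_ _)
      all_goals exact ih' _ _ (by simp only; omega)
    · exact S.smul_mem (S.mul_mem (ih' _ _ (by simp only; omega)) (ih' _ _ (by simp only; omega))) _
  by_cases h3 : (i : ℕ) = n ∧ (j : ℕ) + 2 = n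
  · have e := E1 H (p0 := j) (p1 := ⟨j+1, by omega⟩) (p2 := i) (p3 := ⟨i+1, by omega⟩) (by omega) (by simp only; omega) (by omega) (by simp only; omega)
    have e' := gX q hq (qpow_ne 2 (by norm_num)) (qpow_ne 4 (by norm_num)) _ _ _ e
    rw [e']
    refine S.smul_mem (S.sub_mem (S.smul_mem (S.mul_mem ?_ ?_) _) (S.smul_mem (S.mul_mem ?_ ?_) _)) _
    all_goals exact ih' _ _ (by simp only; omega)
  by_cases h4 : (i : ℕ) = n + 1 ∧ (j : ℕ) + 1 = n
  · have e := E2 H (p0 := ⟨j-1, by omega⟩) (p1 := j) (p2 := ⟨n, by omega⟩) (p3 := i) (by simp only; omega) (by omega) rfl (by omega)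
    have e1 := E1 H (p0 := ⟨j-1, by omega⟩) (p1 := j) (p2 := ⟨n, by omega⟩) (p3 := i) (by simp only; omega) (by omega) rfl (by omega)
    have e' := gX q hq (qpow_ne 2 (by norm_num)) (qpow_ne 4 (by norm_num)) _ _ _ e1
    have hb : s ⟨n, by omega⟩ j ∈ S := hS _ _ (by simp only; omega) (by simp only; omega)
    have ha : s j ⟨j-1, by omega⟩ ∈ S := hS _ _ (by first | omega | (simp only; omega)) (by first | omega | (simp only; omega))
    rw [sub_eq_add_neg, ← neg_smul] at e
    refine mem_add (neg_ne_zero.2 (by simp [hd, hq])) (S.mul_mem hb ha) ?_ e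
    refine S.add_mem (S.mul_mem ha hb) (S.smul_mem (S.smul_mem ?_ _) _)
    rw [e']
    exact S.smul_mem (S.sub_mem (S.smul_mem (S.mul_mem hb ha) _) (S.smul_mem (S.mul_mem ha hb) _)) _
  by_cases h5 : (i : ℕ) = n ∨ (i : ℕ) + j = 2 * n
  · have hj := pr_val j
    have hp := peelR H j ⟨j + 1, by omega⟩ i rfl (by rw [Fin.lt_def]; simp only; omega)
      (by rw [Ne, Fin.ext_iff, pr_val]; simp only; omega) (by omega) (by rw [Ne, Fin.ext_iff, pr_val]; simp only; omega)
    refine mem_add (mul_ne_zero hd (eps_ne _)) (S.mul_mem ?_ ?_) (S.smul_mem (S.mul_mem ?_ ?_) _) hp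
    all_goals exact ih' _ _ (by simp only; omega)
  · have hj := pr_val j
    have hp := peelL H j ⟨i - 1, by omega⟩ i (by simp only; omega) (by rw [Fin.lt_def]; simp only; omega)
      (by rw [Ne, Fin.ext_iff, pr_val]; simp only; omega) (by rw [Ne, Fin.ext_iff, pr_val]; simp only; omega) (by omega)
    refine mem_add (mul_ne_zero hd (eps_ne _)) (S.mul_mem ?_ ?_) (S.smul_mem (S.mul_mem ?_ ?_) _) hp
    all_goals exact ih' _ _ (by simp only; omega)

end genr
end

section
theorem mkAut {𝕜 A E : Type*} [Field 𝕜] [Ring A] [Algebra 𝕜 A] [Ring E] (ρ : A →+* E) (hρ : Function.Injective ρ) (G G' : E)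
    (hG : G * G' = 1) (hG' : G' * G = 1) (hc : ∀ c : 𝕜, ρ (algebraMap 𝕜 A c) * G = G * ρ (algebraMap 𝕜 A c))
    (S : Set A) (hS : Algebra.adjoin 𝕜 S = ⊤)
    (h1 : ∀ a ∈ S, ∃ a', ρ a' * G = G * ρ a) (h2 : ∀ a ∈ S, ∃ a', ρ a * G = G * ρ a') :
    ∃ γ : A ≃ₐ[𝕜] A, ∀ a, ρ (γ a) * G = G * ρ a := by
  have hl : ∀ x y : E, x * G = y * G → x = y := fun x y h => by
    have := congrArg (· * G') h
    simpa [mul_assoc, hG] using this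
  have hr : ∀ x y : E, G * x = G * y → x = y := fun x y h => by
    have := congrArg (G' * ·) h
    simpa [← mul_assoc, hG'] using this
  have k1 : ∀ a, ∃ a', ρ a' * G = G * ρ a := by
    intro a
    have ha : a ∈ Algebra.adjoin 𝕜 S := by rw [hS]; trivial
    induction ha using Algebra.adjoin_induction with
    | mem x hx => exact h1 x hx
    | algebraMap c => exact ⟨_, hc c⟩
    | add x y _ _ hx hy =>
      obtain ⟨x', hx⟩ := hx; obtain ⟨y', hy⟩ := hy
      exact ⟨x' + y', by rw [map_add, map_add, add_mul, mul_add, hx, hy]⟩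
    | mul x y _ _ hx hy =>
      obtain ⟨x', hx⟩ := hx; obtain ⟨y', hy⟩ := hy
      exact ⟨x' * y', by rw [map_mul, map_mul, mul_assoc, hy, ← mul_assoc, hx, mul_assoc]⟩
  have k2 : ∀ a, ∃ a', ρ a * G = G * ρ a' := by
    intro a
    have ha : a ∈ Algebra.adjoin 𝕜 S := by rw [hS]; trivial
    induction ha using Algebra.adjoin_induction with
    | mem x hx => exact h2 x hx
    | algebraMap c => exact ⟨_, hc c⟩
    | add x y _ _ hx hy =>
      obtain ⟨x', hx⟩ := hx; obtain ⟨y', hy⟩ := hy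
      exact ⟨x' + y', by rw [map_add, map_add, add_mul, mul_add, hx, hy]⟩
    | mul x y _ _ hx hy =>
      obtain ⟨x', hx⟩ := hx; obtain ⟨y', hy⟩ := hy
      exact ⟨x' * y', by rw [map_mul, map_mul, mul_assoc, hy, ← mul_assoc, hx, mul_assoc]⟩
  choose f hf using k1
  choose g hg using k2
  have hu : ∀ x y, ρ x * G = ρ y * G → x = y := fun x y h => hρ (hl _ _ h)
  have hu' : ∀ x y, G * ρ x = G * ρ y → x = y := fun x y h => hρ (hr _ _ h)
  let φ : A →ₐ[𝕜] A :=
    { toFun := f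
      map_one' := hu _ _ (by rw [hf, map_one, mul_one, one_mul])
      map_mul' := fun x y => hu _ _ (by rw [hf, map_mul, map_mul, mul_assoc (ρ (f x)), hf, ← mul_assoc, ← mul_assoc, hf])
      map_zero' := hu _ _ (by rw [hf, map_zero, mul_zero, zero_mul])
      map_add' := fun x y => hu _ _ (by rw [hf, map_add, map_add, add_mul, hf, hf, mul_add])
      commutes' := fun c => hu _ _ (by rw [hf, hc]) }
  have hb : Function.Bijective φ := by
    constructor
    · intro x y hxy
      have hxy' : f x = f y := hxy
      exact hu' _ _ (by rw [← hf, ← hf, hxy'])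
    · intro y
      exact ⟨g y, hu _ _ ((hf _).trans (hg y).symm)⟩
  exact ⟨AlgEquiv.ofBijective φ hb, fun a => hf a⟩

theorem exists_g {K : Type*} [Field K] (Q c : K) (hQ : Q ≠ 0) (hc : c ≠ 0) :
    ∃ g : ℤ → K, (∀ j, g j ≠ 0) ∧ ∀ j, g (j + 1) = g j * (c * Q ^ (-j)) := by
  refine ⟨fun j => c ^ j * Q ^ (-(j * (j - 1) / 2)), fun j => mul_ne_zero (zpow_ne_zero _ hc) (zpow_ne_zero _ hQ), fun j => ?_⟩
  have h : -((j + 1) * (j + 1 - 1) / 2) = -(j * (j - 1) / 2) + -j := by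
    have : (j + 1) * (j + 1 - 1) = j * (j - 1) + j * 2 := by ring
    rw [this, Int.add_mul_ediv_right _ _ (by norm_num)]; ring
  simp only
  rw [h, zpow_add₀ hQ, zpow_add_one₀ hc]; ring

/-- diagonal operators -/
theorem exists_G {K V : Type*} [Field K] [AddCommGroup V] [Module K V] (b : Module.End K V) (e : ℤ → K) (he : Function.Injective e)
    (ht : ⨆ j, b.eigenspace (e j) = ⊤) (g : ℤ → K) : ∃ G : Module.End K V, ∀ j, ∀ v ∈ b.eigenspace (e j), G v = g j • v := by
  classical
  have hi : DirectSum.IsInternal (fun j => b.eigenspace (e j)) :=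
    (DirectSum.isInternal_submodule_iff_iSupIndep_and_iSup_eq_top _).2 ⟨(Module.End.eigenspaces_iSupIndep b).comp he, ht⟩
  let E := LinearEquiv.ofBijective (DirectSum.coeLinearMap (fun j => b.eigenspace (e j))) hi
  refine ⟨(DirectSum.toModule K ℤ V fun j => g j • (b.eigenspace (e j)).subtype) ∘ₗ E.symm.toLinearMap, fun j v hv => ?_⟩
  have : E.symm v = DirectSum.lof K ℤ (fun j => b.eigenspace (e j)) j ⟨v, hv⟩ := by
    rw [LinearEquiv.symm_apply_eq]
    exact (DirectSum.coeLinearMap_lof (fun j => b.eigenspace (e j)) j ⟨v, hv⟩).symm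
  simp only [LinearMap.comp_apply, LinearEquiv.coe_coe, this, DirectSum.toModule_lof]
  simp

theorem top_ext {K V : Type*} [Field K] [AddCommGroup V] [Module K V] (b : Module.End K V) (e : ℤ → K)
    (ht : ⨆ j, b.eigenspace (e j) = ⊤) (f g : Module.End K V) (h : ∀ j, ∀ v ∈ b.eigenspace (e j), f v = g v) : f = g := by
  ext v
  have hv : v ∈ ⨆ j, b.eigenspace (e j) := by rw [ht]; trivial
  induction hv using Submodule.iSup_induction' with
  | mem j x hx => exact h j x hx
  | zero => simp
  | add x y _ _ hx hy => rw [map_add, map_add, hx, hy]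
end

section
section gauss
variable {K V : Type*} [Field K] [AddCommGroup V] [Module K V]

theorem eig2 (b : Module.End K V) (x y : K) (hxy : x ≠ y) (w : V) (h : b (b w) = (x + y) • b w - (x * y) • w) :
    ∃ u1 ∈ b.eigenspace x, ∃ u2 ∈ b.eigenspace y, w = u1 + u2 := by
  have h1 : x - y ≠ 0 := sub_ne_zero.2 hxy
  refine ⟨(x - y)⁻¹ • (b w - y • w), ?_, (-(x - y)⁻¹) • (b w - x • w), ?_, ?_⟩
  · rw [Module.End.mem_eigenspace_iff]
    simp only [map_smul, map_sub, h]
    module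
  · rw [Module.End.mem_eigenspace_iff]
    simp only [map_smul, map_sub, h]
    module
  · match_scalars <;> field_simp <;> ring

theorem eig3 (b : Module.End K V) (x y z : K) (hxy : x ≠ y) (hxz : z ≠ x) (hyz : z ≠ y) (w : V)
    (h : b (b (b w) - (x + y) • b w + (x * y) • w) = z • (b (b w) - (x + y) • b w + (x * y) • w)) :
    ∃ u1 ∈ b.eigenspace x, ∃ u2 ∈ b.eigenspace y, ∃ u3 ∈ b.eigenspace z, w = u1 + u2 + u3 := by
  have h1 : z - x ≠ 0 := sub_ne_zero.2 hxz
  have h2 : z - y ≠ 0 := sub_ne_zero.2 hyz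
  set w' := b (b w) - (x + y) • b w + (x * y) • w with hw
  obtain ⟨u1, hu1, u2, hu2, e⟩ := eig2 b x y hxy (w - ((z - x) * (z - y))⁻¹ • w') (by
    have hb : b (b w) = w' + (x + y) • b w - (x * y) • w := by rw [hw]; abel
    simp only [map_sub, map_smul, h, hb]
    match_scalars <;> field_simp <;> ring)
  refine ⟨u1, hu1, u2, hu2, ((z - x) * (z - y))⁻¹ • w', ?_, ?_⟩
  · rw [Module.End.mem_eigenspace_iff, map_smul, h, smul_comm]
  · rw [← e, sub_add_cancel]

variable (Q μ lam z : K)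

/-- the spectrum -/
def ev (j : ℤ) : K := lam * (Q ^ j * z - (Q ^ j * z)⁻¹)

theorem ev_inj (hQ : Q ≠ 0) (hlam : lam ≠ 0) (hz : z ≠ 0) (hQm : ∀ m : ℤ, Q ^ m = 1 → m = 0) (hz2 : ∀ m : ℤ, z ^ 2 ≠ - Q ^ m) :
    Function.Injective (ev Q lam z) := by
  intro i j h
  have hi : Q ^ i ≠ 0 := zpow_ne_zero _ hQ
  have hj : Q ^ j ≠ 0 := zpow_ne_zero _ hQ
  have h1 := mul_left_cancel₀ hlam h
  have h2 : (Q ^ i - Q ^ j) * (Q ^ i * Q ^ j * z ^ 2 + 1) = 0 := by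
    field_simp at h1
    linear_combination h1
  rcases mul_eq_zero.1 h2 with h3 | h3
  · have h4 : Q ^ (i - j) = 1 := by
      rw [zpow_sub₀ hQ, sub_eq_zero.1 h3, div_self hj]
    have := hQm _ h4; omega
  · exfalso
    apply hz2 (-(i + j))
    rw [zpow_neg, zpow_add₀ hQ]
    field_simp
    linear_combination h3

variable (b : Module.End K V) (hQ : Q ≠ 0) (hQQ : Q ^ 2 ≠ 1) (hQ4 : Q ^ 4 ≠ 1) (hz : z ≠ 0) (hl : lam ^ 2 * μ ^ 2 * Q = -1) (he : Function.Injective (ev Q lam z))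
include hQ hQQ hQ4 hz hl he

/-- relation of type one -/
def T1 {R A : Type*} [Field R] [Ring A] [Algebra R A] (Q μ : R) (b t : A) : Prop :=
  b * b * t - (Q + Q⁻¹) • (b * t * b) + t * b * b = (-((μ ^ 2 * Q)⁻¹ * (Q - Q⁻¹) ^ 2)) • t

/-- the cubic expression -/
def Y2 {R A : Type*} [Field R] [Ring A] [Algebra R A] (Q μ : R) (b t : A) : A :=
  b * b * t - (Q ^ 2 + (Q ^ 2)⁻¹) • (b * t * b) + t * b * b + ((μ ^ 2 * Q)⁻¹ * (Q ^ 2 - (Q ^ 2)⁻¹) ^ 2) • t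

theorem dec1 (t : Module.End K V) (ht : T1 Q μ b t) (j : ℤ) (v : V) (hv : v ∈ b.eigenspace (ev Q lam z j)) :
    ∃ u1 ∈ b.eigenspace (ev Q lam z (j + 1)), ∃ u2 ∈ b.eigenspace (ev Q lam z (j - 1)), t v = u1 + u2 := by
  apply eig2 b _ _ (fun h => by have := he h; omega)
  rw [Module.End.mem_eigenspace_iff] at hv
  have h := LinearMap.congr_fun ht v
  simp only [LinearMap.add_apply, LinearMap.sub_apply, LinearMap.smul_apply, Module.End.mul_apply, hv, map_smul] at h
  have hw : Q ^ j * z ≠ 0 := mul_ne_zero (zpow_ne_zero _ hQ) hz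
  have hlam : lam ≠ 0 := fun h => by rw [h] at hl; simp at hl
  have hμ : μ ≠ 0 := fun h => by rw [h] at hl; simp at hl
  have e0 : ev Q lam z j = lam * (Q ^ j * z - (Q ^ j * z)⁻¹) := rfl
  have e1 : ev Q lam z (j + 1) = lam * (Q * (Q ^ j * z) - Q⁻¹ * (Q ^ j * z)⁻¹) := by
    rw [ev, zpow_add_one₀ hQ]; field_simp
  have e2 : ev Q lam z (j - 1) = lam * (Q⁻¹ * (Q ^ j * z) - Q * (Q ^ j * z)⁻¹) := by
    rw [ev, zpow_sub_one₀ hQ]; field_simp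
  have hli : (μ ^ 2 * Q)⁻¹ = - lam ^ 2 := by field_simp; linear_combination hl
  rw [hli] at h
  rw [e1, e2]
  rw [e0] at h
  generalize Q ^ j * z = w at *
  linear_combination (norm := skip) h
  match_scalars <;> field_simp <;> ring

theorem dec2 (t : Module.End K V) (ht : b * Y2 Q μ b t = Y2 Q μ b t * b) (j : ℤ) (v : V) (hv : v ∈ b.eigenspace (ev Q lam z j)) :
    ∃ u1 ∈ b.eigenspace (ev Q lam z (j + 2)), ∃ u2 ∈ b.eigenspace (ev Q lam z (j - 2)), ∃ u3 ∈ b.eigenspace (ev Q lam z j), t v = u1 + u2 + u3 := by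
  apply eig3 b _ _ _ (fun h => by have := he h; omega) (fun h => by have := he h; omega) (fun h => by have := he h; omega)
  rw [Module.End.mem_eigenspace_iff] at hv
  have hw : Q ^ j * z ≠ 0 := mul_ne_zero (zpow_ne_zero _ hQ) hz
  have hlam : lam ≠ 0 := fun h => by rw [h] at hl; simp at hl
  have hμ : μ ≠ 0 := fun h => by rw [h] at hl; simp at hl
  have e0 : ev Q lam z j = lam * (Q ^ j * z - (Q ^ j * z)⁻¹) := rfl
  have e1 : ev Q lam z (j + 2) = lam * (Q ^ 2 * (Q ^ j * z) - (Q ^ 2)⁻¹ * (Q ^ j * z)⁻¹) := by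
    rw [ev, zpow_add₀ hQ]; norm_cast; field_simp
  have e2 : ev Q lam z (j - 2) = lam * ((Q ^ 2)⁻¹ * (Q ^ j * z) - Q ^ 2 * (Q ^ j * z)⁻¹) := by
    rw [ev, zpow_sub₀ hQ]; norm_cast; field_simp
  have hli : (μ ^ 2 * Q)⁻¹ = - lam ^ 2 := by field_simp; linear_combination hl
  have h0 : Y2 Q μ b t v = b (b (t v)) - (ev Q lam z (j + 2) + ev Q lam z (j - 2)) • b (t v) + (ev Q lam z (j + 2) * ev Q lam z (j - 2)) • t v := by
    simp only [Y2, LinearMap.add_apply, LinearMap.sub_apply, LinearMap.smul_apply, Module.End.mul_apply, hv, map_smul]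
    rw [hli, e1, e2, e0]
    generalize Q ^ j * z = w at *
    match_scalars <;> field_simp <;> ring
  have h := LinearMap.congr_fun ht v
  simp only [Module.End.mul_apply, hv, map_smul] at h
  rw [← h0, h]

variable (ht : ⨆ j, b.eigenspace (ev Q lam z j) = ⊤) (g : ℤ → K) (hg : ∀ j, g (j + 1) = g j * (μ * lam * z⁻¹ * Q ^ (-j)))
  (G : Module.End K V) (hG : ∀ j, ∀ v ∈ b.eigenspace (ev Q lam z j), G v = g j • v)

omit hQQ hQ4 he in
include hg in
theorem g_facts (j : ℤ) : g (j + 1) = g j * (μ * lam * (Q ^ j * z)⁻¹) ∧ g (j - 1) = g j * (-(μ * lam * (Q ^ j * z))) := by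
  have hj : Q ^ j ≠ 0 := zpow_ne_zero _ hQ
  constructor
  · rw [hg, zpow_neg]; field_simp
  · have h := hg (j - 1)
    rw [sub_add_cancel, neg_sub, zpow_sub₀ hQ, zpow_one] at h
    rw [h]; field_simp
    linear_combination (g (j-1)) * hl

include ht hg hG

theorem fwd1 (t : Module.End K V) (ht1 : T1 Q μ b t) :
    ((μ * (Q - Q⁻¹)⁻¹) • (b * t - Q • (t * b))) * G = G * t := by
  apply top_ext b _ ht
  intro j v hv
  obtain ⟨u1, hu1, u2, hu2, e⟩ := dec1 Q μ lam z b hQ hQQ hQ4 hz hl he t ht1 j v hv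
  obtain ⟨g1, g2⟩ := g_facts Q μ lam z hQ hz hl g hg j
  have k1 := hG _ _ hu1
  have k2 := hG _ _ hu2
  have k0 := hG _ _ hv
  rw [Module.End.mem_eigenspace_iff] at hv hu1 hu2
  simp only [LinearMap.add_apply, LinearMap.sub_apply, LinearMap.smul_apply, Module.End.mul_apply, map_smul, map_add, k0, hv, e, k1, k2, hu1, hu2]
  have hQ2 : Q ^ 2 - 1 ≠ 0 := sub_ne_zero.2 hQQ
  have hw : Q ^ j * z ≠ 0 := mul_ne_zero (zpow_ne_zero _ hQ) hz
  have e0 : ev Q lam z j = lam * (Q ^ j * z - (Q ^ j * z)⁻¹) := rfl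
  have e1 : ev Q lam z (j + 1) = lam * (Q * (Q ^ j * z) - Q⁻¹ * (Q ^ j * z)⁻¹) := by
    rw [ev, zpow_add_one₀ hQ]; field_simp
  have e2 : ev Q lam z (j - 1) = lam * (Q⁻¹ * (Q ^ j * z) - Q * (Q ^ j * z)⁻¹) := by
    rw [ev, zpow_sub_one₀ hQ]; field_simp
  rw [g1, g2, e0, e1, e2]
  generalize Q ^ j * z = w at *
  match_scalars <;> field_simp <;> ring

theorem bwd1 (t : Module.End K V) (ht1 : T1 Q μ b t) :
    t * G = G * ((-(μ * Q * (Q - Q⁻¹)⁻¹)) • (b * t - Q⁻¹ • (t * b))) := by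
  apply top_ext b _ ht
  intro j v hv
  obtain ⟨u1, hu1, u2, hu2, e⟩ := dec1 Q μ lam z b hQ hQQ hQ4 hz hl he t ht1 j v hv
  obtain ⟨g1, g2⟩ := g_facts Q μ lam z hQ hz hl g hg j
  have k1 := hG _ _ hu1
  have k2 := hG _ _ hu2
  have k0 := hG _ _ hv
  rw [Module.End.mem_eigenspace_iff] at hv hu1 hu2
  simp only [LinearMap.add_apply, LinearMap.sub_apply, LinearMap.smul_apply, Module.End.mul_apply, map_smul, map_add, map_sub, k0, hv, e, k1, k2, hu1, hu2]
  have hQ2 : Q ^ 2 - 1 ≠ 0 := sub_ne_zero.2 hQQ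
  have hw : Q ^ j * z ≠ 0 := mul_ne_zero (zpow_ne_zero _ hQ) hz
  have e0 : ev Q lam z j = lam * (Q ^ j * z - (Q ^ j * z)⁻¹) := rfl
  have e1 : ev Q lam z (j + 1) = lam * (Q * (Q ^ j * z) - Q⁻¹ * (Q ^ j * z)⁻¹) := by
    rw [ev, zpow_add_one₀ hQ]; field_simp
  have e2 : ev Q lam z (j - 1) = lam * (Q⁻¹ * (Q ^ j * z) - Q * (Q ^ j * z)⁻¹) := by
    rw [ev, zpow_sub_one₀ hQ]; field_simp
  rw [g1, g2, e0, e1, e2]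
  generalize Q ^ j * z = w at *
  match_scalars
  · field_simp; linear_combination (g j * w^2 * (Q^2-1)) * hl
  · field_simp; linear_combination (g j * (Q^2-1)) * hl

theorem fwd2 (t : Module.End K V) (ht1 : b * Y2 Q μ b t = Y2 Q μ b t * b) :
    (t + (μ ^ 2 * (Q + Q⁻¹)⁻¹ * ((Q - Q⁻¹) ^ 2)⁻¹) • (b * b * t - (1 + Q ^ 2) • (b * t * b) + Q ^ 2 • (t * b * b))) * G = G * t := by
  apply top_ext b _ ht
  intro j v hv
  obtain ⟨u1, hu1, u2, hu2, u3, hu3, e⟩ := dec2 Q μ lam z b hQ hQQ hQ4 hz hl he t ht1 j v hv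
  obtain ⟨g1, g2⟩ := g_facts Q μ lam z hQ hz hl g hg j
  obtain ⟨g3, -⟩ := g_facts Q μ lam z hQ hz hl g hg (j+1)
  obtain ⟨-, g4⟩ := g_facts Q μ lam z hQ hz hl g hg (j-1)
  rw [add_assoc] at g3
  rw [sub_sub] at g4
  norm_num at g3 g4
  have k1 := hG _ _ hu1
  have k2 := hG _ _ hu2
  have k3 := hG _ _ hu3
  have k0 := hG _ _ hv
  rw [Module.End.mem_eigenspace_iff] at hv hu1 hu2 hu3
  simp only [LinearMap.add_apply, LinearMap.sub_apply, LinearMap.smul_apply, Module.End.mul_apply, map_smul, map_add, k0, hv, e, k1, k2, k3, hu1, hu2, hu3]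
  have hQ2 : Q ^ 2 - 1 ≠ 0 := sub_ne_zero.2 hQQ
  have hQ2' : Q ^ 2 + 1 ≠ 0 := fun h => hQ4 (by linear_combination (Q^2 - 1) * h)
  have hw : Q ^ j * z ≠ 0 := mul_ne_zero (zpow_ne_zero _ hQ) hz
  have e0 : ev Q lam z j = lam * (Q ^ j * z - (Q ^ j * z)⁻¹) := rfl
  have e1 : ev Q lam z (j + 2) = lam * (Q ^ 2 * (Q ^ j * z) - (Q ^ 2)⁻¹ * (Q ^ j * z)⁻¹) := by
    rw [ev, zpow_add₀ hQ]; norm_cast; field_simp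
  have e2 : ev Q lam z (j - 2) = lam * ((Q ^ 2)⁻¹ * (Q ^ j * z) - Q ^ 2 * (Q ^ j * z)⁻¹) := by
    rw [ev, zpow_sub₀ hQ]; norm_cast; field_simp
  have f1 : Q ^ (j + 1) * z = Q * (Q ^ j * z) := by rw [zpow_add_one₀ hQ]; ring
  have f2 : Q ^ (j - 1) * z = Q⁻¹ * (Q ^ j * z) := by rw [zpow_sub_one₀ hQ]; ring
  have f1' : (z⁻¹ * (Q ^ (j + 1))⁻¹) = Q⁻¹ * (Q ^ j * z)⁻¹ := by rw [← mul_inv, mul_comm, f1, mul_inv]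
  rw [g3, g4, g1, g2, e0, e1, e2]
  simp only [f1, f2, f1']
  clear g1 g2 g3 g4 e0 e1 e2 f1 f2 f1'
  generalize Q ^ j * z = w at *
  match_scalars
  · field_simp; linear_combination (g j * Q * (Q^2+1) * (Q^2-1)^2 * w^2) * hl
  · field_simp; linear_combination (g j * Q * (Q^2+1) * (Q^2-1)^2 * w^2) * hl
  · field_simp; ring

theorem bwd2 (t : Module.End K V) (ht1 : b * Y2 Q μ b t = Y2 Q μ b t * b) :
    t * G = G * (t + (μ ^ 2 * Q ^ 2 * (Q + Q⁻¹)⁻¹ * ((Q - Q⁻¹) ^ 2)⁻¹) • (b * b * t - (1 + (Q ^ 2)⁻¹) • (b * t * b) + (Q ^ 2)⁻¹ • (t * b * b))) := by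
  apply top_ext b _ ht
  intro j v hv
  obtain ⟨u1, hu1, u2, hu2, u3, hu3, e⟩ := dec2 Q μ lam z b hQ hQQ hQ4 hz hl he t ht1 j v hv
  obtain ⟨g1, g2⟩ := g_facts Q μ lam z hQ hz hl g hg j
  obtain ⟨g3, -⟩ := g_facts Q μ lam z hQ hz hl g hg (j+1)
  obtain ⟨-, g4⟩ := g_facts Q μ lam z hQ hz hl g hg (j-1)
  rw [add_assoc] at g3
  rw [sub_sub] at g4
  norm_num at g3 g4
  have k1 := hG _ _ hu1
  have k2 := hG _ _ hu2
  have k3 := hG _ _ hu3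
  have k0 := hG _ _ hv
  rw [Module.End.mem_eigenspace_iff] at hv hu1 hu2 hu3
  simp only [LinearMap.add_apply, LinearMap.sub_apply, LinearMap.smul_apply, Module.End.mul_apply, map_smul, map_add, map_sub, k0, hv, e, k1, k2, k3, hu1, hu2, hu3]
  have hQ2 : Q ^ 2 - 1 ≠ 0 := sub_ne_zero.2 hQQ
  have hQ2' : Q ^ 2 + 1 ≠ 0 := fun h => hQ4 (by linear_combination (Q^2 - 1) * h)
  have hw : Q ^ j * z ≠ 0 := mul_ne_zero (zpow_ne_zero _ hQ) hz
  have e0 : ev Q lam z j = lam * (Q ^ j * z - (Q ^ j * z)⁻¹) := rfl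
  have e1 : ev Q lam z (j + 2) = lam * (Q ^ 2 * (Q ^ j * z) - (Q ^ 2)⁻¹ * (Q ^ j * z)⁻¹) := by
    rw [ev, zpow_add₀ hQ]; norm_cast; field_simp
  have e2 : ev Q lam z (j - 2) = lam * ((Q ^ 2)⁻¹ * (Q ^ j * z) - Q ^ 2 * (Q ^ j * z)⁻¹) := by
    rw [ev, zpow_sub₀ hQ]; norm_cast; field_simp
  have f1 : Q ^ (j + 1) * z = Q * (Q ^ j * z) := by rw [zpow_add_one₀ hQ]; ring
  have f2 : Q ^ (j - 1) * z = Q⁻¹ * (Q ^ j * z) := by rw [zpow_sub_one₀ hQ]; ring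
  have f1' : (z⁻¹ * (Q ^ (j + 1))⁻¹) = Q⁻¹ * (Q ^ j * z)⁻¹ := by rw [← mul_inv, mul_comm, f1, mul_inv]
  rw [g3, g4, g1, g2, e0, e1, e2]
  simp only [f1, f2, f1']
  clear g1 g2 g3 g4 e0 e1 e2 f1 f2 f1'
  generalize Q ^ j * z = w at *
  match_scalars
  · field_simp; linear_combination (g j * ((Q^2+1)*(Q^2-1)^2) * w^2 * (-(lam^2*μ^2) + w^2*Q*(1-(lam^2*μ^2)*Q))) * hl
  · field_simp; linear_combination (g j * ((Q^2+1)*(Q^2-1)^2) * (-(lam^2*μ^2)*w^2 + Q*(1-(lam^2*μ^2)*Q))) * hl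
  · field_simp; ring

end gauss
end

section
open TensorProduct Polynomial

theorem exists_rep {𝕜 A : Type} [Field 𝕜] [Ring A] [Algebra 𝕜 A] (B : A)
    (hreg : ∀ (x : A) (p : 𝕜[X]), p ≠ 0 → x * aeval B p = 0 → x = 0) :
    ∃ (K : Type) (_ : Field K) (_ : Algebra 𝕜 K) (_ : IsAlgClosed K) (V : Type) (_ : AddCommGroup V) (_ : Module K V)
      (ρ : A →+* Module.End K V) (x : K) (v0 : V), Function.Injective ρ ∧ Transcendental 𝕜 x ∧
      (∀ c, ρ (algebraMap 𝕜 A c) = algebraMap K _ (algebraMap 𝕜 K c)) ∧ ρ B v0 = x • v0 ∧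
      Submodule.span K (Set.range fun a => ρ a v0) = ⊤ := by
  let M := Module.AEval' (LinearMap.mulRight 𝕜 B)
  let o : A ≃ₗ[𝕜] M := Module.AEval'.of _
  have haev : ∀ (p : 𝕜[X]) (u : A), aeval (LinearMap.mulRight 𝕜 B) p u = u * aeval B p := by
    intro p
    induction p using Polynomial.induction_on with
    | C a => intro u; simp [Algebra.algebraMap_eq_smul_one]
    | add p r hp hr => intro u; simp [hp, hr, mul_add]
    | monomial m a h =>
      intro u
      have := h (u * B)
      simp [pow_succ', LinearMap.mulRight_apply] at this ⊢
      rw [mul_assoc, ← pow_succ, pow_succ', ← mul_assoc, this, Algebra.left_comm, Algebra.left_comm, mul_assoc]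
  have hsm : ∀ (p : 𝕜[X]) (u : A), p • o u = o (u * aeval B p) := by
    intro p u
    rw [← haev]
    exact (Module.AEval.of_aeval_smul (R := 𝕜) (a := LinearMap.mulRight 𝕜 B) p u).symm
  have htf : Module.IsTorsionFree 𝕜[X] M := by
    constructor
    intro r hr
    have hr0 : r ≠ 0 := hr.ne_zero
    intro m m' hm
    obtain ⟨a, rfl⟩ := o.surjective m
    obtain ⟨a', rfl⟩ := o.surjective m'
    simp only [hsm] at hm
    have h1 := o.injective hm
    have h2 : a - a' = 0 := hreg _ r hr0 (by rw [sub_mul, h1, sub_self])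
    rw [sub_eq_zero.1 h2]
  let l : A →+* Module.End 𝕜[X] M :=
    { toFun := fun a =>
        { toFun := fun m => o (a * o.symm m)
          map_add' := fun x y => by rw [map_add, mul_add, map_add]
          map_smul' := fun p m => by
            obtain ⟨u, rfl⟩ := o.surjective m
            rw [hsm, RingHom.id_apply, o.symm_apply_apply, o.symm_apply_apply, hsm, mul_assoc] }
      map_one' := by ext m; simp
      map_mul' := fun a b => by
        apply LinearMap.ext; intro m
        simp [Module.End.mul_apply, mul_assoc]
      map_zero' := by apply LinearMap.ext; intro m; simp
      map_add' := fun a b => by apply LinearMap.ext; intro m; simp [add_mul] }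
  have hl : ∀ a u, l a (o u) = o (a * u) := fun a u => by
    change o (a * o.symm (o u)) = _
    rw [o.symm_apply_apply]
  have hlinj : Function.Injective l := by
    intro a b hab
    have := LinearMap.congr_fun hab (o 1)
    rw [hl, hl, mul_one, mul_one] at this
    exact o.injective this
  let K := AlgebraicClosure (FractionRing 𝕜[X])
  let V := K ⊗[𝕜[X]] M
  let ρ : A →+* Module.End K V := (Module.End.baseChangeHom 𝕜[X] K M).toRingHom.comp l
  have hρ : ∀ a (c : K) u, ρ a (c ⊗ₜ o u) = c ⊗ₜ o (a * u) := fun a c u => by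
    change LinearMap.baseChange K (l a) (c ⊗ₜ o u) = _
    rw [LinearMap.baseChange_tmul, hl]
  have hKinj : Function.Injective (algebraMap 𝕜[X] K) := by
    rw [IsScalarTower.algebraMap_eq 𝕜[X] (FractionRing 𝕜[X]) K]
    exact (algebraMap (FractionRing 𝕜[X]) K).injective.comp (IsFractionRing.injective 𝕜[X] _)
  have : FaithfulSMul 𝕜[X] K := (faithfulSMul_iff_algebraMap_injective _ _).2 hKinj
  refine ⟨K, inferInstance, inferInstance, inferInstance, V, inferInstance, inferInstance, ρ, algebraMap 𝕜[X] K X, 1 ⊗ₜ o 1, ?_, ?_, ?_, ?_, ?_⟩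
  · exact (LinearMap.baseChangeHom_injective 𝕜[X] M K).comp hlinj
  · exact (transcendental_algebraMap_iff hKinj).2 (Polynomial.transcendental_X 𝕜)
  · intro c
    apply LinearMap.ext
    intro v
    induction v using TensorProduct.induction_on with
    | zero => simp
    | add x y hx hy => rw [map_add, map_add, hx, hy]
    | tmul k m =>
      obtain ⟨u, rfl⟩ := o.surjective m
      rw [hρ, Module.algebraMap_end_apply, TensorProduct.smul_tmul', IsScalarTower.algebraMap_apply 𝕜 𝕜[X] K, smul_eq_mul, ← Algebra.smul_def (algebraMap 𝕜 𝕜[X] c) k,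
        TensorProduct.smul_tmul, hsm, ← C_eq_algebraMap, aeval_C, Algebra.commutes]
  · rw [hρ, TensorProduct.smul_tmul', smul_eq_mul, ← Algebra.smul_def, TensorProduct.smul_tmul, hsm, aeval_X, mul_one, one_mul]
  · rw [eq_top_iff]
    rintro v -
    induction v using TensorProduct.induction_on with
    | zero => exact zero_mem _
    | add x y hx hy => exact add_mem hx hy
    | tmul k m =>
      obtain ⟨u, rfl⟩ := o.surjective m
      have : k ⊗ₜ[𝕜[X]] o u = k • ρ u (1 ⊗ₜ o 1) := by
        rw [hρ, TensorProduct.smul_tmul', smul_eq_mul, mul_one, mul_one]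
      rw [this]
      exact Submodule.smul_mem _ _ (Submodule.subset_span ⟨u, rfl⟩)

section
variable {𝕜 A : Type} [Field 𝕜] [Ring A] [Algebra 𝕜 A]

theorem gauss (Q μ : 𝕜) (hμ : μ ≠ 0) (hQ : Q ≠ 0) (hQm : ∀ m : ℤ, Q ^ m = 1 → m = 0) (B : A)
    (hreg : ∀ (x : A) (p : 𝕜[X]), p ≠ 0 → x * aeval B p = 0 → x = 0)
    (S : Set A) (hS : Algebra.adjoin 𝕜 S = ⊤)
    (hSS : ∀ s ∈ S, B * s = s * B ∨ T1 Q μ B s ∨ B * Y2 Q μ B s = Y2 Q μ B s * B) :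
    ∃ γ : A ≃ₐ[𝕜] A, ∀ s, (B * s = s * B → γ s = s) ∧
      (T1 Q μ B s → γ s = (μ * (Q - Q⁻¹)⁻¹) • (B * s - Q • (s * B))) ∧
      (B * Y2 Q μ B s = Y2 Q μ B s * B → γ s = s + (μ ^ 2 * (Q + Q⁻¹)⁻¹ * ((Q - Q⁻¹) ^ 2)⁻¹) •
        (B * B * s - (1 + Q ^ 2) • (B * s * B) + Q ^ 2 • (s * B * B))) := by
  obtain ⟨K, _, _, _, V, _, _, ρ, x, v0, hρ, hx, hc, hB, hV⟩ := exists_rep B hreg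
  have hsm : ∀ (c : 𝕜) (a : A), ρ (c • a) = algebraMap 𝕜 K c • ρ a := fun c a => by
    rw [Algebra.smul_def, map_mul, hc, ← Algebra.smul_def]
  have inj := (algebraMap 𝕜 K).injective
  obtain ⟨Q', hQ'⟩ : ∃ Q', Q' = algebraMap 𝕜 K Q := ⟨_, rfl⟩
  obtain ⟨μ', hμ'⟩ : ∃ Q', Q' = algebraMap 𝕜 K μ := ⟨_, rfl⟩
  have q0 : Q' ≠ 0 := by rw [hQ']; exact (_root_.map_ne_zero _).2 hQ
  have m0 : μ' ≠ 0 := by rw [hμ']; exact (_root_.map_ne_zero _).2 hμ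
  have qm : ∀ m : ℤ, Q' ^ m = 1 → m = 0 := fun m h => hQm m (inj (by rw [map_zpow₀, ← hQ', h, map_one]))
  have q2 : Q' ^ 2 ≠ 1 := fun h => by have := qm 2 (by exact_mod_cast h); omega
  have q4 : Q' ^ 4 ≠ 1 := fun h => by have := qm 4 (by exact_mod_cast h); omega
  obtain ⟨lam, hlam⟩ := IsAlgClosed.exists_pow_nat_eq (-(μ' ^ 2 * Q')⁻¹) (n := 2) (by norm_num)
  have hl : lam ^ 2 * μ' ^ 2 * Q' = -1 := by rw [hlam]; field_simp
  have lam0 : lam ≠ 0 := fun h => by rw [h] at hl; simp at hl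
  obtain ⟨z, hz⟩ := IsAlgClosed.exists_root (C lam * X ^ 2 + C (-x) * X + C (-lam)) (by
    rw [degree_quadratic lam0]; norm_num)
  have hz' : lam * z ^ 2 - x * z - lam = 0 := by
    simpa [IsRoot, sub_eq_add_neg] using hz
  have z0 : z ≠ 0 := fun h => by rw [h] at hz'; simp at hz'; exact lam0 hz'
  have hxz : x = lam * (z - z⁻¹) := by field_simp; linear_combination -hz'
  have halg : ∀ c : 𝕜, IsAlgebraic 𝕜 (algebraMap 𝕜 K c) := fun c => isAlgebraic_algebraMap c
  have hz2 : ∀ m : ℤ, z ^ 2 ≠ - Q' ^ m := by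
    intro m hm
    have h1 : IsAlgebraic 𝕜 z := IsAlgebraic.of_pow (n := 2) (by norm_num) (by
      rw [hm, hQ', ← map_zpow₀, ← map_neg]; exact halg _)
    have h2 : IsAlgebraic 𝕜 lam := IsAlgebraic.of_pow (n := 2) (by norm_num) (by
      rw [hlam, hQ', hμ', ← map_pow, ← map_mul, ← map_inv₀, ← map_neg]; exact halg _)
    exact hx (hxz ▸ h2.mul (h1.sub h1.inv))
  have he := ev_inj Q' lam z q0 lam0 z0 qm hz2
  have hcomm : ∀ s, B * s = s * B → ∀ j, ∀ v ∈ (ρ B).eigenspace (ev Q' lam z j), ρ s v ∈ (ρ B).eigenspace (ev Q' lam z j) := by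
    intro s hs j v hv
    rw [Module.End.mem_eigenspace_iff] at hv ⊢
    rw [← Module.End.mul_apply, ← map_mul, hs, map_mul, Module.End.mul_apply, hv, map_smul]
  have hT1 : ∀ s, T1 Q μ B s → T1 Q' μ' (ρ B) (ρ s) := by
    intro s hs
    have := congrArg ρ hs
    simpa only [T1, map_add, map_sub, map_mul, hsm, map_inv₀, map_pow, map_neg, ← hQ', ← hμ'] using this
  have hY2' : ∀ s, ρ (Y2 Q μ B s) = Y2 Q' μ' (ρ B) (ρ s) := by
    intro s
    simp only [Y2, map_add, map_sub, map_mul, hsm, map_inv₀, map_pow, map_neg, ← hQ', ← hμ']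
  have hY2 : ∀ s, B * Y2 Q μ B s = Y2 Q μ B s * B → ρ B * Y2 Q' μ' (ρ B) (ρ s) = Y2 Q' μ' (ρ B) (ρ s) * ρ B := by
    intro s hs
    rw [← hY2', ← map_mul, hs, map_mul]
  have ht : ⨆ j, (ρ B).eigenspace (ev Q' lam z j) = ⊤ := by
    have hle : ∀ j, (ρ B).eigenspace (ev Q' lam z j) ≤ ⨆ j, (ρ B).eigenspace (ev Q' lam z j) := fun j => le_iSup (fun j => (ρ B).eigenspace (ev Q' lam z j)) j
    have key : ∀ a : A, ∀ w ∈ ⨆ j, (ρ B).eigenspace (ev Q' lam z j), ρ a w ∈ ⨆ j, (ρ B).eigenspace (ev Q' lam z j) := by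
      intro a
      have ha : a ∈ Algebra.adjoin 𝕜 S := by rw [hS]; trivial
      induction ha using Algebra.adjoin_induction with
      | mem s hs =>
        intro w hw
        induction hw using Submodule.iSup_induction' with
        | zero => rw [map_zero]; exact zero_mem _
        | add x y _ _ hx hy => rw [map_add]; exact add_mem hx hy
        | mem j v hv =>
          rcases hSS s hs with h | h | h
          · exact hle j (hcomm s h j v hv)
          · obtain ⟨u1, hu1, u2, hu2, e⟩ := dec1 Q' μ' lam z (ρ B) q0 q2 q4 z0 hl he _ (hT1 s h) j v hv
            rw [e]; exact add_mem (hle _ hu1) (hle _ hu2)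
          · obtain ⟨u1, hu1, u2, hu2, u3, hu3, e⟩ := dec2 Q' μ' lam z (ρ B) q0 q2 q4 z0 hl he _ (hY2 s h) j v hv
            rw [e]; exact add_mem (add_mem (hle _ hu1) (hle _ hu2)) (hle _ hu3)
      | algebraMap c =>
        intro w hw
        rw [hc, Module.algebraMap_end_apply]; exact Submodule.smul_mem _ _ hw
      | add x y _ _ hx hy => intro w hw; rw [map_add, LinearMap.add_apply]; exact add_mem (hx w hw) (hy w hw)
      | mul x y _ _ hx hy => intro w hw; rw [map_mul, Module.End.mul_apply]; exact hx _ (hy w hw)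
    rw [eq_top_iff, ← hV, Submodule.span_le]
    rintro _ ⟨a, rfl⟩
    refine key a v0 (hle 0 ?_)
    rw [Module.End.mem_eigenspace_iff, hB, hxz, ev, zpow_zero, one_mul]
  obtain ⟨g, hg0, hg⟩ := exists_g Q' (μ' * lam * z⁻¹) q0 (mul_ne_zero (mul_ne_zero m0 lam0) (inv_ne_zero z0))
  obtain ⟨G, hG⟩ := exists_G (ρ B) _ he ht g
  obtain ⟨G', hG'⟩ := exists_G (ρ B) _ he ht (fun j => (g j)⁻¹)
  have hGG : G * G' = 1 := by
    apply top_ext (ρ B) _ ht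
    intro j v hv
    rw [Module.End.mul_apply, hG' j v hv, map_smul, hG j v hv, smul_smul, inv_mul_cancel₀ (hg0 j), one_smul, Module.End.one_apply]
  have hGG' : G' * G = 1 := by
    apply top_ext (ρ B) _ ht
    intro j v hv
    rw [Module.End.mul_apply, hG j v hv, map_smul, hG' j v hv, smul_smul, mul_inv_cancel₀ (hg0 j), one_smul, Module.End.one_apply]
  have c0 : ∀ s, B * s = s * B → ρ s * G = G * ρ s := by
    intro s hs
    apply top_ext (ρ B) _ ht
    intro j v hv
    rw [Module.End.mul_apply, Module.End.mul_apply, hG j v hv, hG j _ (hcomm s hs j v hv), map_smul]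
  have f1 : ∀ s, T1 Q μ B s → ρ ((μ * (Q - Q⁻¹)⁻¹) • (B * s - Q • (s * B))) * G = G * ρ s := by
    intro s hs
    have := fwd1 Q' μ' lam z (ρ B) q0 q2 q4 z0 hl he ht g hg G hG (ρ s) (hT1 s hs)
    simpa only [map_add, map_sub, map_mul, hsm, map_inv₀, map_pow, map_neg, ← hQ', ← hμ'] using this
  have b1 : ∀ s, T1 Q μ B s → ρ s * G = G * ρ ((-(μ * Q * (Q - Q⁻¹)⁻¹)) • (B * s - Q⁻¹ • (s * B))) := by
    intro s hs
    have := bwd1 Q' μ' lam z (ρ B) q0 q2 q4 z0 hl he ht g hg G hG (ρ s) (hT1 s hs)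
    simpa only [map_add, map_sub, map_mul, hsm, map_inv₀, map_pow, map_neg, ← hQ', ← hμ'] using this
  have f2 : ∀ s, B * Y2 Q μ B s = Y2 Q μ B s * B → ρ (s + (μ ^ 2 * (Q + Q⁻¹)⁻¹ * ((Q - Q⁻¹) ^ 2)⁻¹) •
        (B * B * s - (1 + Q ^ 2) • (B * s * B) + Q ^ 2 • (s * B * B))) * G = G * ρ s := by
    intro s hs
    have := fwd2 Q' μ' lam z (ρ B) q0 q2 q4 z0 hl he ht g hg G hG (ρ s) (hY2 s hs)
    simpa only [map_add, map_sub, map_mul, hsm, map_inv₀, map_pow, map_neg, map_one, ← hQ', ← hμ'] using this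
  have b2 : ∀ s, B * Y2 Q μ B s = Y2 Q μ B s * B → ρ s * G = G * ρ (s + (μ ^ 2 * Q ^ 2 * (Q + Q⁻¹)⁻¹ * ((Q - Q⁻¹) ^ 2)⁻¹) • (B * B * s - (1 + (Q ^ 2)⁻¹) • (B * s * B) + (Q ^ 2)⁻¹ • (s * B * B))) := by
    intro s hs
    have := bwd2 Q' μ' lam z (ρ B) q0 q2 q4 z0 hl he ht g hg G hG (ρ s) (hY2 s hs)
    simpa only [map_add, map_sub, map_mul, hsm, map_inv₀, map_pow, map_neg, map_one, ← hQ', ← hμ'] using this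
  obtain ⟨γ, hγ⟩ := mkAut (𝕜 := 𝕜) ρ hρ G G' hGG hGG' (fun c => c0 _ (Algebra.commutes c B).symm) S hS
    (by
      intro a ha
      rcases hSS a ha with h | h | h
      · exact ⟨_, c0 a h⟩
      · exact ⟨_, f1 a h⟩
      · exact ⟨_, f2 a h⟩)
    (by
      intro a ha
      rcases hSS a ha with h | h | h
      · exact ⟨_, c0 a h⟩
      · exact ⟨_, b1 a h⟩
      · exact ⟨_, b2 a h⟩)
  have hu : ∀ s a, ρ a * G = G * ρ s → γ s = a := by
    intro s a h
    have h1 := (hγ s).trans h.symm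
    have h2 := congrArg (· * G') h1
    simp only [mul_assoc, hGG, mul_one] at h2
    exact hρ h2
  exact ⟨γ, fun s => ⟨fun h => hu _ _ (c0 s h), fun h => hu _ _ (f1 s h), fun h => hu _ _ (f2 s h)⟩⟩

end
end

section
open Polynomial

section
variable {𝕜 A : Type} [Field 𝕜] [Ring A] [Algebra 𝕜 A]

theorem gauss' (Q μ : 𝕜) (hμ : μ ≠ 0) (hQ : Q ≠ 0) (hQm : ∀ m : ℤ, Q ^ m = 1 → m = 0) (B : A)
    (hreg : B ≠ 0 → ∀ (x : A) (p : 𝕜[X]), p ≠ 0 → x * aeval B p = 0 → x = 0)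
    (S : Set A) (hS : Algebra.adjoin 𝕜 S = ⊤)
    (hSS : ∀ s ∈ S, B * s = s * B ∨ T1 Q μ B s ∨ B * Y2 Q μ B s = Y2 Q μ B s * B) :
    ∃ γ : A ≃ₐ[𝕜] A, ∀ s, (B * s = s * B → γ s = s) ∧
      (T1 Q μ B s → γ s = (μ * (Q - Q⁻¹)⁻¹) • (B * s - Q • (s * B))) ∧
      (B * Y2 Q μ B s = Y2 Q μ B s * B → γ s = s + (μ ^ 2 * (Q + Q⁻¹)⁻¹ * ((Q - Q⁻¹) ^ 2)⁻¹) •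
        (B * B * s - (1 + Q ^ 2) • (B * s * B) + Q ^ 2 • (s * B * B))) := by
  by_cases hB : B = 0
  · subst hB
    refine ⟨AlgEquiv.refl, fun s => ⟨fun _ => rfl, fun h => ?_, fun _ => by simp⟩⟩
    have hd : Q - Q⁻¹ ≠ 0 := by
      intro h
      have h2 : Q ^ (2 : ℤ) = 1 := by
        have : Q ^ 2 = 1 := by
          field_simp at h
          linear_combination h
        exact_mod_cast this
      have := hQm 2 h2
      omega
    have hs : s = 0 := by
      simp only [T1, zero_mul, mul_zero, smul_zero, sub_zero, zero_add] at h
      refine (smul_eq_zero.1 h.symm).resolve_left ?_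
      exact neg_ne_zero.2 (mul_ne_zero (inv_ne_zero (mul_ne_zero (pow_ne_zero _ hμ) hQ)) (pow_ne_zero _ hd))
    simp [hs]
  · exact gauss Q μ hμ hQ hQm B (hreg hB) S hS hSS

theorem T1_inj {B : Type} [Ring B] [Algebra 𝕜 B] (f : A →ₐ[𝕜] B) (hf : Function.Injective f) (Q μ : 𝕜) (b t : A)
    (h : T1 Q μ (f b) (f t)) : T1 Q μ b t := by
  apply hf
  simpa only [T1, map_add, map_sub, map_mul, map_smul] using h

theorem Y2_map {B : Type} [Ring B] [Algebra 𝕜 B] (f : A →ₐ[𝕜] B) (Q μ : 𝕜) (b t : A) :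
    f (Y2 Q μ b t) = Y2 Q μ (f b) (f t) := by
  simp only [Y2, map_add, map_sub, map_mul, map_smul]

theorem T1_one (Q : 𝕜) (b t : A) (h : b * b * t - (Q + Q⁻¹) • (b * t * b) + t * b * b = (-(Q⁻¹ * (Q - Q⁻¹) ^ 2)) • t) :
    T1 Q 1 b t := by
  rw [T1, one_pow, one_mul]; exact h

theorem T1_I (Q μ : 𝕜) (hm : μ ^ 2 = -1) (b t : A) (h : b * b * t - (Q + Q⁻¹) • (b * t * b) + t * b * b = (Q⁻¹ * (Q - Q⁻¹) ^ 2) • t) :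
    T1 Q μ b t := by
  have e : -((μ ^ 2 * Q)⁻¹ * (Q - Q⁻¹) ^ 2) = Q⁻¹ * (Q - Q⁻¹) ^ 2 := by
    rw [hm, neg_one_mul, inv_neg, neg_mul, neg_neg]
  rw [T1, e]; exact h

theorem Y2_one (Q : 𝕜) (b t : A) : Y2 Q 1 b t = b * b * t - (Q ^ 2 + (Q ^ 2)⁻¹) • (b * t * b) + t * b * b + (Q⁻¹ * (Q ^ 2 - (Q ^ 2)⁻¹) ^ 2) • t := by
  rw [Y2, one_pow, one_mul]

theorem fin1 (c Q : 𝕜) (x y : A) : -((1 * c) • (x - Q • y)) = c • (Q • y - x) := by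
  rw [one_mul, ← smul_neg, neg_sub]

theorem fin2 (Q : 𝕜) (hQ : Q ≠ 0) (b t : A) :
    -(t + (1 ^ 2 * (Q + Q⁻¹)⁻¹ * ((Q - Q⁻¹) ^ 2)⁻¹) • (b * b * t - (1 + Q ^ 2) • (b * t * b) + Q ^ 2 • (t * b * b)))
    = (-((Q + Q⁻¹)⁻¹ * ((Q - Q⁻¹)^2)⁻¹)) • (b ^ 2 * t - (Q * (Q + Q⁻¹)) • (b * t * b) + Q^2 • (t * b ^ 2)) - t := by
  have e : Q * (Q + Q⁻¹) = 1 + Q ^ 2 := by field_simp; ring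
  rw [e, one_pow, one_mul, neg_smul, pow_two b, ← mul_assoc t, neg_add, add_comm, sub_eq_add_neg (-_)]

end

/-- the relations of the Chevalley generators of the twisted algebra -/
structure GRel (n : ℕ) {A : Type} [Ring A] [Algebra F A] (s : ℕ → A) : Prop where
  comm : ∀ m m', 1 ≤ m → m + 2 ≤ m' → m' ≤ n → s m * s m' = s m' * s m
  t1 : ∀ m, 1 ≤ m → m + 1 < n → T1 q 1 (s m) (s (m + 1))
  t2 : ∀ m, 1 ≤ m → m + 1 < n → T1 q 1 (s (m + 1)) (s m)
  t3 : T1 (q ^ 2) (RatFunc.C Complex.I) (s n) (s (n - 1))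
  t4 : s (n - 1) * Y2 q 1 (s (n - 1)) (s n) = Y2 q 1 (s (n - 1)) (s n) * s (n - 1)

theorem qz_ne (m : ℤ) (h : q ^ m = 1) : m = 0 := by
  by_contra hm
  rcases Int.natAbs_eq m with e | e
  · rw [e, zpow_natCast] at h
    exact qpow_ne _ (by omega) h
  · rw [e, zpow_neg, zpow_natCast, inv_eq_one] at h
    exact qpow_ne _ (by omega) h

theorem qz2_ne (m : ℤ) (h : (q ^ 2) ^ m = 1) : m = 0 := by
  have : q ^ (2 * m) = 1 := by rw [zpow_mul]; exact_mod_cast h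
  have := qz_ne _ this
  omega

theorem CI_sq : (RatFunc.C Complex.I : F) ^ 2 = -1 := by
  rw [← map_pow, Complex.I_sq, map_neg, map_one]

theorem main_gen (n k : ℕ) (hn : 2 ≤ n) (hk1 : 1 ≤ k) (hkn : k ≤ n) {A : Type} [Ring A] [Algebra F A] (s : ℕ → A) (H : GRel n s)
    (hgen : Algebra.adjoin F {x | ∃ m, 1 ≤ m ∧ m ≤ n ∧ s m = x} = ⊤)
    (hreg : s k ≠ 0 → ∀ (x : A) (p : F[X]), p ≠ 0 → x * aeval (s k) p = 0 → x = 0)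
    (σ : A ≃ₐ[F] A) (hσ : ∀ m, 1 ≤ m → m ≤ n → σ (s m) = if m = k ∨ (k ≠ n ∧ m = k + 1) then - s m else s m) :
    ∃ β : A ≃ₐ[F] A, ∀ m, 1 ≤ m → m ≤ n →
      (m = k → β (s m) = -s k) ∧
      (m ≠ k - 1 ∧ m ≠ k ∧ m ≠ k + 1 → β (s m) = s m) ∧
      (m = k + 1 → k ≠ n - 1 → k ≠ n → β (s m) = (qk n k - (qk n k)⁻¹)⁻¹ • (qk n k • (s (k+1) * s k) - s k * s (k+1))) ∧
      (m = k - 1 → k ≠ 1 → k ≠ n → β (s m) = (qk n k - (qk n k)⁻¹)⁻¹ • (s k * s (k-1) - qk n k • (s (k-1) * s k))) ∧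
      (k = n - 1 → m = n → β (s m) = (-((q + q⁻¹)⁻¹ * ((q - q⁻¹)^2)⁻¹)) •
          (s (n-1) ^ 2 * s n - (q * (q + q⁻¹)) • (s (n-1) * s n * s (n-1)) + q^2 • (s n * s (n-1) ^ 2)) - s n) ∧
      (k = n → m = n - 1 → β (s m) = (RatFunc.C Complex.I * (q^2 - (q^2)⁻¹)⁻¹) • (s n * s (n-1) - q^2 • (s (n-1) * s n))) := by
  have hcomm : ∀ m, 1 ≤ m → m ≤ n → (m = k - 1 ∨ m = k + 1) ∨ s k * s m = s m * s k := by
    intro m h1 h2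
    rcases lt_trichotomy m k with h | h | h
    · by_cases hm : m = k - 1
      · exact Or.inl (Or.inl hm)
      · exact Or.inr (H.comm m k h1 (by omega) hkn).symm
    · exact Or.inr (by rw [h])
    · by_cases hm : m = k + 1
      · exact Or.inl (Or.inr hm)
      · exact Or.inr (H.comm k m hk1 (by omega) h2)
  rcases Nat.lt_or_ge k n with hlt | hge
  · obtain ⟨γ, hγ⟩ := gauss' q (1 : F) one_ne_zero q_ne qz_ne (s k) hreg _ hgen (by
      rintro _ ⟨m, h1, h2, rfl⟩
      rcases hcomm m h1 h2 with (rfl | rfl) | h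
      · have := H.t2 (k - 1) h1 (by omega)
        rw [Nat.sub_add_cancel hk1] at this
        exact Or.inr (Or.inl this)
      · by_cases hk : k + 1 < n
        · exact Or.inr (Or.inl (H.t1 k hk1 hk))
        · have e : n = k + 1 := by omega
          have := H.t4
          rw [e, Nat.add_sub_cancel] at this
          exact Or.inr (Or.inr this)
      · exact Or.inl h)
    have hq : qk n k = q := by rw [qk, if_pos hlt]
    refine ⟨σ.trans γ, fun m h1 h2 => ⟨?_, ?_, ?_, ?_, ?_, ?_⟩⟩
    · rintro rfl
      rw [AlgEquiv.trans_apply, hσ m h1 h2, if_pos (Or.inl rfl), map_neg, (hγ _).1 rfl]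
    · rintro ⟨e1, e2, e3⟩
      rw [AlgEquiv.trans_apply, hσ m h1 h2, if_neg (by omega), (hγ _).1 ((hcomm m h1 h2).resolve_left (by omega))]
    · rintro rfl e1 e2
      rw [AlgEquiv.trans_apply, hσ _ h1 h2, if_pos (Or.inr ⟨e2, rfl⟩), map_neg, (hγ _).2.1 (H.t1 k hk1 (by omega)), hq]
      exact fin1 _ _ _ _
    · rintro rfl e1 e2
      have := H.t2 (k - 1) h1 (by omega)
      rw [Nat.sub_add_cancel hk1] at this
      rw [AlgEquiv.trans_apply, hσ _ h1 h2, if_neg (by omega), (hγ _).2.1 this, hq, one_mul]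
    · rintro e1 rfl
      have h4 := H.t4
      rw [← e1] at h4 ⊢
      rw [AlgEquiv.trans_apply, hσ _ h1 h2, if_pos (by omega), map_neg, (hγ _).2.2 h4]
      exact fin2 q q_ne _ _
    · intro e1; omega
  · have hkn' : k = n := by omega
    subst hkn'
    have hI : (RatFunc.C Complex.I : F) ≠ 0 := fun h => by
      have := CI_sq; rw [h] at this; simp at this
    obtain ⟨γ, hγ⟩ := gauss' (q ^ 2) (RatFunc.C Complex.I : F) hI (pow_ne_zero _ q_ne) qz2_ne (s k) hreg _ hgen (by
      rintro _ ⟨m, h1, h2, rfl⟩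
      rcases hcomm m h1 h2 with (rfl | rfl) | h
      · exact Or.inr (Or.inl H.t3)
      · omega
      · exact Or.inl h)
    refine ⟨σ.trans γ, fun m h1 h2 => ⟨?_, ?_, ?_, ?_, ?_, ?_⟩⟩
    · rintro rfl
      rw [AlgEquiv.trans_apply, hσ m h1 h2, if_pos (Or.inl rfl), map_neg, (hγ _).1 rfl]
    · rintro ⟨e1, e2, e3⟩
      rw [AlgEquiv.trans_apply, hσ m h1 h2, if_neg (by omega), (hγ _).1 ((hcomm m h1 h2).resolve_left (by omega))]
    · rintro rfl e1 e2; exact absurd rfl e2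
    · rintro rfl e1 e2; exact absurd rfl e2
    · intro e1; omega
    · rintro - rfl
      rw [AlgEquiv.trans_apply, hσ _ h1 h2, if_neg (by omega), (hγ _).2.1 H.t3]
end

section
section
variable {n : ℕ}

theorem Rm_diag (u v : Fin (2*n) → F)
    (h1 : ∀ i j, u j * v i = v j * u i) (h2 : ∀ i j, u j * v (pr n j) = v (pr n i) * u i) :
    RX n F * M12 (Matrix.diagonal u) (Matrix.diagonal v) = M21 (Matrix.diagonal u) (Matrix.diagonal v) * RX n F := by
  have e1 : M12 (Matrix.diagonal u) (Matrix.diagonal v) = Matrix.diagonal (fun p : Fin (2*n) × Fin (2*n) => u p.1 * v p.2) := by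
    ext ⟨i, a⟩ ⟨j, b⟩
    simp only [M12, Matrix.diagonal_apply, Prod.mk.injEq]
    by_cases h : i = j <;> by_cases h' : a = b <;> simp [h, h']
  have e2 : M21 (Matrix.diagonal u) (Matrix.diagonal v) = Matrix.diagonal (fun p : Fin (2*n) × Fin (2*n) => u p.1 * v p.2) := by
    ext ⟨i, a⟩ ⟨j, b⟩
    simp only [M21, Matrix.diagonal_apply, Prod.mk.injEq]
    by_cases h : i = j <;> by_cases h' : a = b <;> simp [h, h', mul_comm]
  rw [e1, e2]
  ext ⟨i, a⟩ ⟨j, b⟩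
  rw [Matrix.mul_diagonal, Matrix.diagonal_mul]
  by_cases hR : RX n F (i, a) (j, b) = 0
  · rw [hR, zero_mul, mul_zero]
  · rw [mul_comm]
    congr 1
    by_cases c1 : i = j ∧ a = b
    · rw [c1.1, c1.2]
    · by_cases c2 : j = a ∧ b = i
      · rw [c2.1, c2.2]; change u a * v i = u i * v a; rw [h1 i a, mul_comm]
      · by_cases c3 : a = pr n i ∧ b = pr n j
        · rw [c3.1, c3.2]; change u j * v (pr n j) = u i * v (pr n i); rw [h2 i j, mul_comm]
        · exfalso; apply hR
          have : Rm n (i, a) (j, b) = 0 := by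
            rw [Rm]
            simp only
            rw [if_neg c1, if_neg (fun h => c2 h.2), if_neg (fun h => c3 h.2)]; ring
          rw [RX, this, map_zero]

theorem hat_diag (u : Fin (2*n) → F) : hat (Matrix.diagonal u) = Matrix.diagonal (fun i => u (pr n i)) := by
  ext k j
  rw [hat, Matrix.diagonal_apply, Matrix.diagonal_apply]
  by_cases h : k = j
  · subst h
    have : cc n k k = 1 := by
      rw [cc, mul_inv_cancel₀ (show dd n k ≠ 0 from zpow_ne_zero _ q_ne), one_mul, eps_mul_self]
    simp [this]
  · rw [if_neg (fun e => h ((pr_inj n).1 e).symm), if_neg h, smul_zero]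

theorem RTT_diag (a : Fin (2*n) → F) (h1 : ∀ i, a i * a (pr n i) = 1) (h2 : ∀ i j, a i * a i = a j * a j) :
    RTT (Matrix.diagonal a) (Matrix.diagonal fun i => (a i)⁻¹) := by
  have h0 : ∀ i, a i ≠ 0 := fun i h => by have := h1 i; rw [h, zero_mul] at this; exact zero_ne_one this
  have h1' : ∀ i, a (pr n i) = (a i)⁻¹ := fun i => eq_inv_of_mul_eq_one_right (h1 i)
  have ho : (1 : Mat n F) = Matrix.diagonal (fun _ => (1 : F)) := rfl
  refine ⟨?_, ?_, ?_, ?_, ?_, ?_, ?_, ?_, ?_, ?_, ?_⟩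
  · intro i j h; exact Matrix.diagonal_apply_ne _ h.ne
  · intro i j h; exact Matrix.diagonal_apply_ne _ h.ne'
  · intro i; simp [h0 i]
  · intro i; simp [h0 i]
  · apply Rm_diag
    · intro i j; rfl
    · intro i j; rw [h1, mul_comm, h1]
  · apply Rm_diag
    · intro i j; rfl
    · intro i j; rw [h1', h1', inv_inv, inv_inv, inv_mul_cancel₀ (h0 _), mul_inv_cancel₀ (h0 _)]
  · apply Rm_diag
    · intro i j
      have := h2 i j
      have := h0 i; have := h0 j
      field_simp
      rw [pow_two, pow_two]; exact h2 i j
    · intro i j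
      rw [h1', h1', ← mul_inv, ← mul_inv, h2 i j]
  · rw [hat_diag, Matrix.diagonal_mul_diagonal, ho]; congr 1; funext i; exact h1 i
  · rw [hat_diag, Matrix.diagonal_mul_diagonal, ho]; congr 1; funext i; rw [h1', inv_inv, inv_mul_cancel₀ (h0 _)]
  · rw [hat_diag, Matrix.diagonal_mul_diagonal, ho]; congr 1; funext i; rw [mul_comm, h1 i]
  · rw [hat_diag, Matrix.diagonal_mul_diagonal, ho]; congr 1; funext i; rw [h1', inv_inv, mul_inv_cancel₀ (h0 _)]

theorem exists_hom (a : Fin (2*n) → F) (h1 : ∀ i, a i * a (pr n i) = 1) (h2 : ∀ i j, a i * a i = a j * a j) :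
    ∃ f : Usp n →ₐ[F] Usp n, (∀ i j, f (tU n i j) = algebraMap F _ (a i) * tU n i j) ∧ (∀ i j, f (tbU n i j) = algebraMap F _ (a i)⁻¹ * tbU n i j) := by
  have hd := (RTT_diag a h1 h2).map (Algebra.ofId F (Usp n))
  have hc : ∀ (u : Fin (2*n) → F) (x : Usp n) i j, Commute ((Matrix.diagonal u).map (Algebra.ofId F (Usp n)) i j) x := fun u x i j => Algebra.commutes (Matrix.diagonal u i j) x
  have hR := hd.mul (RTT_U n) (fun _ _ _ _ => hc _ _ _ _) (fun _ _ _ _ => hc _ _ _ _)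
    (fun _ _ _ _ => hc _ _ _ _) (fun _ _ _ _ => hc _ _ _ _)
  have e : ∀ u : Fin (2*n) → F, (Matrix.diagonal u).map (Algebra.ofId F (Usp n)) = Matrix.diagonal fun i => algebraMap F (Usp n) (u i) := by
    intro u
    rw [Matrix.diagonal_map (map_zero _)]; rfl
  rw [e, e] at hR
  refine ⟨hR.hom, fun i j => ?_, fun i j => ?_⟩
  · rw [hR.hom_t, Matrix.diagonal_mul]; rfl
  · rw [hR.hom_tb, Matrix.diagonal_mul]; rfl

theorem sum_aux {R A ι : Type*} [Field R] [Ring A] [Algebra R A] (S : Finset ι) (c d : R) (e : ι → R) (x y : ι → A) :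
    ∑ k ∈ S, e k • ((algebraMap R A c * x k) * (algebraMap R A d * y k)) = (c * d) • ∑ k ∈ S, e k • (x k * y k) := by
  rw [Finset.smul_sum]
  refine Finset.sum_congr rfl fun k _ => ?_
  rw [← Algebra.smul_def, ← Algebra.smul_def, smul_mul_smul_comm, smul_comm]

theorem hom_s (a : Fin (2*n) → F) (f : Usp n →ₐ[F] Usp n) (h1 : ∀ i j, f (tU n i j) = algebraMap F _ (a i) * tU n i j)
    (h2 : ∀ i j, f (tbU n i j) = algebraMap F _ (a i)⁻¹ * tbU n i j) (i j) : f (sU n i j) = (a i * (a j)⁻¹) • sU n i j := by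
  rw [sU, map_sum, ← sum_aux]
  refine Finset.sum_congr rfl fun k _ => ?_
  rw [map_smul, map_mul, h1, h2]

theorem s_mem (i j : Fin (2*n)) : sU n i j ∈ Utw n := Algebra.subset_adjoin ⟨(i, j), rfl⟩

theorem hom_mem (a : Fin (2*n) → F) (f : Usp n →ₐ[F] Usp n) (h : ∀ i j, f (sU n i j) = (a i * (a j)⁻¹) • sU n i j) (x) (hx : x ∈ Utw n) : f x ∈ Utw n := by
  have : (Utw n) ≤ (Utw n).comap f := by
    apply Algebra.adjoin_le
    rintro _ ⟨⟨i, j⟩, rfl⟩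
    change f (sU n i j) ∈ Utw n
    rw [h]
    exact (Utw n).smul_mem (s_mem i j) _
  exact this hx

theorem inv_aux {R A : Type*} [Field R] [Ring A] [Algebra R A] (c : R) (hc : c ≠ 0) (x : A) :
    algebraMap R A c * (algebraMap R A c⁻¹ * x) = x := by
  rw [← mul_assoc, ← map_mul, mul_inv_cancel₀ hc, map_one, one_mul]

theorem hom_comp (a b : Fin (2*n) → F) (hab : ∀ i, a i * b i = 1) (f g : Usp n →ₐ[F] Usp n) (h1 : ∀ i j, f (tU n i j) = algebraMap F _ (a i) * tU n i j)
    (h2 : ∀ i j, f (tbU n i j) = algebraMap F _ (a i)⁻¹ * tbU n i j) (h3 : ∀ i j, g (tU n i j) = algebraMap F _ (b i) * tU n i j)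
    (h4 : ∀ i j, g (tbU n i j) = algebraMap F _ (b i)⁻¹ * tbU n i j) (x) : f (g x) = x := by
  have ha : ∀ i, a i ≠ 0 := fun i => left_ne_zero_of_mul_eq_one (hab i)
  have hb : ∀ i, b i = (a i)⁻¹ := fun i => eq_inv_of_mul_eq_one_right (hab i)
  induction x using U_induction with
  | hF r => rw [AlgHom.commutes, AlgHom.commutes]
  | ht i j =>
    rw [h3, map_mul, AlgHom.commutes, h1, hb, ← mul_assoc, ← map_mul, inv_mul_cancel₀ (ha i), map_one, one_mul]
  | htb i j =>
    rw [h4, map_mul, AlgHom.commutes, h2, hb, inv_inv, ← mul_assoc, ← map_mul, mul_inv_cancel₀ (ha i), map_one, one_mul]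
  | hadd x y hx hy => rw [map_add, map_add, hx, hy]
  | hmul x y hx hy => rw [map_mul, map_mul, hx, hy]

theorem exists_sigma (a : Fin (2*n) → F) (h1 : ∀ i, a i * a (pr n i) = 1) (h2 : ∀ i j, a i * a i = a j * a j) :
    ∃ σ : Utw n ≃ₐ[F] Utw n, ∀ i j, σ ⟨sU n i j, s_mem i j⟩ = (a i * (a j)⁻¹) • ⟨sU n i j, s_mem i j⟩ := by
  have h0 : ∀ i, a i ≠ 0 := fun i => left_ne_zero_of_mul_eq_one (h1 i)
  obtain ⟨f, f1, f2⟩ := exists_hom a h1 h2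
  obtain ⟨g, g1, g2⟩ := exists_hom (fun i => (a i)⁻¹) (fun i => by rw [← mul_inv, h1, inv_one]) (fun i j => by rw [← mul_inv, ← mul_inv, h2 i j])
  have fs := hom_s a f f1 f2
  have gs := hom_s _ g g1 g2
  let f' : Utw n →ₐ[F] Utw n := (f.comp (Utw n).val).codRestrict _ (fun x => hom_mem a f fs x x.2)
  let g' : Utw n →ₐ[F] Utw n := (g.comp (Utw n).val).codRestrict _ (fun x => hom_mem _ g gs x x.2)
  refine ⟨AlgEquiv.ofAlgHom f' g' ?_ ?_, fun i j => ?_⟩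
  · apply AlgHom.ext; intro x
    apply Subtype.ext
    exact hom_comp a _ (fun i => mul_inv_cancel₀ (h0 i)) f g f1 f2 g1 g2 x
  · apply AlgHom.ext; intro x
    apply Subtype.ext
    exact hom_comp _ a (fun i => inv_mul_cancel₀ (h0 i)) g f g1 g2 f1 f2 x
  · apply Subtype.ext
    exact fs i j

end
end

section
open Polynomial

theorem GRel_of_SRel {n : ℕ} (hn : 2 ≤ n) {A : Type} [Ring A] [Algebra F A] {s : Fin (2*n) → Fin (2*n) → A} (H : SRel n s) (t : ℕ → A)
    (ht : ∀ i j : Fin (2*n), (i : ℕ) = j + 1 → t i = s i j) : GRel n t := by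
  have hd := qd_ne
  have h2 := qpow_ne 2 (by norm_num)
  have h4 := qpow_ne 4 (by norm_num)
  have hq := q_ne
  have e1 : ∀ m, 1 ≤ m → m + 1 < n → ∀ x y z : Fin (2*n), (x : ℕ) + 1 = m → (y : ℕ) = x + 1 → (z : ℕ) = y + 1 →
      s y x * s z y + (q - q⁻¹) • s z x = q • (s z y * s y x) := by
    intro m h1 h2 x y z hx hy hz
    have v1 := pr_val x
    have v2 := pr_val y
    have h := peelL H x y z hz (by omega) (by omega) (by omega) (by omega)
    rwa [eps_lt (i := y) (by omega), mul_one] at h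
  let p0 : Fin (2*n) := ⟨n - 2, by omega⟩
  let p1 : Fin (2*n) := ⟨n - 1, by omega⟩
  let p2 : Fin (2*n) := ⟨n, by omega⟩
  let p3 : Fin (2*n) := ⟨n + 1, by omega⟩
  have g0 : (p0 : ℕ) + 2 = n := by simp only [p0]; omega
  have g1 : (p1 : ℕ) + 1 = n := by simp only [p1]; omega
  have g2 : (p2 : ℕ) = n := rfl
  have g3 : (p3 : ℕ) = n + 1 := rfl
  have ta : t (n - 1) = s p1 p0 := ht p1 p0 (by omega)
  have tb : t n = s p2 p1 := ht p2 p1 (by omega)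
  refine ⟨?_, ?_, ?_, ?_, ?_⟩
  · intro m m' h1 h2 h3
    have f1 := ht ⟨m, by omega⟩ ⟨m - 1, by omega⟩ (by simp only; omega)
    have f2 := ht ⟨m', by omega⟩ ⟨m' - 1, by omega⟩ (by simp only; omega)
    simp only at f1 f2
    rw [f1, f2]
    exact commG H _ _ _ _ (by simp only; omega) (by simp only; omega) (by rw [Fin.lt_def]; simp only; omega) h3
  · intro m h1 h3
    have f1 := ht ⟨m, by omega⟩ ⟨m - 1, by omega⟩ (by simp only; omega)
    have f2 := ht ⟨m + 1, by omega⟩ ⟨m, by omega⟩ rfl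
    simp only at f1 f2
    rw [f1, f2]
    have hm : m = m - 1 + 1 := by omega
    exact T1_one _ _ _ (ga1 q hq h2 _ _ _ (e1 m h1 h3 ⟨m - 1, by omega⟩ ⟨m, by omega⟩ ⟨m + 1, by omega⟩ hm.symm hm rfl)
      (serA1 H ⟨m - 1, by omega⟩ ⟨m, by omega⟩ ⟨m + 1, by omega⟩ hm rfl h3))
  · intro m h1 h3
    have f1 := ht ⟨m, by omega⟩ ⟨m - 1, by omega⟩ (by simp only; omega)
    have f2 := ht ⟨m + 1, by omega⟩ ⟨m, by omega⟩ rfl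
    simp only at f1 f2
    rw [f1, f2]
    have hm : m = m - 1 + 1 := by omega
    exact T1_one _ _ _ (ga2 q hq h2 _ _ _ (e1 m h1 h3 ⟨m - 1, by omega⟩ ⟨m, by omega⟩ ⟨m + 1, by omega⟩ hm.symm hm rfl)
      (serA2 H ⟨m - 1, by omega⟩ ⟨m, by omega⟩ ⟨m + 1, by omega⟩ hm rfl h3))
  · rw [ta, tb]
    exact T1_I _ _ CI_sq _ _ (ga3 q hq h2 h4 _ _ _ (E1 H g0 g1 g2 g3) (E3 H g0 g1 g2 g3))
  · rw [ta, tb, Y2_one]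
    exact ga4 q hq h2 h4 _ _ _ _ _ (E1 H g0 g1 g2 g3) (E2 H g0 g1 g2 g3) (E4 H g0 g1 g2 g3) (E5 H g0 g1 g2 g3)

theorem GRel_inj {n : ℕ} {A B : Type} [Ring A] [Algebra F A] [Ring B] [Algebra F B] (f : A →ₐ[F] B) (hf : Function.Injective f)
    (t : ℕ → A) (H : GRel n (fun m => f (t m))) : GRel n t where
  comm m m' h1 h2 h3 := hf (by rw [map_mul, map_mul]; exact H.comm m m' h1 h2 h3)
  t1 m h1 h2 := T1_inj f hf _ _ _ _ (H.t1 m h1 h2)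
  t2 m h1 h2 := T1_inj f hf _ _ _ _ (H.t2 m h1 h2)
  t3 := T1_inj f hf _ _ _ _ H.t3
  t4 := hf (by rw [map_mul, map_mul, Y2_map]; exact H.t4)

theorem sg_mem (n m : ℕ) : sg n m ∈ Utw n := by
  unfold sg
  split
  · exact s_mem _ _
  · exact zero_mem _

theorem sg_eq {n : ℕ} (i j : Fin (2*n)) (h : (i : ℕ) = j + 1) : sg n i = sU n i j := by
  have := i.isLt
  rw [sg, dif_pos ⟨by omega, by omega⟩]
  congr 1
  apply Fin.ext
  simp only; omega

/-- the generators inside the twisted algebra -/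
def xs (n m : ℕ) : Utw n := ⟨sg n m, sg_mem n m⟩

theorem xs_GRel {n : ℕ} (hn : 2 ≤ n) : GRel n (xs n) :=
  GRel_inj (Utw n).val Subtype.val_injective _ (GRel_of_SRel hn SRel_U (sg n) sg_eq)

theorem xs_gen {n : ℕ} (hn : 2 ≤ n) : Algebra.adjoin F {x | ∃ m, 1 ≤ m ∧ m ≤ n ∧ xs n m = x} = ⊤ := by
  have h : Utw n ≤ (Algebra.adjoin F {x | ∃ m, 1 ≤ m ∧ m ≤ n ∧ xs n m = x}).map (Utw n).val := by
    apply Algebra.adjoin_le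
    rintro _ ⟨⟨i, j⟩, rfl⟩
    refine gen_all SRel_U hn _ (fun i j hij hi => ?_) i j
    exact ⟨xs n i, Algebra.subset_adjoin ⟨i, by omega, hi, rfl⟩, sg_eq i j hij⟩
  rw [eq_top_iff]
  rintro x -
  obtain ⟨y, hy, e⟩ := h x.2
  have : y = x := Subtype.ext e
  rw [← this]; exact hy

theorem xs_reg {n k : ℕ} (hk1 : 1 ≤ k) (hkn : k ≤ n) (hb : xs n k ≠ 0) (x : Utw n) (p : F[X]) (hp : p ≠ 0)
    (hx : x * aeval (xs n k) p = 0) : x = 0 := by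
  have hs : sg n k = sU n ⟨k, by omega⟩ ⟨k - 1, by omega⟩ := sg_eq ⟨k, by omega⟩ ⟨k - 1, by omega⟩ (by simp only; omega)
  apply Subtype.ext
  refine s_regular ⟨k - 1, by omega⟩ ⟨k, by omega⟩ (by simp only; omega) (fun h0 => hb (Subtype.ext (hs.trans h0))) _ p hp ?_
  rw [← hs]
  have h := congrArg (Utw n).val hx
  rw [map_mul, ← Polynomial.aeval_algHom_apply, map_zero] at h
  exact h

theorem exists_sign {n k : ℕ} (hn : 2 ≤ n) (hk1 : 1 ≤ k) (hkn : k ≤ n) : ∃ σ : Utw n ≃ₐ[F] Utw n,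
    ∀ m, 1 ≤ m → m ≤ n → σ (xs n m) = if m = k ∨ (k ≠ n ∧ m = k + 1) then - xs n m else xs n m := by
  obtain ⟨θ, hθ, hθ0, hθs⟩ : ∃ θ : F, θ * θ = θ⁻¹ * θ⁻¹ ∧ θ ≠ 0 ∧ θ * θ = if k + 1 < n then 1 else -1 := by
    by_cases h : k + 1 < n
    · exact ⟨1, by simp, one_ne_zero, by simp [h]⟩
    · have := CI_sq
      rw [pow_two] at this
      exact ⟨RatFunc.C Complex.I, by rw [← mul_inv, this]; norm_num, fun h0 => by rw [h0] at this; simp at this, by rw [this, if_neg h]⟩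
  let b : ℕ → F := fun j => if j = k then -1 else 1
  have hb : ∀ j, b j * b j = 1 := fun j => by simp only [b]; split <;> norm_num
  have hb' : ∀ j, (b j)⁻¹ = b j := fun j => by simp only [b]; split <;> norm_num
  let a : Fin (2*n) → F := fun i => if (i : ℕ) < n then θ * b i else θ⁻¹ * b (pr n i)
  have a1 : ∀ i, a i * a (pr n i) = 1 := by
    intro i
    have hv := pr_val i
    have hv' := pr_val (pr n i)
    have hpp : pr n (pr n i) = i := Fin.ext (by omega)
    simp only [a]
    by_cases hi : (i : ℕ) < n
    · rw [if_pos hi, if_neg (by omega), hpp, mul_mul_mul_comm, hb, mul_inv_cancel₀ hθ0, one_mul]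
    · rw [if_neg hi, if_pos (by omega), mul_mul_mul_comm, hb, inv_mul_cancel₀ hθ0, one_mul]
  have a2' : ∀ i, a i * a i = θ * θ := by
    intro i
    simp only [a]
    split
    · rw [mul_mul_mul_comm, hb, mul_one]
    · rw [mul_mul_mul_comm, hb, mul_one, hθ]
  obtain ⟨σ, hσ⟩ := exists_sigma a a1 (fun i j => by rw [a2', a2'])
  refine ⟨σ, fun m h1 h2 => ?_⟩
  have hx : xs n m = ⟨sU n ⟨m, by omega⟩ ⟨m - 1, by omega⟩, s_mem _ _⟩ := by
    have h3 : sg n m = sU n ⟨m, by omega⟩ ⟨m - 1, by omega⟩ := sg_eq ⟨m, by omega⟩ ⟨m - 1, by omega⟩ (by simp only; omega)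
    exact Subtype.ext h3
  have key : a ⟨m, by omega⟩ * (a ⟨m - 1, by omega⟩)⁻¹ = if m = k ∨ (k ≠ n ∧ m = k + 1) then -1 else 1 := by
    by_cases hm : m < n
    · have e1 : a ⟨m, by omega⟩ = θ * b m := if_pos hm
      have e2 : a ⟨m - 1, by omega⟩ = θ * b (m - 1) := if_pos (show m - 1 < n by omega)
      rw [e1, e2, mul_inv, mul_mul_mul_comm, mul_inv_cancel₀ hθ0, one_mul, hb']
      simp only [b]
      by_cases c1 : m = k
      · rw [if_pos c1, if_neg (by omega), if_pos (Or.inl c1), mul_one]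
      · by_cases c2 : m = k + 1
        · rw [if_neg c1, if_pos (by omega), if_pos (Or.inr ⟨by omega, c2⟩), one_mul]
        · rw [if_neg c1, if_neg (by omega), if_neg (by omega), mul_one]
    · have hmn : m = n := by omega
      subst hmn
      have e1 : a ⟨m, by omega⟩ = θ⁻¹ * b (m - 1) := by
        have := pr_val (n := m) ⟨m, by omega⟩
        have e : (pr m ⟨m, by omega⟩ : ℕ) = m - 1 := by simp only at this; omega
        simp only [a]
        rw [if_neg hm, e]
      have e2 : a ⟨m - 1, by omega⟩ = θ * b (m - 1) := if_pos (show m - 1 < m by omega)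
      rw [e1, e2, mul_inv, mul_mul_mul_comm, ← hθ, hb', hb, mul_one, hθs]
      by_cases c : k + 1 < m
      · rw [if_pos c, if_neg (by omega)]
      · rw [if_neg c, if_pos (by omega)]
  have h := hσ ⟨m, by omega⟩ ⟨m - 1, by omega⟩
  rw [key, ← hx] at h
  rw [h]
  split
  · exact neg_one_smul F (xs n m)
  · exact one_smul F (xs n m)

theorem final (n : ℕ) (hn : 2 ≤ n) (k : ℕ) (hk1 : 1 ≤ k) (hkn : k ≤ n) :
    ∃ β : Utw n ≃ₐ[F] Utw n, IsBeta n k β := by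
  obtain ⟨σ, hσ⟩ := exists_sign hn hk1 hkn
  obtain ⟨β, hβ⟩ := main_gen n k hn hk1 hkn (xs n) (xs_GRel hn) (xs_gen hn) (xs_reg hk1 hkn) σ hσ
  refine ⟨β, fun m x h1 h2 hx => ?_⟩
  obtain rfl : x = xs n m := Subtype.ext hx
  obtain ⟨c1, c2, c3, c4, c5, c6⟩ := hβ m h1 h2
  refine ⟨fun e => ?_, fun e => ?_, fun e e' e'' => ?_, fun e e' e'' => ?_, fun e e' => ?_, fun e e' => ?_⟩
  · exact congrArg Subtype.val (c1 e)
  · exact congrArg Subtype.val (c2 e)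
  · exact congrArg Subtype.val (c3 e e' e'')
  · exact congrArg Subtype.val (c4 e e' e'')
  · exact congrArg Subtype.val (c5 e e')
  · exact congrArg Subtype.val (c6 e e')
end

/-- for each k = 1, …, n there exists an F-algebra automorphism β_k of
    U_q^{tw}(gl_n) acting on the generators s_m = s_{m+1,m} by the prescribed formulas. -/
theorem beta_automorphism_exists (n : ℕ) (hn : 2 ≤ n) (k : ℕ) (hk1 : 1 ≤ k) (hkn : k ≤ n) :
    ∃ β : Utw n ≃ₐ[F] Utw n, IsBeta n k β := by
  exact final n hn k hk1 hkn

end CI
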